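/- Uniform positive independence over fields of bounded type: For every n ≥ 1 there is m = m(n) ≥ 1 such that the following holds. Let 𝕂 be a field and F a subfield of 𝕂 such that 𝕂 is a finite extension of F of degree [𝕂:F] ≤ n, and F is a purely transcendental extension of its prime subfield (i.e. there is a subset of F which is algebraically independent over the prime subfield and generates F as a field extension of the prime subfield). Then for every d ≤ n and every subset Σ ⊆ GL_d(𝕂) with 1 ∈ Σ generating a group that is not virtually nilpotent, Σ^m contains two positively independent elements. -/

import Mathlib

section
open Pointwise

namespace UPI

/-- two elements generate a free semigroup -/
def FreePair {M : Type*} [Monoid M] (a b : M) : Prop :=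
  Function.Injective (FreeMonoid.lift ![a, b] : FreeMonoid (Fin 2) →* M)

theorem FreePair.of_map {M N : Type*} [Monoid M] [Monoid N] (φ : M →* N) {a b : M}
    (h : FreePair (φ a) (φ b)) : FreePair a b := by
  have e : (FreeMonoid.lift ![φ a, φ b] : FreeMonoid (Fin 2) →* N)
      = φ.comp (FreeMonoid.lift ![a, b]) := by
    ext i; fin_cases i <;> simp
  unfold FreePair at h
  rw [e] at h
  exact Function.Injective.of_comp (f := φ) (by simpa using h)

theorem freePair_of_words {G : Type*} [Group G] (a b : G)
    (h1 : ∀ w : FreeMonoid (Fin 2), a * FreeMonoid.lift ![a, b] w ≠ 1)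
    (h2 : ∀ w : FreeMonoid (Fin 2), b * FreeMonoid.lift ![a, b] w ≠ 1)
    (h3 : ∀ w w' : FreeMonoid (Fin 2), a * FreeMonoid.lift ![a, b] w ≠
      b * FreeMonoid.lift ![a, b] w') : FreePair a b := by
  have key : ∀ w w' : FreeMonoid (Fin 2), FreeMonoid.lift ![a, b] w = FreeMonoid.lift ![a, b] w' →
      w = w' := by
    intro w
    induction w using FreeMonoid.inductionOn' with
    | one =>
      intro w' h
      cases w' using FreeMonoid.casesOn with
      | one => rfl
      | of_mul x xs =>
        exfalso
        fin_cases x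
        · exact h1 xs (by simpa using h.symm)
        · exact h2 xs (by simpa using h.symm)
    | of_mul x xs ih =>
      intro w' h
      cases w' using FreeMonoid.casesOn with
      | one =>
        exfalso
        fin_cases x
        · exact h1 xs (by simpa using h)
        · exact h2 xs (by simpa using h)
      | of_mul y ys =>
        fin_cases x <;> fin_cases y
        · have := ih ys (by simpa using h)
          rw [this]
        · exact absurd (by simpa using h) (h3 xs ys)
        · exact absurd (by simpa using h.symm) (h3 ys xs)
        · have := ih ys (by simpa using h)
          rw [this]
  intro w w' h
  exact key w w' h

/-- ping-pong for semigroups; `act` is an action given by functions. -/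
theorem freePair_of_pingpong {G X : Type*} [Group G] (act : G → X → X)
    (hmul : ∀ g h x, act (g * h) x = act g (act h x)) (hone : ∀ x, act 1 x = x)
    (a b : G) (Y A B : Set X) (hY : Y.Nonempty) (hA : A ⊆ Y) (hB : B ⊆ Y)
    (hAB : Disjoint A B) (ha : ∀ y ∈ Y, act a y ∈ A) (hb : ∀ y ∈ Y, act b y ∈ B) :
    FreePair a b := by
  have hw : ∀ w : FreeMonoid (Fin 2), ∀ y ∈ Y, act (FreeMonoid.lift ![a, b] w) y ∈ Y := by
    intro w
    induction w using FreeMonoid.inductionOn' with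
    | one => intro y hy; simpa [hone] using hy
    | of_mul x xs ih =>
      intro y hy
      rw [map_mul, hmul]
      fin_cases x
      · exact hA (by simpa using ha _ (ih y hy))
      · exact hB (by simpa using hb _ (ih y hy))
  rw [Set.disjoint_left] at hAB
  obtain ⟨y, hy⟩ := hY
  apply freePair_of_words
  · intro w h
    have := ha _ (hw w _ (hB (hb y hy)))
    rw [← hmul, h, hone] at this
    exact hAB this (hb y hy)
  · intro w h
    have := hb _ (hw w _ (hA (ha y hy)))
    rw [← hmul, h, hone] at this
    exact hAB (ha y hy) this
  · intro w w' h
    have h1 := ha _ (hw w _ hy)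
    have h2 := hb _ (hw w' _ hy)
    rw [← hmul] at h1 h2
    rw [h] at h1
    exact hAB h1 h2

theorem FreePair.of_inv {G : Type*} [Group G] {a b : G} (h : FreePair a⁻¹ b⁻¹) :
    FreePair a b := by
  have key : ∀ w : FreeMonoid (Fin 2), (FreeMonoid.lift ![a, b] w)⁻¹ =
      FreeMonoid.lift ![a⁻¹, b⁻¹] w.reverse := by
    intro w
    induction w using FreeMonoid.inductionOn' with
    | one => exact inv_one
    | of_mul x xs ih =>
      rw [map_mul, mul_inv_rev, ih, FreeMonoid.reverse_mul, map_mul]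
      congr 1
      fin_cases x <;> simp
  intro w w' hww
  have := congrArg (fun g => g⁻¹) hww
  simp only [key] at this
  have := h this
  simpa using congrArg FreeMonoid.reverse this

/-- projectively free pairs -/
def PFree {E : Type*} [Field E] {M : Type*} [Monoid M] [SMul E M] (a b : M) : Prop :=
  ∀ w w' : FreeMonoid (Fin 2), ∀ c : E, c ≠ 0 →
    FreeMonoid.lift ![a, b] w = c • FreeMonoid.lift ![a, b] w' → w = w'

theorem pfree_of_pingpong {E : Type*} [Field E] {n : Type*} [Fintype n] [DecidableEq n]
    {W : Type*} [AddCommGroup W] [Module E W]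
    (ρ : Matrix n n E →* Module.End E W) (i : ℕ) (hρ : ∀ (c : E) g, ρ (c • g) = c ^ i • ρ g)
    (a b : Matrix n n E) (hau : IsUnit a) (hbu : IsUnit b)
    (Y A B : Set W) (hY : Y.Nonempty) (hA : A ⊆ Y) (hB : B ⊆ Y)
    (hAB : Disjoint A B) (ha : ∀ y ∈ Y, ρ a y ∈ A) (hb : ∀ y ∈ Y, ρ b y ∈ B)
    (hAc : ∀ c : E, c ≠ 0 → ∀ y ∈ A, c • y ∈ A)
    (hBc : ∀ c : E, c ≠ 0 → ∀ y ∈ B, c • y ∈ B) :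
    PFree (E := E) a b := by
  have hw : ∀ w : FreeMonoid (Fin 2), ∀ y ∈ Y, ρ (FreeMonoid.lift ![a, b] w) y ∈ Y := by
    intro w
    induction w using FreeMonoid.inductionOn' with
    | one => intro y hy; simpa using hy
    | of_mul x xs ih =>
      intro y hy
      rw [map_mul, map_mul]
      fin_cases x
      · exact hA (by simpa using ha _ (ih y hy))
      · exact hB (by simpa using hb _ (ih y hy))
  rw [Set.disjoint_left] at hAB
  obtain ⟨y, hy⟩ := hY
  have h1 : ∀ (w : FreeMonoid (Fin 2)) (c : E), c ≠ 0 → a * FreeMonoid.lift ![a, b] w ≠ c • 1 := by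
    intro w c hc h
    have := ha _ (hw w _ (hB (hb y hy)))
    have h' := congrArg (fun g => ρ g (ρ b y)) h
    simp only [map_mul, hρ, map_one, Module.End.mul_apply, LinearMap.smul_apply,
      Module.End.one_apply] at h'
    rw [h'] at this
    exact hAB this (hBc _ (pow_ne_zero _ hc) _ (hb y hy))
  have h2 : ∀ (w : FreeMonoid (Fin 2)) (c : E), c ≠ 0 → b * FreeMonoid.lift ![a, b] w ≠ c • 1 := by
    intro w c hc h
    have := hb _ (hw w _ (hA (ha y hy)))
    have h' := congrArg (fun g => ρ g (ρ a y)) h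
    simp only [map_mul, hρ, map_one, Module.End.mul_apply, LinearMap.smul_apply,
      Module.End.one_apply] at h'
    rw [h'] at this
    exact hAB (hAc _ (pow_ne_zero _ hc) _ (ha y hy)) this
  have h3 : ∀ (w w' : FreeMonoid (Fin 2)) (c : E), c ≠ 0 → a * FreeMonoid.lift ![a, b] w ≠
      c • (b * FreeMonoid.lift ![a, b] w') := by
    intro w w' c hc h
    have h1 := ha _ (hw w _ hy)
    have h2 := hb _ (hw w' _ hy)
    have h' := congrArg (fun g => ρ g y) h
    simp only [map_mul, hρ, Module.End.mul_apply, LinearMap.smul_apply] at h'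
    rw [h'] at h1
    exact hAB h1 (hBc _ (pow_ne_zero _ hc) _ h2)
  have inv : ∀ (c : E), c ≠ 0 → ∀ x y : Matrix n n E, x = c • y → y = c⁻¹ • x := by
    intro c hc x y h
    rw [h, smul_smul, inv_mul_cancel₀ hc, one_smul]
  intro w
  induction w using FreeMonoid.inductionOn' with
  | one =>
    intro w' c hc h
    cases w' using FreeMonoid.casesOn with
    | one => rfl
    | of_mul x xs =>
      exfalso
      have h := inv c hc _ _ h
      fin_cases x
      · exact h1 xs _ (inv_ne_zero hc) (by simpa using h)
      · exact h2 xs _ (inv_ne_zero hc) (by simpa using h)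
  | of_mul x xs ih =>
    intro w' c hc h
    cases w' using FreeMonoid.casesOn with
    | one =>
      exfalso
      fin_cases x
      · exact h1 xs _ hc (by simpa using h)
      · exact h2 xs _ hc (by simpa using h)
    | of_mul y ys =>
      fin_cases x <;> fin_cases y
      · have := ih ys c hc (hau.mul_left_cancel (by simpa using h))
        rw [this]
      · exact absurd (by simpa using h) (h3 xs ys c hc)
      · have h := inv c hc _ _ h
        exact absurd (by simpa using h) (h3 ys xs _ (inv_ne_zero hc))
      · have := ih ys c hc (hbu.mul_left_cancel (by simpa using h))
        rw [this]

end UPI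
end

section
open Pointwise
namespace UPI

theorem levitzki_range {κ : Type*} [Field κ] (n : ℕ) : ∀ (V : Type*) [AddCommGroup V] [Module κ V]
    [FiniteDimensional κ V], Module.finrank κ V = n → 0 < n → ∀ S : Set (Module.End κ V),
    (∀ s ∈ S, ∀ t ∈ S, s * t ∈ S) → (∀ s ∈ S, IsNilpotent s) →
    ∃ R : Submodule κ V, R ≠ ⊤ ∧ ∀ s ∈ S, LinearMap.range s ≤ R := by
  induction n using Nat.strong_induction_on with
  | _ n IH =>
  intro V _ _ _ hn hpos S hmul hnil
  by_cases hS : ∀ s ∈ S, s = 0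
  · refine ⟨⊥, ?_, ?_⟩
    · intro h
      have := finrank_top κ V
      rw [← h, finrank_bot] at this
      omega
    · intro s hs
      rw [hS s hs, LinearMap.range_zero]
  push Not at hS
  -- minimal rank
  obtain ⟨x, ⟨hxS, hx0⟩, hmin⟩ : ∃ x, (x ∈ S ∧ x ≠ 0) ∧ ∀ y, (y ∈ S ∧ y ≠ 0) →
      Module.finrank κ (LinearMap.range x) ≤ Module.finrank κ (LinearMap.range y) := by
    obtain ⟨x, hx⟩ := hS
    have hne : ({x | x ∈ S ∧ x ≠ 0} : Set (Module.End κ V)).Nonempty := ⟨x, hx⟩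
    refine ⟨Function.argminOn (fun y : Module.End κ V => Module.finrank κ (LinearMap.range y)) _ hne,
      Function.argminOn_mem _ _ hne, ?_⟩
    intro y hy
    exact Function.argminOn_le (fun y : Module.End κ V => Module.finrank κ (LinearMap.range y)) _ hy
  -- general claim : t ∈ S, t * x ∈ S → x t x = 0
  have claim : ∀ t ∈ S, t * x = 0 ∨ ¬ (LinearMap.range (t * x) = LinearMap.range x) := by
    intro t ht
    by_contra hcon
    push Not at hcon
    obtain ⟨h0, hr⟩ := hcon
    have hm : Submodule.map t (LinearMap.range x) = LinearMap.range x := by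
      rw [← hr]
      conv_rhs => rw [hr]
      rw [hr, ← LinearMap.range_comp]; exact hr
    have hp : ∀ k : ℕ, Submodule.map (t ^ k) (LinearMap.range x) = LinearMap.range x := by
      intro k
      induction k with
      | zero => simp [Module.End.one_eq_id]
      | succ k ih =>
        rw [pow_succ, Module.End.mul_eq_comp, Submodule.map_comp, hm, ih]
    obtain ⟨k, hk⟩ := hnil t ht
    have := hp k
    rw [hk, Submodule.map_zero] at this
    exact hx0 (LinearMap.range_eq_bot.mp this.symm)
  have zero_of_le : ∀ t ∈ S, t * x ∈ S → LinearMap.range (t * x) ≤ LinearMap.range x → t * x = 0 := by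
    intro t ht htx hle
    rcases claim t ht with h | h
    · exact h
    · by_contra h0
      exact h (Submodule.eq_of_le_of_finrank_le hle (hmin _ ⟨htx, h0⟩))
  have hxx : x * x = 0 := zero_of_le x hxS (hmul _ hxS _ hxS) (by
    rw [Module.End.mul_eq_comp]; exact LinearMap.range_comp_le_range _ _)
  have hxsx : ∀ s ∈ S, x * s * x = 0 := fun s hs =>
    zero_of_le (x * s) (hmul _ hxS _ hs) (hmul _ (hmul _ hxS _ hs) _ hxS) (by
      rw [mul_assoc, Module.End.mul_eq_comp]; exact LinearMap.range_comp_le_range _ _)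
  let U : Submodule κ V := LinearMap.range x ⊔ ⨆ s ∈ S, LinearMap.range (s * x)
  have hUker : U ≤ LinearMap.ker x := by
    refine sup_le ?_ (iSup₂_le ?_)
    · rintro _ ⟨v, rfl⟩
      exact congrArg (fun f => f v) hxx
    · rintro s hs _ ⟨v, rfl⟩
      exact congrArg (fun f => f v) (hxsx s hs)
  have hUtop : U ≠ ⊤ := by
    intro h
    apply hx0
    rw [h, top_le_iff] at hUker
    exact LinearMap.ker_eq_top.mp hUker
  have hUbot : U ≠ ⊥ := by
    intro h
    apply hx0
    rw [← LinearMap.range_eq_bot, eq_bot_iff, ← h]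
    exact le_sup_left
  have hUinv : ∀ s ∈ S, U ≤ U.comap s := by
    intro s hs
    refine sup_le ?_ (iSup₂_le ?_)
    · rintro _ ⟨v, rfl⟩
      exact Submodule.mem_sup_right (Submodule.mem_iSup_of_mem s (Submodule.mem_iSup_of_mem hs ⟨v, rfl⟩))
    · rintro t ht _ ⟨v, rfl⟩
      exact Submodule.mem_sup_right (Submodule.mem_iSup_of_mem (s * t)
        (Submodule.mem_iSup_of_mem (hmul _ hs _ ht) ⟨v, rfl⟩))
  have hlt : Module.finrank κ (V ⧸ U) < n := by
    have h1 := Submodule.finrank_quotient_add_finrank U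
    have h2 : 0 < Module.finrank κ U := by
      rw [Nat.pos_iff_ne_zero]; intro h; exact hUbot (Submodule.finrank_eq_zero.mp h)
    omega
  have hpos' : 0 < Module.finrank κ (V ⧸ U) := by
    have h1 := Submodule.finrank_quotient_add_finrank U
    have h2 := Submodule.finrank_lt hUtop
    omega
  obtain ⟨R, hR, hRS⟩ := IH _ hlt (V ⧸ U) rfl hpos'
    {q | ∃ s, ∃ hs : s ∈ S, q = U.mapQ U s (hUinv s hs)} (by
      rintro _ ⟨s, hs, rfl⟩ _ ⟨t, ht, rfl⟩
      refine ⟨s * t, hmul _ hs _ ht, ?_⟩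
      ext v; rfl) (by
      rintro _ ⟨s, hs, rfl⟩
      obtain ⟨k, hk⟩ := hnil s hs
      refine ⟨k, ?_⟩
      have : ∀ k : ℕ, ∀ v, (U.mapQ U s (hUinv s hs) ^ k) (U.mkQ v) = U.mkQ ((s ^ k) v) := by
        intro k
        induction k with
        | zero => intro v; rfl
        | succ k ih => intro v; rw [pow_succ, pow_succ, Module.End.mul_apply, Module.End.mul_apply,
                        ← ih]; rfl
      ext v
      have := this k v
      rw [hk] at this
      simpa using this)
  refine ⟨R.comap U.mkQ, ?_, ?_⟩
  · intro h
    apply hR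
    rw [eq_top_iff]
    rintro q -
    obtain ⟨v, rfl⟩ := U.mkQ_surjective q
    have : v ∈ R.comap U.mkQ := by rw [h]; trivial
    exact this
  · rintro s hs _ ⟨v, rfl⟩
    exact hRS _ ⟨s, hs, rfl⟩ ⟨U.mkQ v, rfl⟩

/-- Levitzki: simultaneous strict triangularization -/
theorem levitzki_basis {κ : Type*} [Field κ] (n : ℕ) : ∀ (V : Type*) [AddCommGroup V] [Module κ V]
    [FiniteDimensional κ V], Module.finrank κ V = n → ∀ S : Set (Module.End κ V),
    (∀ s ∈ S, ∀ t ∈ S, s * t ∈ S) → (∀ s ∈ S, IsNilpotent s) →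
    ∃ b : Module.Basis (Fin n) κ V, ∀ s ∈ S, ∀ i j, i ≤ j → b.repr (s (b j)) i = 0 := by
  induction n with
  | zero =>
    intro V _ _ _ hn S _ _
    exact ⟨Module.finBasisOfFinrankEq κ V hn, fun s _ i => i.elim0⟩
  | succ n IH =>
    intro V _ _ _ hn S hmul hnil
    obtain ⟨R, hR, hRS⟩ := levitzki_range (n + 1) V hn (Nat.succ_pos _) S hmul hnil
    obtain ⟨φ, hφ0, hφ⟩ := Submodule.exists_le_ker_of_lt_top R (lt_top_iff_ne_top.mpr hR)
    let N := LinearMap.ker φ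
    have hsurj : Function.Surjective φ := LinearMap.surjective hφ0
    have hN : Module.finrank κ N = n := by
      have := LinearMap.finrank_range_add_finrank_ker φ
      rw [LinearMap.range_eq_top.mpr hsurj, finrank_top, Module.finrank_self] at this
      change Module.finrank κ (LinearMap.ker φ) = n
      omega
    have hinv : ∀ s ∈ S, ∀ v, s v ∈ N := fun s hs v => hφ (hRS s hs ⟨v, rfl⟩)
    obtain ⟨b, hb⟩ := IH N hN {q | ∃ s, ∃ hs : s ∈ S, q = s.restrict (fun v _ => hinv s hs v)} (by
      rintro _ ⟨s, hs, rfl⟩ _ ⟨t, ht, rfl⟩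
      exact ⟨s * t, hmul _ hs _ ht, rfl⟩) (by
      rintro _ ⟨s, hs, rfl⟩
      obtain ⟨k, hk⟩ := hnil s hs
      refine ⟨k, ?_⟩
      have : ∀ k : ℕ, ∀ v : N, (((s.restrict (fun v _ => hinv s hs v) : Module.End κ N) ^ k) v : V)
          = (s ^ k) (v : V) := by
        intro k
        induction k with
        | zero => intro v; rfl
        | succ k ih => intro v; rw [pow_succ, pow_succ, Module.End.mul_apply, Module.End.mul_apply,
                        ih]; rfl
      ext v
      rw [this k v, hk]; rfl)
    obtain ⟨y, hy⟩ := hsurj 1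
    have hc1 : ∀ (c : κ), ∀ x ∈ N, c • y + x = 0 → c = 0 := by
      intro c x hx h
      have := congrArg φ h
      rw [map_add, map_smul, hy, LinearMap.mem_ker.mp hx] at this
      simpa using this
    have hc2 : ∀ z : V, ∃ c : κ, z + c • y ∈ N := by
      intro z
      refine ⟨-φ z, ?_⟩
      rw [LinearMap.mem_ker, map_add, map_smul, hy]; simp
    let B := Module.Basis.mkFinCons y b hc1 hc2
    have hBs : ∀ i : Fin n, B i.succ = (b i : V) := by
      intro i; simp [B, Module.Basis.coe_mkFinCons]
    have hB0 : B 0 = y := by simp [B, Module.Basis.coe_mkFinCons]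
    have key : ∀ (x : V) (hx : x ∈ N), B.repr x 0 = 0 ∧ ∀ i : Fin n, B.repr x i.succ = b.repr ⟨x, hx⟩ i := by
      intro x hx
      have h1 : x = ∑ i, b.repr ⟨x, hx⟩ i • B i.succ := by
        have := congrArg (Subtype.val) (b.sum_repr ⟨x, hx⟩)
        simp only [hBs]
        rw [Submodule.coe_sum] at this
        simpa using this.symm
      have h2 : x = ∑ i : Fin (n+1), (Fin.cons 0 (fun i => b.repr ⟨x, hx⟩ i) : Fin (n+1) → κ) i • B i := by
        rw [Fin.sum_univ_succ]; simpa using h1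
      have h3 : ∀ i, B.repr x i = (Fin.cons 0 (fun i => b.repr ⟨x, hx⟩ i) : Fin (n+1) → κ) i := by
        intro i
        conv_lhs => rw [h2]
        rw [B.repr_sum_self]
      exact ⟨by rw [h3]; rfl, fun i => by rw [h3]; rfl⟩
    refine ⟨B, ?_⟩
    intro s hs i j hij
    have hk := key (s (B j)) (hinv s hs _)
    induction i using Fin.cases with
    | zero => exact hk.1
    | succ i =>
      rw [hk.2]
      induction j using Fin.cases with
      | zero => exact absurd hij (by simp)
      | succ j =>
        have := hb _ ⟨s, hs, rfl⟩ i j (by simpa using hij)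
        convert this using 3
        ext
        simp [hBs]

theorem levitzki_matrix {κ : Type*} [Field κ] (n : ℕ) (S : Set (Matrix (Fin n) (Fin n) κ))
    (hmul : ∀ s ∈ S, ∀ t ∈ S, s * t ∈ S) (hnil : ∀ s ∈ S, IsNilpotent s) :
    ∃ P Q : Matrix (Fin n) (Fin n) κ, P * Q = 1 ∧ Q * P = 1 ∧
      ∀ s ∈ S, ∀ i j, i ≤ j → (P * s * Q) i j = 0 := by
  let φ := Matrix.toLinAlgEquiv' (R := κ) (n := Fin n)
  obtain ⟨b, hb⟩ := levitzki_basis n (Fin n → κ) (by simp) (φ '' S) (by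
    rintro _ ⟨s, hs, rfl⟩ _ ⟨t, ht, rfl⟩
    exact ⟨s * t, hmul _ hs _ ht, map_mul φ s t⟩) (by
    rintro _ ⟨s, hs, rfl⟩
    exact (hnil s hs).map φ)
  let c := Pi.basisFun κ (Fin n)
  refine ⟨b.toMatrix c, c.toMatrix b, Module.Basis.toMatrix_mul_toMatrix_flip _ _,
    Module.Basis.toMatrix_mul_toMatrix_flip _ _, ?_⟩
  intro s hs i j hij
  have h1 := hb _ ⟨s, hs, rfl⟩ i j hij
  have h2 : b.toMatrix c * s * c.toMatrix b = LinearMap.toMatrix b b (Matrix.toLin' s) := by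
    have : s = LinearMap.toMatrix c c (Matrix.toLin' s) := by
      rw [LinearMap.toMatrix_eq_toMatrix', LinearMap.toMatrix'_toLin']
    conv_lhs => rw [this]
    exact basis_toMatrix_mul_linearMap_toMatrix_mul_basis_toMatrix _ _ _ _ _
  rw [h2, LinearMap.toMatrix_apply]
  exact h1

end UPI
end

section
open Pointwise
namespace UPI

section scale
variable {E : Type} [Field E] [IsAlgClosed E] (w : AbsoluteValue E ℝ)

theorem exists_scale (hw : ∃ x, 1 < w x) (t : ℝ) (ht : 0 < t) : ∃ z : E, t ≤ w z ∧ w z ≤ 2 * t := by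
  obtain ⟨x, hx⟩ := hw
  obtain ⟨n, hn⟩ := pow_unbounded_of_one_lt (w x) (one_lt_two (α := ℝ))
  have hn0 : n ≠ 0 := by rintro rfl; simp at hn; linarith
  obtain ⟨y, hy⟩ := IsAlgClosed.exists_pow_nat_eq x (Nat.pos_of_ne_zero hn0)
  have hy1 : w y ^ n = w x := by rw [← map_pow, hy]
  have hy2 : w y < 2 := by
    by_contra h
    push Not at h
    have := pow_le_pow_left₀ (by norm_num) h n
    linarith
  have hy3 : 1 < w y := by
    by_contra h
    push Not at h
    have := pow_le_one₀ (w.nonneg y) h (n := n)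
    linarith
  obtain ⟨k, hk1, hk2⟩ := exists_mem_Ioc_zpow ht hy3
  refine ⟨y ^ (k + 1), ?_, ?_⟩
  · rw [map_zpow₀]; exact hk2
  · rw [map_zpow₀, zpow_add_one₀ (by linarith)]
    have : 0 < w y ^ k := zpow_pos (by linarith) k
    nlinarith

theorem exists_roots_fin {E : Type} [Field E] [IsAlgClosed E] (D : ℕ) (p : Polynomial E) (hm : p.Monic) (hd : p.natDegree = D) :
    ∃ r : Fin D → E, p = ∏ i, (Polynomial.X - Polynomial.C (r i)) := by
  have hs : p.Splits := IsAlgClosed.splits p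
  have hcard : p.roots.card = D := by rw [← hd]; exact hs.natDegree_eq_card_roots.symm
  have hl : p.roots.toList.length = D := by simpa using hcard
  subst hl
  refine ⟨fun i => p.roots.toList.get i, ?_⟩
  conv_lhs => rw [hs.eq_prod_roots, hm.leadingCoeff]
  simp only [map_one, one_mul]
  conv_lhs => rw [← Multiset.coe_toList p.roots]
  rw [Multiset.map_coe, Multiset.prod_coe]
  exact (Fin.prod_univ_fun_getElem p.roots.toList _).symm
end scale

section ring
variable {ι : Type} {E : ι → Type} [∀ j, Field (E j)] (w : ∀ j, AbsoluteValue (E j) ℝ)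
  (c : ι → ℝ) (hc : ∀ j, 2 ≤ c j)

/-- sequences bounded by a power of `c` -/
def Obd : Subring (∀ j, E j) where
  carrier := {x | ∃ M : ℕ, ∀ j, w j (x j) ≤ c j ^ M}
  mul_mem' := by
    rintro x y ⟨M, hM⟩ ⟨M', hM'⟩
    refine ⟨M + M', fun j => ?_⟩
    rw [Pi.mul_apply, map_mul, pow_add]
    exact mul_le_mul (hM j) (hM' j) ((w j).nonneg _) (pow_nonneg (by linarith [hc j]) _)
  one_mem' := ⟨0, fun j => by simp⟩
  add_mem' := by
    rintro x y ⟨M, hM⟩ ⟨M', hM'⟩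
    refine ⟨max M M' + 1, fun j => ?_⟩
    have h1 : c j ^ M ≤ c j ^ (max M M') := pow_le_pow_right₀ (by linarith [hc j]) (le_max_left _ _)
    have h2 : c j ^ M' ≤ c j ^ (max M M') := pow_le_pow_right₀ (by linarith [hc j]) (le_max_right _ _)
    have h3 : 0 < c j ^ (max M M') := pow_pos (by linarith [hc j]) _
    have := (w j).add_le (x j) (y j)
    have := hM j
    have := hM' j
    have := hc j
    rw [Pi.add_apply, pow_succ]
    nlinarith
  zero_mem' := ⟨0, fun j => by simp⟩
  neg_mem' := by
    rintro x ⟨M, hM⟩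
    exact ⟨M, fun j => by simpa using hM j⟩

theorem mem_Obd {x : ∀ j, E j} : x ∈ Obd w c hc ↔ ∃ M : ℕ, ∀ j, w j (x j) ≤ c j ^ M := Iff.rfl

/-- evaluation at `j` -/
def evO (j : ι) : Obd w c hc →+* E j := (Pi.evalRingHom E j).comp (Obd w c hc).subtype

@[simp] theorem evO_apply (j : ι) (x : Obd w c hc) : evO w c hc j x = x.1 j := rfl

theorem Obd_ext {x y : Obd w c hc} (h : ∀ j, evO w c hc j x = evO w c hc j y) : x = y :=
  Subtype.ext (funext h)

theorem Obd_poly_ext {p q : Polynomial (Obd w c hc)}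
    (h : ∀ j, p.map (evO w c hc j) = q.map (evO w c hc j)) : p = q := by
  ext n : 1
  apply Obd_ext
  intro j
  have := congrArg (fun r => r.coeff n) (h j)
  simpa [Polynomial.coeff_map] using this

theorem Obd_mat_ext {m n : Type*} {p q : Matrix m n (Obd w c hc)}
    (h : ∀ j, p.map (evO w c hc j) = q.map (evO w c hc j)) : p = q := by
  funext a b
  apply Obd_ext
  intro j
  exact congrFun (congrFun (h j) a) b

/-- build a matrix over Obd -/
theorem Obd_mat_exists {m n : Type*} [Fintype m] [Fintype n] (A : ∀ j, Matrix m n (E j)) (M : ℕ)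
    (hA : ∀ j a b, w j (A j a b) ≤ c j ^ M) : ∃ B : Matrix m n (Obd w c hc),
      ∀ j, B.map (evO w c hc j) = A j :=
  ⟨fun a b => ⟨fun j => A j a b, M, fun j => hA j a b⟩, fun _ => rfl⟩

theorem Obd_mat_bound {m n : Type*} [Fintype m] [Fintype n] (A : Matrix m n (Obd w c hc)) :
    ∃ M : ℕ, ∀ j a b, w j (A.map (evO w c hc j) a b) ≤ c j ^ M := by
  choose f hf using fun a b => (A a b).2
  refine ⟨∑ a, ∑ b, f a b, fun j a b => (hf a b j).trans ?_⟩
  apply pow_le_pow_right₀ (by linarith [hc j])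
  exact (Finset.single_le_sum (f := fun b => f a b) (fun _ _ => Nat.zero_le _)
    (Finset.mem_univ b)).trans (Finset.single_le_sum (f := fun a => ∑ b, f a b)
      (fun _ _ => Nat.zero_le _) (Finset.mem_univ a))

/-- a sequence that is bounded below by negative powers is a unit -/
theorem Obd_isUnit (x : Obd w c hc) (M : ℕ) (h : ∀ j, 1 ≤ w j (x.1 j) * c j ^ M) : IsUnit x := by
  have h0 : ∀ j, x.1 j ≠ 0 := by
    intro j h0
    have := h j
    rw [h0, map_zero, zero_mul] at this
    linarith
  refine IsUnit.of_mul_eq_one (⟨fun j => (x.1 j)⁻¹, M, fun j => ?_⟩ : Obd w c hc) ?_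
  · rw [map_inv₀]
    have hp : 0 < w j (x.1 j) := (w j).pos (h0 j)
    rw [inv_le_iff_one_le_mul₀ hp]; linarith [h j]
  · apply Obd_ext
    intro j
    simp [h0 j]
end ring
theorem isRoot_charpoly_iff {E : Type*} [Field E] {n : Type*} [Fintype n] [DecidableEq n]
    (A : Matrix n n E) (μ : E) : A.charpoly.IsRoot μ ↔ ∃ v, v ≠ 0 ∧ A.mulVec v = μ • v := by
  rw [Polynomial.IsRoot, Matrix.eval_charpoly, ← Matrix.exists_mulVec_eq_zero_iff]
  refine exists_congr fun v => and_congr_right fun _ => ?_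
  rw [Matrix.sub_mulVec, sub_eq_zero, Matrix.scalar_apply, ← Matrix.smul_one_eq_diagonal,
    Matrix.smul_mulVec, Matrix.one_mulVec, eq_comm]

theorem mat_mul_bound {E : Type*} [Field E] (w : AbsoluteValue E ℝ) {m n o : Type*} [Fintype n]
    (A : Matrix m n E) (B : Matrix n o E) (α β : ℝ) (hα : 0 ≤ α)
    (hA : ∀ a b, w (A a b) ≤ α) (hB : ∀ a b, w (B a b) ≤ β) (a b) :
    w ((A * B) a b) ≤ Fintype.card n * (α * β) := by
  rw [Matrix.mul_apply]
  refine (w.sum_le _ _).trans ?_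
  refine (Finset.sum_le_card_nsmul _ _ (α * β) ?_).trans ?_
  · intro k _
    rw [map_mul]
    exact mul_le_mul (hA _ _) (hB _ _) (w.nonneg _) hα
  · simp

section levi
open Filter
variable {E : ℕ → Type} [∀ j, Field (E j)] (w : ∀ j, AbsoluteValue (E j) ℝ)

/-- bounded sequences -/
abbrev OB := Obd w (fun _ => (2:ℝ)) (fun _ => le_refl _)

/-- infinitesimals -/
def infI : Ideal (OB w) where
  carrier := {x | Tendsto (fun j => w j (x.1 j)) (hyperfilter ℕ : Filter ℕ) (nhds 0)}
  add_mem' := by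
    intro x y hx hy
    have := Tendsto.add hx hy
    rw [add_zero] at this
    exact squeeze_zero (fun j => (w j).nonneg _) (fun j => (w j).add_le _ _) this
  zero_mem' := by
    simp
  smul_mem' := by
    intro y x hx
    obtain ⟨M, hM⟩ := y.2
    have := Tendsto.const_mul ((2:ℝ) ^ M) hx
    rw [mul_zero] at this
    refine squeeze_zero (fun j => (w j).nonneg _) (fun j => ?_) this
    change w j (y.1 j * x.1 j) ≤ _
    rw [map_mul]
    exact mul_le_mul_of_nonneg_right (hM j) ((w j).nonneg _)

theorem mem_infI {x : OB w} : x ∈ infI w ↔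
    Tendsto (fun j => w j (x.1 j)) (hyperfilter ℕ : Filter ℕ) (nhds 0) := Iff.rfl

theorem infI_inv {x : OB w} (hx : x ∉ infI w) : ∃ y : OB w,
    ∀ᶠ j in (hyperfilter ℕ : Filter ℕ), x.1 j * y.1 j = 1 := by
  rw [mem_infI, Metric.tendsto_nhds] at hx
  push Not at hx
  obtain ⟨ε, hε, hx⟩ := hx
  obtain ⟨n, hn⟩ := pow_unbounded_of_one_lt (ε⁻¹) (one_lt_two (α := ℝ))
  classical
  refine ⟨⟨fun j => if ε ≤ w j (x.1 j) then (x.1 j)⁻¹ else 0, n, fun j => ?_⟩, ?_⟩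
  · beta_reduce
    split_ifs with h
    · rw [map_inv₀]
      exact (inv_anti₀ hε h).trans hn.le
    · simp
  · filter_upwards [hx] with j hj
    have h : ε ≤ w j (x.1 j) := by simpa [abs_of_nonneg ((w j).nonneg _)] using hj
    beta_reduce
    rw [if_pos h]
    apply mul_inv_cancel₀
    intro h0
    rw [h0, map_zero] at h
    linarith

theorem infI_of_eventually {x y : OB w} (h : ∀ᶠ j in (hyperfilter ℕ : Filter ℕ), x.1 j = y.1 j) :
    x - y ∈ infI w := by
  rw [mem_infI]
  apply tendsto_const_nhds.congr'
  filter_upwards [h] with j hj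
  change 0 = w j (x.1 j - y.1 j)
  rw [hj]; simp

instance infI_maximal : (infI w).IsMaximal := by
  rw [Ideal.isMaximal_iff]
  constructor
  · intro h
    rw [mem_infI] at h
    simp at h
  · intro J x hJ hx hxJ
    obtain ⟨y, hy⟩ := infI_inv w hx
    have h1 : x * y - 1 ∈ infI w := infI_of_eventually w hy
    have h2 : x * y ∈ J := J.mul_mem_right y hxJ
    have := J.sub_mem h2 (hJ h1)
    simpa using this

theorem JN_seq (D : ℕ) [∀ j, IsAlgClosed (E j)] (hw : ∀ j, ∃ x, 1 < w j x)
    (S : ∀ j, Set (Matrix (Fin D) (Fin D) (E j)))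
    (h1 : ∀ j, ∀ s ∈ S j, ∀ a b, w j (s a b) ≤ 1)
    (h2 : ∀ j ℓ, 1 ≤ ℓ → ℓ ≤ j + 1 → ∀ x ∈ S j ^ ℓ, ∀ μ : E j, x.charpoly.IsRoot μ →
      w j μ ≤ 1 / (j + 1))
    (h3 : ∀ j, ∀ P Q : Matrix (Fin D) (Fin D) (E j), P * Q = 1 → 
      ∃ s ∈ S j, ∃ a b, 1 / 8 < w j ((P * s * Q) a b)) : False := by
  let _ := Ideal.Quotient.field (infI w)
  let q := Ideal.Quotient.mk (infI w)
  let ev := evO w (fun _ => (2:ℝ)) (fun _ => le_refl _)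
  -- words
  let T : Set (Matrix (Fin D) (Fin D) (OB w ⧸ infI w)) :=
    {t | ∃ ℓ, 1 ≤ ℓ ∧ ∃ s : Matrix (Fin D) (Fin D) (OB w), t = s.map q ∧
      ∀ j, s.map (ev j) ∈ S j ^ ℓ}
  have hTmul : ∀ s ∈ T, ∀ t ∈ T, s * t ∈ T := by
    rintro _ ⟨ℓ, hℓ, s, rfl, hs⟩ _ ⟨ℓ', hℓ', t, rfl, ht⟩
    refine ⟨ℓ + ℓ', by omega, s * t, by rw [Matrix.map_mul], fun j => ?_⟩
    rw [Matrix.map_mul, pow_add]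
    exact Set.mul_mem_mul (hs j) (ht j)
  have hTnil : ∀ s ∈ T, IsNilpotent s := by
    rintro _ ⟨ℓ, hℓ, s, rfl, hs⟩
    choose r hr using fun j => exists_roots_fin D (s.map (ev j)).charpoly (Matrix.charpoly_monic _)
      (by rw [Matrix.charpoly_natDegree_eq_dim]; simp)
    have hroot : ∀ j a, (s.map (ev j)).charpoly.IsRoot (r j a) := by
      intro j a
      rw [hr j, Polynomial.IsRoot, Polynomial.eval_prod]
      exact Finset.prod_eq_zero (Finset.mem_univ a) (by simp)
    -- bound on roots: pass to the large j
    have hb : ∀ j, ℓ ≤ j + 1 → ∀ a, w j (r j a) ≤ 1 / (j + 1) := fun j hj a =>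
      h2 j ℓ hℓ hj _ (hs j) _ (hroot j a)
    let r' : Fin D → OB w := fun a => ⟨fun j => if ℓ ≤ j + 1 then r j a else 0, 0, fun j => by
      beta_reduce
      split_ifs with h
      · refine (hb j h a).trans ?_
        rw [pow_zero, div_le_one (by positivity)]
        have : (0:ℝ) ≤ j := Nat.cast_nonneg j
        linarith
      · simp⟩
    have hr' : ∀ a, q (r' a) = 0 := by
      intro a
      rw [Ideal.Quotient.eq_zero_iff_mem, mem_infI]
      have : Tendsto (fun j : ℕ => (1:ℝ) / (j + 1)) (hyperfilter ℕ : Filter ℕ) (nhds 0) :=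
        (tendsto_one_div_add_atTop_nhds_zero_nat (𝕜 := ℝ)).mono_left (Nat.hyperfilter_le_atTop)
      refine squeeze_zero (fun j => (w j).nonneg _) (fun j => ?_) this
      change w j (if ℓ ≤ j + 1 then r j a else 0) ≤ _
      split_ifs with h
      · exact hb j h a
      · rw [map_zero]; positivity
    have hcp : (s.map q).charpoly = Polynomial.X ^ D := by
      have e1 : (∏ a, (Polynomial.X - Polynomial.C (r' a))).map q = Polynomial.X ^ D := by
        simp [Polynomial.map_prod, hr']
      rw [← e1, Matrix.charpoly_map]
      ext n : 1
      rw [Polynomial.coeff_map, Polynomial.coeff_map, ← sub_eq_zero, ← map_sub,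
        Ideal.Quotient.eq_zero_iff_mem]
      apply infI_of_eventually
      have : ∀ᶠ j in (hyperfilter ℕ : Filter ℕ), ℓ ≤ j + 1 :=
        Nat.hyperfilter_le_atTop (eventually_atTop.mpr ⟨ℓ, fun j hj => by omega⟩)
      filter_upwards [this] with j hj
      have e2 : s.charpoly.map (ev j) = (∏ a, (Polynomial.X - Polynomial.C (r' a))).map (ev j) := by
        rw [← Matrix.charpoly_map, hr j, Polynomial.map_prod]
        apply Finset.prod_congr rfl
        intro a _
        simp [r', ev, hj]
      have := congrArg (fun p => p.coeff n) e2
      simpa [Polynomial.coeff_map, ev] using this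
    refine ⟨D, ?_⟩
    have := Matrix.aeval_self_charpoly (s.map q)
    rw [hcp] at this
    simpa using this
  obtain ⟨P₀, Q₀, hPQ, hQP, htri⟩ := levitzki_matrix D T hTmul hTnil
  -- lift
  obtain ⟨P, rfl⟩ : ∃ P : Matrix (Fin D) (Fin D) (OB w), P.map q = P₀ :=
    ⟨fun a b => Function.surjInv (Ideal.Quotient.mk_surjective) (P₀ a b), by
      funext a b; exact Function.surjInv_eq _ _⟩
  have hdet : P.det ∉ infI w := by
    rw [← Ideal.Quotient.eq_zero_iff_mem]
    intro h
    have e : (P.map q).det = 0 := by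
      rw [← h]; exact (RingHom.map_det q P).symm
    have := congrArg Matrix.det hPQ
    rw [Matrix.det_mul, e] at this
    simp at this
  obtain ⟨y, hy⟩ := infI_inv w hdet
  let Q : Matrix (Fin D) (Fin D) (OB w) := y • P.adjugate
  have hPQe : ∀ᶠ j in (hyperfilter ℕ : Filter ℕ), P.map (ev j) * Q.map (ev j) = 1 := by
    filter_upwards [hy] with j hj
    have : P * Q = (P.det * y) • 1 := by
      rw [Matrix.mul_smul, Matrix.mul_adjugate, smul_smul, mul_comm]
    rw [← Matrix.map_mul, this]
    have hj' : ev j (P.det * y) = 1 := hj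
    ext a b
    simp only [Matrix.map_apply, Matrix.smul_apply, smul_eq_mul, map_mul]
    rw [← map_mul (ev j) P.det y, hj', one_mul, Matrix.one_apply, Matrix.one_apply]
    split_ifs <;> simp
  have hQq : Q.map q = Q₀ := by
    have hy1 : q (P.det * y) = 1 := by
      rw [← sub_eq_zero, ← map_one q, ← map_sub, Ideal.Quotient.eq_zero_iff_mem]
      exact infI_of_eventually w hy
    have : P.map q * Q.map q = 1 := by
      have : P * Q = (P.det * y) • 1 := by
        rw [Matrix.mul_smul, Matrix.mul_adjugate, smul_smul, mul_comm]
      rw [← Matrix.map_mul, this]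
      ext a b
      simp only [Matrix.map_apply, Matrix.smul_apply, smul_eq_mul, map_mul]
      rw [← map_mul q P.det y, hy1, one_mul, Matrix.one_apply, Matrix.one_apply]
      split_ifs <;> simp
    calc Q.map q = Q₀ * P.map q * Q.map q := by rw [hQP, one_mul]
      _ = Q₀ := by rw [mul_assoc, this, mul_one]
  -- bounds
  obtain ⟨MP, hMP⟩ := Obd_mat_bound w _ (fun _ => le_refl _) P
  obtain ⟨MQ, hMQ⟩ := Obd_mat_bound w _ (fun _ => le_refl _) Q
  have hC : ∀ j, ∀ s ∈ S j, ∀ a b, w j ((P.map (ev j) * s * Q.map (ev j)) a b) ≤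
      D * (D * (2 ^ MP * 1) * 2 ^ MQ) := by
    intro j s hs a b
    have e1 := mat_mul_bound (w j) (P.map (ev j)) s (2 ^ MP) 1 (by positivity) (hMP j) (h1 j s hs)
    have := mat_mul_bound (w j) _ (Q.map (ev j)) _ (2 ^ MQ) (by positivity) e1 (hMQ j) a b
    simpa using this
  set C : ℝ := D * (D * (2 ^ MP * 1) * 2 ^ MQ) with hCdef
  have hC0 : 0 ≤ C := by positivity
  obtain ⟨τ, hτ0, hτ1, hτC⟩ : ∃ τ : ℝ, 0 < τ ∧ 2 * τ ≤ 1 ∧ 2 * τ * C ≤ 1 / 8 := by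
    refine ⟨1 / (16 * (C + 1)), by positivity, ?_, ?_⟩
    · rw [mul_one_div, div_le_one (by positivity)]; linarith
    · rw [mul_one_div, div_mul_eq_mul_div, div_le_iff₀ (by positivity)]; linarith
  choose t ht1 ht2 using fun j => exists_scale (w j) (hw j) τ hτ0
  have ht0 : ∀ j, t j ≠ 0 := by
    intro j h
    have := ht1 j
    rw [h, map_zero] at this
    linarith
  let P' : ∀ j, Matrix (Fin D) (Fin D) (E j) := fun j =>
    Matrix.diagonal (fun a : Fin D => t j ^ (a : ℕ)) * P.map (ev j)
  let Q' : ∀ j, Matrix (Fin D) (Fin D) (E j) := fun j =>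
    Q.map (ev j) * Matrix.diagonal (fun a : Fin D => (t j ^ (a : ℕ))⁻¹)
  have hPQpr : ∀ j, P.map (ev j) * Q.map (ev j) = 1 → P' j * Q' j = 1 := by
    intro j hj
    have : P' j * Q' j = Matrix.diagonal (fun a : Fin D => t j ^ (a : ℕ)) * (P.map (ev j) * Q.map (ev j)) *
      Matrix.diagonal (fun a : Fin D => (t j ^ (a : ℕ))⁻¹) := by simp only [P', Q', mul_assoc]
    rw [this, hj, mul_one, Matrix.diagonal_mul_diagonal, ← Matrix.diagonal_one]
    congr 1
    funext a
    exact mul_inv_cancel₀ (pow_ne_zero _ (ht0 j))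
  have hsel : ∀ j, ∃ s ∈ S j, P.map (ev j) * Q.map (ev j) = 1 → ∃ a b,
      1 / 8 < w j ((P' j * s * Q' j) a b) := by
    intro j
    by_cases hj : P.map (ev j) * Q.map (ev j) = 1
    · obtain ⟨s, hs, h⟩ := h3 j _ _ (hPQpr j hj)
      exact ⟨s, hs, fun _ => h⟩
    · obtain ⟨s, hs, h⟩ := h3 j 1 1 (one_mul 1)
      exact ⟨s, hs, fun h => absurd h hj⟩
  choose s hsS hs using hsel
  obtain ⟨sO, hsO⟩ := Obd_mat_exists w (fun _ => (2:ℝ)) (fun _ => le_refl _) s 0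
    (fun j a b => by simpa using h1 j _ (hsS j) a b)
  have hsT : sO.map q ∈ T := ⟨1, le_rfl, sO, rfl, fun j => by rw [pow_one, hsO]; exact hsS j⟩
  have hinf : ∀ a b, a ≤ b → (P * sO * Q) a b ∈ infI w := by
    intro a b hab
    have := htri _ hsT a b hab
    rw [← hQq, ← Matrix.map_mul, ← Matrix.map_mul, Matrix.map_apply] at this
    exact Ideal.Quotient.eq_zero_iff_mem.mp this
  have hev : ∀ a b, a ≤ b → ∀ᶠ j in (hyperfilter ℕ : Filter ℕ),
      w j ((P.map (ev j) * s j * Q.map (ev j)) a b) < τ ^ D / 8 := by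
    intro a b hab
    have := (hinf a b hab)
    rw [mem_infI] at this
    have h8 := this.eventually (gt_mem_nhds (show (0:ℝ) < τ ^ D / 8 by positivity))
    filter_upwards [h8] with j hj
    rw [← hsO j, ← Matrix.map_mul, ← Matrix.map_mul]
    exact hj
  have hev2 : ∀ᶠ j in (hyperfilter ℕ : Filter ℕ), ∀ a b, a ≤ b →
      w j ((P.map (ev j) * s j * Q.map (ev j)) a b) < τ ^ D / 8 := by
    simp only [eventually_all]
    exact hev
  obtain ⟨j, hj1, hj2⟩ := (hPQe.and hev2).exists
  obtain ⟨a, b, hab⟩ := hs j hj1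
  have e : P' j * s j * Q' j = Matrix.diagonal (fun a : Fin D => t j ^ (a : ℕ)) *
      (P.map (ev j) * s j * Q.map (ev j)) * Matrix.diagonal (fun a : Fin D => (t j ^ (a : ℕ))⁻¹) := by
    simp only [P', Q', mul_assoc]
  rw [e, Matrix.mul_diagonal, Matrix.diagonal_mul, map_mul, map_mul, map_inv₀, map_pow, map_pow] at hab
  have hwt : 0 < w j (t j) := (w j).pos (ht0 j)
  have hwt1 : w j (t j) ≤ 1 := (ht2 j).trans hτ1
  rw [← div_eq_mul_inv, lt_div_iff₀ (by positivity)] at hab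
  rcases le_or_gt a b with h | h
  · have h9 := hj2 a b h
    have : w j (t j) ^ (a:ℕ) ≤ 1 := pow_le_one₀ hwt.le hwt1
    have h5 : w j (t j) ^ D ≤ w j (t j) ^ (b:ℕ) := pow_le_pow_of_le_one hwt.le hwt1 b.2.le
    have h6 : τ ^ D ≤ w j (t j) ^ D := pow_le_pow_left₀ hτ0.le (ht1 j) D
    have h7 := mul_le_mul_of_nonneg_right this ((w j).nonneg ((P.map (ev j) * s j * Q.map (ev j)) a b))
    linarith
  · have h9 := hC j _ (hsS j) a b
    have h4 : w j (t j) ^ (a:ℕ) ≤ w j (t j) ^ ((b:ℕ) + 1) := pow_le_pow_of_le_one hwt.le hwt1 h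
    rw [pow_succ] at h4
    have h5 : 0 < w j (t j) ^ (b:ℕ) := by positivity
    have h6 : w j (t j) ^ (a:ℕ) * w j ((P.map (ev j) * s j * Q.map (ev j)) a b) ≤
      w j (t j) ^ (b:ℕ) * w j (t j) * C := mul_le_mul h4 h9 ((w j).nonneg _) (by positivity)
    have h7 : w j (t j) * C ≤ 2 * τ * C := mul_le_mul_of_nonneg_right (ht2 j) hC0
    nlinarith
end levi

theorem J' (D : ℕ) : ∃ δ : ℝ, 0 < δ ∧ δ ≤ 1 ∧ ∃ L : ℕ, 1 ≤ L ∧ ∀ (E : Type) [Field E] [IsAlgClosed E]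
    (w : AbsoluteValue E ℝ), (∃ x, 1 < w x) → ∀ (S : Set (Matrix (Fin D) (Fin D) E)) (ρ : ℝ), 0 < ρ →
    (∀ s ∈ S, ∀ a b, w (s a b) ≤ ρ) →
    (∀ ℓ, 1 ≤ ℓ → ℓ ≤ L → ∀ x ∈ S ^ ℓ, ∀ μ : E, x.charpoly.IsRoot μ → w μ ≤ δ * ρ ^ ℓ) →
    ∃ P Q : Matrix (Fin D) (Fin D) E, P * Q = 1 ∧ ∀ s ∈ S, ∀ a b, w ((P * s * Q) a b) ≤ ρ / 4 := by
  by_contra hcon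
  push Not at hcon
  have := fun j : ℕ => hcon (1 / (j + 1)) (by positivity) (by
    rw [div_le_one (by positivity)]
    have : (0:ℝ) ≤ j := Nat.cast_nonneg j
    linarith) (j + 1) (by omega)
  choose E hF hA w hw S ρ hρ hS hev hno using this
  choose z hz1 hz2 using fun j => exists_scale (w j) (hw j) (ρ j) (hρ j)
  have hz0 : ∀ j, z j ≠ 0 := by
    intro j h
    have := hz1 j
    rw [h, map_zero] at this
    linarith [hρ j]
  have hzp : ∀ j, 0 < w j (z j) := fun j => (w j).pos (hz0 j)
  have hpow : ∀ j ℓ, (((z j)⁻¹ • S j : Set (Matrix (Fin D) (Fin D) (E j))) ^ ℓ) = ((z j)⁻¹ ^ ℓ) • (S j ^ ℓ) := by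
    intro j ℓ
    exact smul_pow _ _ _
  refine JN_seq w D hw (fun j => (z j)⁻¹ • S j) ?_ ?_ ?_
  · rintro j _ ⟨s, hs, rfl⟩ a b
    simp only [Matrix.smul_apply, smul_eq_mul, map_mul, map_inv₀]
    rw [inv_mul_le_iff₀ (hzp j)]
    linarith [hS j s hs a b, hz1 j]
  · intro j ℓ h1 h2 x hx μ hμ
    rw [hpow] at hx
    obtain ⟨y, hy, rfl⟩ := hx
    have hroot : y.charpoly.IsRoot (z j ^ ℓ * μ) := by
      rw [isRoot_charpoly_iff] at hμ ⊢
      obtain ⟨v, hv, hv2⟩ := hμ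
      refine ⟨v, hv, ?_⟩
      rw [Matrix.smul_mulVec] at hv2
      rw [mul_smul, ← hv2, smul_smul, ← mul_pow, mul_inv_cancel₀ (hz0 j), one_pow, one_smul]
    have := hev j ℓ h1 h2 y hy _ hroot
    rw [map_mul, map_pow] at this
    have h3 : ρ j ^ ℓ ≤ w j (z j) ^ ℓ := pow_le_pow_left₀ (hρ j).le (hz1 j) ℓ
    have h4 : w j (z j) ^ ℓ * w j μ ≤ w j (z j) ^ ℓ * (1 / (j + 1)) := by
      refine this.trans ?_
      rw [mul_comm]
      exact mul_le_mul_of_nonneg_right h3 (by positivity)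
    exact le_of_mul_le_mul_left h4 (pow_pos (hzp j) _)
  · intro j P Q hPQ
    obtain ⟨s, hs, a, b, hab⟩ := hno j P Q hPQ
    refine ⟨(z j)⁻¹ • s, ⟨s, hs, rfl⟩, a, b, ?_⟩
    rw [Matrix.mul_smul, Matrix.smul_mul, Matrix.smul_apply, smul_eq_mul, map_mul, map_inv₀,
      lt_inv_mul_iff₀ (hzp j)]
    linarith [hz2 j]

end UPI
end

section
open Pointwise
namespace UPI

theorem ev_le {E : Type*} [Field E] (w : AbsoluteValue E ℝ) {D : ℕ} (A : Matrix (Fin D) (Fin D) E)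
    (ρ : ℝ) (hA : ∀ a b, w (A a b) ≤ ρ) (μ : E) (hμ : A.charpoly.IsRoot μ) : w μ ≤ D * ρ := by
  rw [isRoot_charpoly_iff] at hμ
  obtain ⟨v, hv, hv2⟩ := hμ
  obtain ⟨k, hk⟩ := Function.ne_iff.mp hv
  obtain ⟨i, -, hi⟩ := Finset.exists_max_image Finset.univ (fun i => w (v i)) ⟨k, Finset.mem_univ _⟩
  have hpos : 0 < w (v i) := lt_of_lt_of_le (w.pos hk) (hi k (Finset.mem_univ _))
  have h := congrFun hv2 i
  have h2 : w μ * w (v i) ≤ D * ρ * w (v i) := by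
    rw [← map_mul]
    have : μ * v i = ∑ j, A i j * v j := by rw [← smul_eq_mul, ← Pi.smul_apply, ← h]; rfl
    rw [this]
    refine (w.sum_le _ _).trans ?_
    refine (Finset.sum_le_card_nsmul _ _ (ρ * w (v i)) ?_).trans ?_
    · intro j _
      rw [map_mul]
      exact mul_le_mul (hA _ _) (hi j (Finset.mem_univ _)) (w.nonneg _) ((w.nonneg _).trans (hA i i))
    · simp [mul_assoc]
  exact le_of_mul_le_mul_right h2 hpos

theorem conj_pow_mem {R : Type*} [Monoid R] (P Q : R) (h : Q * P = 1) (S : Set R) (ℓ : ℕ)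
    (h1 : 1 ≤ ℓ) : ∀ x ∈ ((fun s => P * s * Q) '' S) ^ ℓ, ∃ y ∈ S ^ ℓ, x = P * y * Q := by
  induction ℓ, h1 using Nat.le_induction with
  | base => 
    rintro x hx
    rw [pow_one] at hx
    obtain ⟨s, hs, rfl⟩ := hx
    exact ⟨s, by rwa [pow_one], rfl⟩
  | succ ℓ _ ih =>
    intro x hx
    rw [pow_succ] at hx
    obtain ⟨a, ha, _, ⟨s, hs, rfl⟩, rfl⟩ := hx
    obtain ⟨y, hy, rfl⟩ := ih a ha
    refine ⟨y * s, by rw [pow_succ]; exact Set.mul_mem_mul hy hs, ?_⟩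
    calc P * y * Q * (P * s * Q) = P * y * (Q * P) * s * Q := by simp only [mul_assoc]
      _ = _ := by rw [h, mul_one]; simp only [mul_assoc]

theorem charpoly_conj {E : Type*} [Field E] {D : ℕ} (P Q A : Matrix (Fin D) (Fin D) E)
    (h : P * Q = 1) : (P * A * Q).charpoly = A.charpoly := by
  rw [mul_assoc, Matrix.charpoly_mul_comm, mul_assoc, mul_eq_one_comm.mp h, mul_one]

/-- Joint spectral radius comparison -/
theorem J (D : ℕ) (hD : 1 ≤ D) : ∃ δ : ℝ, 0 < δ ∧ δ ≤ 1 ∧ ∃ L : ℕ, 1 ≤ L ∧ ∀ (E : Type) [Field E] [IsAlgClosed E]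
    (w : AbsoluteValue E ℝ), (∃ x, 1 < w x) → ∀ (S : Set (Matrix (Fin D) (Fin D) E)),
    S.Finite → S.Nonempty → (∀ s ∈ S, s.det = 1) →
    ∃ P Q : Matrix (Fin D) (Fin D) E, P * Q = 1 ∧ ∃ ρ : ℝ, 0 < ρ ∧
      (∀ s ∈ S, ∀ a b, w ((P * s * Q) a b) ≤ ρ) ∧
      ∃ ℓ, 1 ≤ ℓ ∧ ℓ ≤ L ∧ ∃ x ∈ S ^ ℓ, ∃ μ : E, x.charpoly.IsRoot μ ∧ δ * ρ ^ ℓ < w μ := by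
  obtain ⟨δ, hδ, hδ1, L, hL, H⟩ := J' D
  refine ⟨δ, hδ, hδ1, L, hL, ?_⟩
  intro E _ _ w hw S hfin hne hdet
  by_contra hcon
  push Not at hcon
  obtain ⟨ρ₀, hρ₀, hb⟩ : ∃ ρ : ℝ, 0 < ρ ∧ ∀ s ∈ S, ∀ a b, w (s a b) ≤ ρ := by
    refine ⟨1 + ∑ s ∈ hfin.toFinset, ∑ a, ∑ b, w (s a b), ?_, ?_⟩
    · have : 0 ≤ ∑ s ∈ hfin.toFinset, ∑ a, ∑ b, w (s a b) :=
        Finset.sum_nonneg fun _ _ => Finset.sum_nonneg fun _ _ => Finset.sum_nonneg fun _ _ => w.nonneg _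
      linarith
    · intro s hs a b
      have h1 : w (s a b) ≤ ∑ b, w (s a b) := Finset.single_le_sum (f := fun b => w (s a b))
        (fun _ _ => w.nonneg _) (Finset.mem_univ b)
      have h2 : ∑ b, w (s a b) ≤ ∑ a, ∑ b, w (s a b) := Finset.single_le_sum
        (f := fun a => ∑ b, w (s a b)) (fun _ _ => Finset.sum_nonneg fun _ _ => w.nonneg _) (Finset.mem_univ a)
      have h3 : ∑ a, ∑ b, w (s a b) ≤ ∑ s ∈ hfin.toFinset, ∑ a, ∑ b, w (s a b) := Finset.single_le_sum
        (f := fun s : Matrix (Fin D) (Fin D) E => ∑ a, ∑ b, w (s a b))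
        (fun _ _ => Finset.sum_nonneg fun _ _ => Finset.sum_nonneg fun _ _ => w.nonneg _)
        (hfin.mem_toFinset.mpr hs)
      linarith
  have step : ∀ n : ℕ, ∃ P Q : Matrix (Fin D) (Fin D) E, P * Q = 1 ∧
      ∀ s ∈ S, ∀ a b, w ((P * s * Q) a b) ≤ ρ₀ / 4 ^ n := by
    intro n
    induction n with
    | zero => exact ⟨1, 1, one_mul 1, by simpa using hb⟩
    | succ n ih =>
      obtain ⟨P, Q, hPQ, hb⟩ := ih
      obtain ⟨P', Q', hPQ', hb'⟩ := H E w hw ((fun s => P * s * Q) '' S) (ρ₀ / 4 ^ n) (by positivity)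
        (by rintro _ ⟨s, hs, rfl⟩; exact hb s hs) (by
          intro ℓ h1 h2 x hx μ hμ
          obtain ⟨y, hy, rfl⟩ := conj_pow_mem P Q (mul_eq_one_comm.mp hPQ) S ℓ h1 x hx
          rw [charpoly_conj P Q y hPQ] at hμ
          exact hcon P Q hPQ _ (by positivity) hb ℓ h1 h2 y hy μ hμ)
      refine ⟨P' * P, Q * Q', ?_, ?_⟩
      · calc P' * P * (Q * Q') = P' * (P * Q) * Q' := by simp only [mul_assoc]
          _ = 1 := by rw [hPQ, mul_one, hPQ']
      · intro s hs a b
        have := hb' _ ⟨s, hs, rfl⟩ a b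
        have e : P' * P * s * (Q * Q') = P' * (P * s * Q) * Q' := by simp only [mul_assoc]
        rw [e, pow_succ, ← div_div]
        exact this
  obtain ⟨s, hs⟩ := hne
  have hlow : ∀ n : ℕ, 1 ≤ (D.factorial : ℝ) * (ρ₀ / 4 ^ n) ^ D := by
    intro n
    obtain ⟨P, Q, hPQ, hb⟩ := step n
    have h1 := Matrix.det_le (abv := w) (A := P * s * Q) (fun i j => hb s hs i j)
    have h2 : (P * s * Q).det = 1 := by
      rw [Matrix.det_mul, Matrix.det_mul, hdet s hs, mul_one, ← Matrix.det_mul, hPQ, Matrix.det_one]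
    rw [h2, map_one] at h1
    simpa using h1
  have hlim : Filter.Tendsto (fun n : ℕ => (D.factorial : ℝ) * (ρ₀ / 4 ^ n) ^ D) Filter.atTop (nhds (D.factorial * 0 ^ D)) := by
    apply Filter.Tendsto.const_mul
    apply Filter.Tendsto.pow
    have := (tendsto_pow_atTop_nhds_zero_of_lt_one (r := (1/4:ℝ)) (by norm_num) (by norm_num)).const_mul ρ₀
    rw [mul_zero] at this
    refine this.congr fun n => ?_
    rw [one_div, inv_pow]; rfl
  have := ge_of_tendsto' hlim hlow
  rw [zero_pow (by omega), mul_zero] at this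
  linarith

/-- axioms for norms on `W` -/
structure NormAx {E : Type*} [Field E] (w : AbsoluteValue E ℝ) {W : Type*} [AddCommGroup W] [Module E W]
    (N : W → ℝ) : Prop where
  nonneg : ∀ x, 0 ≤ N x
  add : ∀ x y, N (x + y) ≤ N x + N y
  smul : ∀ (c : E) x, N (c • x) = w c * N x
  eq0 : ∀ x, N x = 0 → x = 0

theorem NormAx.neg {E : Type*} [Field E] {w : AbsoluteValue E ℝ} {W : Type*} [AddCommGroup W] [Module E W]
    {N : W → ℝ} (h : NormAx w N) (x : W) : N (-x) = N x := by
  have := h.smul (-1) x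
  simpa using this

theorem NormAx.sub {E : Type*} [Field E] {w : AbsoluteValue E ℝ} {W : Type*} [AddCommGroup W] [Module E W]
    {N : W → ℝ} (h : NormAx w N) (x y : W) : N (x - y) ≤ N x + N y := by
  have := h.add x (-y)
  rwa [h.neg, ← sub_eq_add_neg] at this

theorem NormAx.pos {E : Type*} [Field E] {w : AbsoluteValue E ℝ} {W : Type*} [AddCommGroup W] [Module E W]
    {N : W → ℝ} (h : NormAx w N) (x : W) (hx : x ≠ 0) : 0 < N x :=
  lt_of_le_of_ne (h.nonneg x) fun h0 => hx (h.eq0 x h0.symm)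

theorem PP {E : Type*} [Field E] (w : AbsoluteValue E ℝ) {n : Type*} [Fintype n] [DecidableEq n]
    {W : Type*} [AddCommGroup W] [Module E W]
    (ρ : Matrix n n E →* Module.End E W) (i : ℕ) (hρ : ∀ (c : E) g, ρ (c • g) = c ^ i • ρ g)
    (N : W → ℝ) (hN : NormAx w N) (f : W →ₗ[E] E) (o : W) (hfo : f o = 1)
    (a g : Matrix n n E) (hau : IsUnit a) (hgu : IsUnit g) (Λ : E) (hΛ : Λ ≠ 0)
    (hao : ρ a o = Λ • o) (hfa : ∀ x, f (ρ a x) = Λ * f x) (η C : ℝ) (hη : 0 ≤ η) (hC : 1 ≤ C)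
    (hcon : ∀ u, f u = 0 → N (ρ a u) ≤ η * w Λ * N u) (hηC : 20 * C ^ 5 * η ^ 2 ≤ 1)
    (hη5 : η ≤ 1 / 5)
    (hfN : ∀ x, w (f x) * N o ≤ C * N x) (hg : ∀ x, N (ρ g x) ≤ C * N x)
    (hq : 1 ≤ C * w (f (ρ g o))) (hgo : ρ g o ≠ f (ρ g o) • o) :
    PFree (E := E) a (a * g * a) := by
  set q := f (ρ g o) with hqdef
  have hwq : 0 < w q := by
    rcases (w.nonneg q).eq_or_lt with h | h
    · rw [← h] at hq; linarith
    · exact h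
  have hq0 : q ≠ 0 := by rintro h; rw [h, map_zero] at hwq; exact lt_irrefl _ hwq
  have ho0 : o ≠ 0 := by rintro h; rw [h, map_zero] at hfo; exact zero_ne_one hfo
  have hNo : 0 < N o := hN.pos o ho0
  set A : W →ₗ[E] W := Λ⁻¹ • ρ a with hAdef
  have hA : ∀ x, ρ a x = Λ • A x := by
    intro x; rw [hAdef, LinearMap.smul_apply, smul_smul, mul_inv_cancel₀ hΛ, one_smul]
  have hAo : A o = o := by
    rw [hAdef, LinearMap.smul_apply, hao, smul_smul, inv_mul_cancel₀ hΛ, one_smul]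
  have hfA : ∀ x, f (A x) = f x := by
    intro x
    rw [hAdef, LinearMap.smul_apply, map_smul, hfa, smul_eq_mul, ← mul_assoc, inv_mul_cancel₀ hΛ, one_mul]
  have hwΛ : 0 < w Λ := w.pos hΛ
  have hAc : ∀ u, f u = 0 → N (A u) ≤ η * N u := by
    intro u hu
    rw [hAdef, LinearMap.smul_apply, hN.smul, map_inv₀, inv_mul_le_iff₀ hwΛ]
    linarith [hcon u hu]
  have hAinj : ∀ x, A x = 0 → x = 0 := by
    intro x hx
    obtain ⟨u, rfl⟩ := hau
    have : ρ (u⁻¹ : (Matrix n n E)ˣ).1 (ρ u.1 x) = x := by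
      rw [← Module.End.mul_apply, ← map_mul, Units.inv_mul, map_one]; rfl
    rw [← this, hA, hx, smul_zero, map_zero]
  set p := A (q⁻¹ • ρ g o - o) with hp
  have hfin : f (q⁻¹ • ρ g o - o) = 0 := by
    rw [map_sub, map_smul, hfo, ← hqdef, smul_eq_mul, inv_mul_cancel₀ hq0, sub_self]
  have hp0 : p ≠ 0 := by
    intro h
    have := hAinj _ h
    apply hgo
    rw [sub_eq_zero] at this
    have h2 := congrArg (fun z => q • z) this
    simp only [smul_smul, mul_inv_cancel₀ hq0, one_smul] at h2
    exact h2
  set d := N p with hd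
  have hd0 : 0 < d := hN.pos p hp0
  have hop : o + p = q⁻¹ • A (ρ g o) := by
    rw [hp, map_sub, map_smul, hAo]; abel
  have hCq : (w q)⁻¹ ≤ C := by rw [inv_le_iff_one_le_mul₀ hwq]; linarith
  have hC2 : 1 ≤ C ^ 2 := one_le_pow₀ hC
  have hdle : d ≤ 2 * C ^ 2 * η * N o := by
    have h1 := hAc _ hfin
    have h2 := hN.sub (q⁻¹ • ρ g o) o
    rw [hN.smul, map_inv₀] at h2
    have h3 : (w q)⁻¹ * N (ρ g o) ≤ C * (C * N o) :=
      mul_le_mul hCq (hg o) (hN.nonneg _) (by linarith)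
    have h4 : N (q⁻¹ • ρ g o - o) ≤ 2 * C ^ 2 * N o := by nlinarith
    have h5 := mul_le_mul_of_nonneg_left h4 hη
    calc d ≤ _ := h1
      _ ≤ _ := h5
      _ = _ := by ring
  let Y : Set W := {x | f x ≠ 0 ∧ N (x - f x • o) ≤ 2 * d * w (f x)}
  let SA : Set W := {x | f x ≠ 0 ∧ N (x - f x • o) ≤ 2 / 5 * d * w (f x)}
  let SB : Set W := {x | f x ≠ 0 ∧ N (x - f x • (o + p)) ≤ 2 / 5 * d * w (f x)}
  have hSAc : ∀ c : E, c ≠ 0 → ∀ y ∈ SA, c • y ∈ SA := by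
    rintro c hc y ⟨h1, h2⟩
    refine ⟨by rw [map_smul, smul_eq_mul]; exact mul_ne_zero hc h1, ?_⟩
    rw [map_smul, smul_eq_mul, mul_smul, ← smul_sub, hN.smul, map_mul]
    have := mul_le_mul_of_nonneg_left h2 (w.nonneg c)
    linarith
  have hSBc : ∀ c : E, c ≠ 0 → ∀ y ∈ SB, c • y ∈ SB := by
    rintro c hc y ⟨h1, h2⟩
    refine ⟨by rw [map_smul, smul_eq_mul]; exact mul_ne_zero hc h1, ?_⟩
    rw [map_smul, smul_eq_mul, mul_smul, ← smul_sub, hN.smul, map_mul]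
    have := mul_le_mul_of_nonneg_left h2 (w.nonneg c)
    linarith
  refine pfree_of_pingpong ρ i hρ a (a * g * a) hau ((hau.mul hgu).mul hau) Y SA SB ⟨o, ?_⟩ ?_ ?_ ?_ ?_ ?_ hSAc hSBc
  · refine ⟨by rw [hfo]; exact one_ne_zero, ?_⟩
    rw [hfo, one_smul, sub_self, map_one]
    have : N 0 = 0 := by simpa using hN.smul 0 o
    rw [this]; linarith
  · rintro x ⟨h1, h2⟩
    refine ⟨h1, h2.trans ?_⟩
    have : 0 < w (f x) := w.pos h1
    nlinarith [mul_pos hd0 this]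
  · rintro x ⟨h1, h2⟩
    refine ⟨h1, ?_⟩
    have : 0 < w (f x) := w.pos h1
    have e : x - f x • o = (x - f x • (o + p)) + f x • p := by rw [smul_add]; abel
    rw [e]
    have := hN.add (x - f x • (o + p)) (f x • p)
    rw [hN.smul] at this
    nlinarith [mul_pos hd0 (w.pos h1)]
  · rw [Set.disjoint_left]
    rintro x ⟨h1, h2⟩ ⟨h3, h4⟩
    have := hN.sub (x - f x • o) (x - f x • (o + p))
    have e : (x - f x • o) - (x - f x • (o + p)) = f x • p := by rw [smul_add]; abel
    rw [e, hN.smul] at this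
    nlinarith [mul_pos hd0 (w.pos h1)]
  · rintro x ⟨h1, h2⟩
    rw [hA]
    apply hSAc Λ hΛ
    refine ⟨by rwa [hfA], ?_⟩
    rw [hfA]
    have e : A x - f x • o = A (x - f x • o) := by rw [map_sub, map_smul, hAo]
    rw [e]
    have h3 := hAc (x - f x • o) (by rw [map_sub, map_smul, hfo]; simp)
    have h4 := mul_le_mul_of_nonneg_right hη5 (hN.nonneg (x - f x • o))
    linarith
  · rintro x ⟨h1, h2⟩
    have e0 : ρ (a * g * a) x = (Λ * Λ) • A (ρ g (A x)) := by
      rw [map_mul, map_mul, Module.End.mul_apply, Module.End.mul_apply, hA x, map_smul, map_smul, hA,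
        smul_smul]
    rw [e0]
    apply hSBc _ (mul_ne_zero hΛ hΛ)
    set s := f x with hs
    set u := x - s • o with hu
    have hfu : f u = 0 := by rw [hu, map_sub, map_smul, hfo, ← hs]; simp
    have hx : x = s • o + u := by rw [hu]; abel
    set y := f (ρ g (A u)) with hy
    have hAu := hAc u hfu
    have hNu0 := hN.nonneg u
    have hws : 0 < w s := w.pos h1
    have hfb : f (A (ρ g (A x))) = s * q + y := by
      rw [hfA, hx, map_add, map_smul, hAo, map_add, map_smul, map_add, map_smul, ← hqdef, ← hy, smul_eq_mul]
    have hyb : w y * N o ≤ C ^ 2 * η * N u := by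
      calc w y * N o ≤ C * N (ρ g (A u)) := hfN _
        _ ≤ C * (C * N (A u)) := mul_le_mul_of_nonneg_left (hg _) (by linarith)
        _ ≤ C * (C * (η * N u)) := by
            apply mul_le_mul_of_nonneg_left _ (by linarith)
            exact mul_le_mul_of_nonneg_left hAu (by linarith)
        _ = _ := by ring
    have hC5 : C ^ 2 * η * (2 * (2 * C ^ 2 * η)) * (2 * C) ≤ 1 := by nlinarith
    -- w y ≤ w s * w q / 2
    have hy2 : w y ≤ w s * w q / 2 := by
      have h6 : C ^ 2 * η * N u ≤ C ^ 2 * η * (2 * (2 * C ^ 2 * η * N o) * w s) := by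
        apply mul_le_mul_of_nonneg_left _ (by positivity)
        refine h2.trans ?_
        exact mul_le_mul_of_nonneg_right (by linarith) hws.le
      have h7 : C ^ 2 * η * (2 * (2 * C ^ 2 * η)) ≤ w q / 2 := by
        have h8 : 1 / (2 * C) ≤ w q / 2 := by
          rw [div_le_div_iff₀ (by positivity) (by positivity)]; nlinarith
        refine le_trans ?_ h8
        rw [le_div_iff₀ (by positivity)]; exact hC5
      have h9 : w y * N o ≤ (w s * w q / 2) * N o := by
        calc w y * N o ≤ _ := hyb
          _ ≤ _ := h6
          _ = (C ^ 2 * η * (2 * (2 * C ^ 2 * η))) * (N o * w s) := by ring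
          _ ≤ w q / 2 * (N o * w s) := mul_le_mul_of_nonneg_right h7 (by positivity)
          _ = _ := by ring
      exact le_of_mul_le_mul_right h9 hNo
    have hfb2 : w s * w q / 2 ≤ w (s * q + y) := by
      have := w.le_sub (s * q) (-y)
      rw [sub_neg_eq_add, map_neg_eq_map, map_mul] at this
      linarith
    refine ⟨?_, ?_⟩
    · rw [hfb]
      intro h
      rw [h, map_zero] at hfb2
      have := mul_pos hws hwq
      linarith
    · rw [hfb, hop]
      have e : A (ρ g (A x)) - (s * q + y) • q⁻¹ • A (ρ g o) = A (ρ g (A u) - (y * q⁻¹) • ρ g o) := by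
        have hAx : A x = s • o + A u := by
          rw [hu, map_sub, map_smul, hAo]; abel
        have gen : ∀ (v : W) (y : E), A (ρ g (s • o + v)) - (s * q + y) • q⁻¹ • A (ρ g o) =
            A (ρ g v - (y * q⁻¹) • ρ g o) := by
          intro v y
          rw [map_add, map_smul, map_add, map_smul, map_sub, map_smul, smul_smul,
            add_mul, mul_assoc s, mul_inv_cancel₀ hq0, mul_one, add_smul]; abel
        rw [hAx]; exact gen _ _
      rw [e]
      have hf0 : f (ρ g (A u) - (y * q⁻¹) • ρ g o) = 0 := by
        rw [map_sub, map_smul, ← hqdef, ← hy, smul_eq_mul, mul_assoc, inv_mul_cancel₀ hq0, mul_one, sub_self]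
      have b1 := hAc _ hf0
      have b2 := hN.sub (ρ g (A u)) ((y * q⁻¹) • ρ g o)
      rw [hN.smul, map_mul, map_inv₀] at b2
      have b3 : N (ρ g (A u)) ≤ C * (η * N u) :=
        (hg _).trans (mul_le_mul_of_nonneg_left hAu (by linarith))
      have b4 : w y * (w q)⁻¹ * N (ρ g o) ≤ C ^ 4 * η * N u := by
        calc w y * (w q)⁻¹ * N (ρ g o) ≤ w y * (w q)⁻¹ * (C * N o) :=
              mul_le_mul_of_nonneg_left (hg _) (by positivity)
          _ = (w y * N o) * ((w q)⁻¹ * C) := by ring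
          _ ≤ (C ^ 2 * η * N u) * (C * C) := by
              apply mul_le_mul hyb _ (by positivity) (by positivity)
              exact mul_le_mul_of_nonneg_right hCq (by linarith)
          _ = _ := by ring
      have b5 : N (ρ g (A u) - (y * q⁻¹) • ρ g o) ≤ 2 * C ^ 4 * η * N u := by
        have : C * (η * N u) ≤ C ^ 4 * (η * N u) := by
          apply mul_le_mul_of_nonneg_right _ (by positivity)
          exact le_self_pow₀ hC (by norm_num)
        linarith
      have b6 : N (A (ρ g (A u) - (y * q⁻¹) • ρ g o)) ≤ η * (2 * C ^ 4 * η * (2 * d * w s)) := by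
        refine b1.trans (mul_le_mul_of_nonneg_left (b5.trans ?_) hη)
        exact mul_le_mul_of_nonneg_left h2 (by positivity)
      refine b6.trans ?_
      have b7 : 2 * C ^ 4 * η ^ 2 * 2 ≤ 2 / 5 * (w q / 2) := by
        have : 1 / C ≤ w q := by rw [div_le_iff₀ (by linarith)]; linarith
        refine le_trans ?_ (show 1 / 5 * (1 / C) ≤ _ by linarith)
        rw [mul_one_div, le_div_iff₀ (by linarith)]
        nlinarith
      calc η * (2 * C ^ 4 * η * (2 * d * w s)) = (2 * C ^ 4 * η ^ 2 * 2) * (d * w s) := by ring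
        _ ≤ (2 / 5 * (w q / 2)) * (d * w s) := mul_le_mul_of_nonneg_right b7 (by positivity)
        _ = 2 / 5 * d * (w s * w q / 2) := by ring
        _ ≤ _ := mul_le_mul_of_nonneg_left hfb2 (by positivity)

end UPI
end

section
open Pointwise
namespace UPI
open Polynomial in
theorem LL {E : Type*} [Field E] {w : AbsoluteValue E ℝ} {V : Type*} [AddCommGroup V] [Module E V]
    {N : V → ℝ} (hN : NormAx w N) (T : Module.End E V) (M ρ : ℝ) (hρ : 0 < ρ) (hM : ρ ≤ M)
    (hT : ∀ x, N (T x) ≤ M * N x) (s : Multiset E) : (∀ ν ∈ s, w ν ≤ ρ) → ∀ x : V,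
    aeval T ((s.map (fun ν => X - C ν)).prod) x = 0 → ∀ r : ℕ,
    N ((T ^ r) x) ≤ ρ ^ r * (1 + 2 * M * r / ρ) ^ (Multiset.card s) * N x := by
  induction s using Multiset.induction_on with
  | empty =>
    intro _ x hx r
    have hx : x = 0 := by simpa using hx
    have h0 : N 0 = 0 := by simpa using hN.smul 0 (0 : V)
    rw [hx, map_zero, h0]; simp
  | cons ν s ih =>
    intro hs x hx r
    have hν : w ν ≤ ρ := hs ν (Multiset.mem_cons_self _ _)
    have ih' := ih (fun μ hμ => hs μ (Multiset.mem_cons_of_mem hμ))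
    set y := T x - ν • x with hy
    have hy0 : aeval T ((s.map (fun ν => X - C ν)).prod) y = 0 := by
      rw [Multiset.map_cons, Multiset.prod_cons, mul_comm, map_mul, Module.End.mul_apply] at hx
      convert hx using 2
      simp [hy]
    have hM0 : 0 < M := hρ.trans_le hM
    have hNy : N y ≤ 2 * M * N x := by
      refine (hN.sub _ _).trans ?_
      rw [hN.smul]
      have := mul_le_mul_of_nonneg_right (hν.trans hM) (hN.nonneg x)
      linarith [hT x]
    have key : ∀ r : ℕ, N ((T ^ r) x) ≤ ρ ^ r * N x + r * (ρ ^ r / ρ) * (1 + 2 * M * r / ρ) ^ (Multiset.card s) * N y := by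
      intro r
      induction r with
      | zero => simp
      | succ r ihr =>
        have e : (T ^ (r + 1)) x = ν • (T ^ r) x + (T ^ r) y := by
          rw [hy, map_sub, map_smul, pow_succ, Module.End.mul_apply]; abel
        rw [e]
        refine (hN.add _ _).trans ?_
        rw [hN.smul]
        have h1 := ih' y hy0 r
        have h2 : w ν * N ((T ^ r) x) ≤ ρ * (ρ ^ r * N x + r * (ρ ^ r / ρ) * (1 + 2 * M * r / ρ) ^ (Multiset.card s) * N y) :=
          mul_le_mul hν ihr (hN.nonneg _) hρ.le
        have h3 : (1 + 2 * M * r / ρ) ^ (Multiset.card s) ≤ (1 + 2 * M * (r + 1 : ℕ) / ρ) ^ (Multiset.card s) := by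
          have hr0 : (0:ℝ) ≤ r := Nat.cast_nonneg r
          apply pow_le_pow_left₀ (by positivity)
          gcongr
          · norm_num
        set A := (1 + 2 * M * r / ρ) ^ (Multiset.card s)
        set B := (1 + 2 * M * (r + 1 : ℕ) / ρ) ^ (Multiset.card s)
        have h4 : ρ ^ (r + 1) / ρ = ρ ^ r := by rw [pow_succ]; field_simp
        have h5 : ρ * (ρ ^ r * N x + r * (ρ ^ r / ρ) * A * N y) = ρ ^ (r + 1) * N x + r * ρ ^ r * A * N y := by
          rw [pow_succ]; field_simp
        rw [h4]
        rw [h5] at h2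
        have h6 : (r + 1) * ρ ^ r * A * N y ≤ (r + 1) * ρ ^ r * B * N y := by
          apply mul_le_mul_of_nonneg_right _ (hN.nonneg y)
          apply mul_le_mul_of_nonneg_left h3 (by positivity)
        push_cast
        linarith
    refine (key r).trans ?_
    rw [Multiset.card_cons, pow_succ]
    set A := (1 + 2 * M * r / ρ) ^ (Multiset.card s) with hA
    have hr : (0:ℝ) ≤ 2 * M * r / ρ := by positivity
    have hA1 : 1 ≤ A := one_le_pow₀ (by linarith)
    have h1 : r * (ρ ^ r / ρ) * A * N y ≤ r * (ρ ^ r / ρ) * A * (2 * M * N x) :=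
      mul_le_mul_of_nonneg_left hNy (by positivity)
    have h2 : r * (ρ ^ r / ρ) * A * (2 * M * N x) = ρ ^ r * A * (2 * M * r / ρ) * N x := by ring
    have h3 : ρ ^ r * N x ≤ ρ ^ r * A * N x := by
      apply mul_le_mul_of_nonneg_right _ (hN.nonneg x)
      exact le_mul_of_one_le_right (by positivity) hA1
    calc _ ≤ ρ ^ r * A * N x + ρ ^ r * A * (2 * M * r / ρ) * N x := by linarith
      _ = _ := by ring

/-- l1 norm of a matrix -/
noncomputable def Mn {E : Type*} [Field E] (w : AbsoluteValue E ℝ) {D : ℕ} (X : Matrix (Fin D) (Fin D) E) : ℝ :=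
  ∑ a, ∑ b, w (X a b)

theorem Mn_ax {E : Type*} [Field E] (w : AbsoluteValue E ℝ) {D : ℕ} :
    NormAx w (Mn w : Matrix (Fin D) (Fin D) E → ℝ) where
  nonneg x := Finset.sum_nonneg fun _ _ => Finset.sum_nonneg fun _ _ => w.nonneg _
  add x y := by
    simp only [Mn, ← Finset.sum_add_distrib]
    exact Finset.sum_le_sum fun _ _ => Finset.sum_le_sum fun _ _ => w.add_le _ _
  smul c x := by
    simp only [Mn, Matrix.smul_apply, smul_eq_mul, map_mul, Finset.mul_sum]
  eq0 x h := by
    funext a b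
    have h1 := (Finset.sum_eq_zero_iff_of_nonneg (fun _ _ => Finset.sum_nonneg fun _ _ => w.nonneg _)).mp h a (Finset.mem_univ _)
    have h2 := (Finset.sum_eq_zero_iff_of_nonneg (fun _ _ => w.nonneg _)).mp h1 b (Finset.mem_univ _)
    simpa using h2

theorem le_Mn {E : Type*} [Field E] (w : AbsoluteValue E ℝ) {D : ℕ} (X : Matrix (Fin D) (Fin D) E) (a b) :
    w (X a b) ≤ Mn w X :=
  (Finset.single_le_sum (f := fun b => w (X a b)) (fun _ _ => w.nonneg _) (Finset.mem_univ b)).trans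
    (Finset.single_le_sum (f := fun a => ∑ b, w (X a b)) (fun _ _ => Finset.sum_nonneg fun _ _ => w.nonneg _)
      (Finset.mem_univ a))

theorem Mn_le {E : Type*} [Field E] (w : AbsoluteValue E ℝ) {D : ℕ} (X : Matrix (Fin D) (Fin D) E) (c : ℝ)
    (h : ∀ a b, w (X a b) ≤ c) : Mn w X ≤ D ^ 2 * c := by
  have : Mn w X ≤ ∑ a : Fin D, ∑ b : Fin D, c := Finset.sum_le_sum fun _ _ => Finset.sum_le_sum fun _ _ => h _ _
  refine this.trans (le_of_eq ?_)
  simp; ring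

theorem Mn_mul {E : Type*} [Field E] (w : AbsoluteValue E ℝ) {D : ℕ} (A X : Matrix (Fin D) (Fin D) E) (c : ℝ)
    (h : ∀ a b, w (A a b) ≤ c) : Mn w (A * X) ≤ D * c * Mn w X := by
  have h1 : Mn w (A * X) ≤ ∑ a : Fin D, ∑ b : Fin D, ∑ k : Fin D, c * w (X k b) := by
    refine Finset.sum_le_sum fun a _ => Finset.sum_le_sum fun b _ => ?_
    rw [Matrix.mul_apply]
    refine (w.sum_le _ _).trans (Finset.sum_le_sum fun k _ => ?_)
    rw [map_mul]
    exact mul_le_mul_of_nonneg_right (h _ _) (w.nonneg _)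
  refine h1.trans (le_of_eq ?_)
  simp only [← Finset.mul_sum, Finset.sum_const, Finset.card_univ, Fintype.card_fin, nsmul_eq_mul]
  rw [Mn, Finset.sum_comm]; ring

open Polynomial in
theorem PB (D M : ℕ) : ∃ m : ℕ, ∀ (E : Type) [Field E] (w : AbsoluteValue E ℝ) (R : ℝ) (A X : Matrix (Fin D) (Fin D) E)
    (ρ : ℝ) (s : Multiset E) (r : ℕ), (2:ℝ) ≤ R → (D:ℝ) ≤ R → (∀ a b, w (A a b) ≤ R ^ M) → (∀ a b, w (X a b) ≤ R ^ M) →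
    1 ≤ ρ * R ^ M → ρ ≤ R ^ M → Multiset.card s ≤ D → (∀ ν ∈ s, w ν ≤ ρ) →
    aeval A ((s.map (fun ν => Polynomial.X - C ν)).prod) * X = 0 → 1 ≤ r → 3 * (r:ℝ) ≤ R →
    ∀ a b, w ((A ^ r * X) a b) ≤ ρ ^ r * R ^ m := by
  refine ⟨(2 * M + 2) * D + (M + 2), ?_⟩
  intro E _ w R A X ρ s r hR hD hA hX hρ1 hρ2 hs hν h0 hr hrR a b
  have hRM : (0:ℝ) < R ^ M := by positivity
  have hρ : 0 < ρ := by
    by_contra h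
    push Not at h
    have := mul_nonpos_of_nonpos_of_nonneg h hRM.le
    linarith
  have hM1 : ρ ≤ R ^ (M + 1) := hρ2.trans (pow_le_pow_right₀ (by linarith) (by omega))
  have hT : ∀ x, Mn w (Algebra.lmul E (Matrix (Fin D) (Fin D) E) A x) ≤ R ^ (M + 1) * Mn w x := by
    intro x
    refine (Mn_mul w A x _ hA).trans (mul_le_mul_of_nonneg_right ?_ ((Mn_ax w).nonneg x))
    rw [pow_succ, mul_comm]
    exact mul_le_mul_of_nonneg_left hD hRM.le
  have := LL (Mn_ax w) (Algebra.lmul E (Matrix (Fin D) (Fin D) E) A) (R ^ (M + 1)) ρ hρ hM1 hT s hν X (by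
    rw [aeval_algHom_apply]; exact h0) r
  rw [← map_pow] at this
  refine (le_Mn w _ a b).trans (this.trans ?_)
  rw [mul_assoc]
  apply mul_le_mul_of_nonneg_left _ (by positivity)
  rw [pow_add R ((2 * M + 2) * D) (M + 2)]
  have hr1 : (1:ℝ) ≤ r := by exact_mod_cast hr
  apply mul_le_mul _ _ ((Mn_ax w).nonneg _) (by positivity)
  · have h1 : 1 + 2 * R ^ (M + 1) * r / ρ ≤ R ^ (2 * M + 2) := by
      have e1 : 1 ≤ R ^ (M + 1) * r / ρ := by
        rw [one_le_div hρ]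
        exact hM1.trans (le_mul_of_one_le_right (by positivity) hr1)
      have e2 : R ^ (M + 1) * r / ρ * 3 ≤ R ^ (2 * M + 2) := by
        rw [div_mul_eq_mul_div, div_le_iff₀ hρ]
        calc R ^ (M + 1) * r * 3 = R ^ (M + 1) * (3 * r) := by ring
          _ ≤ R ^ (M + 1) * R := mul_le_mul_of_nonneg_left hrR (by positivity)
          _ = R ^ (M + 2) * 1 := by ring
          _ ≤ R ^ (M + 2) * (ρ * R ^ M) := mul_le_mul_of_nonneg_left hρ1 (by positivity)
          _ = _ := by ring
      calc _ = 1 + 2 * (R ^ (M + 1) * r / ρ) := by ring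
        _ ≤ _ := by linarith
    calc (1 + 2 * R ^ (M + 1) * r / ρ) ^ (Multiset.card s) ≤ (R ^ (2 * M + 2)) ^ (Multiset.card s) :=
          pow_le_pow_left₀ (by positivity) h1 _
      _ = R ^ ((2 * M + 2) * Multiset.card s) := by rw [← pow_mul]
      _ ≤ _ := pow_le_pow_right₀ (by linarith) (Nat.mul_le_mul_left _ hs)
  · refine (Mn_le w X _ hX).trans ?_
    calc (D:ℝ) ^ 2 * R ^ M ≤ R ^ 2 * R ^ M := by gcongr
      _ = _ := by ring

open Polynomial in
theorem proj_ring {O : Type*} [CommRing O] {D : ℕ} (A : Matrix (Fin D) (Fin D) O) (α : Fin D → O)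
    (h : A.charpoly = ∏ i, (X - C (α i))) (S : Finset (Fin D))
    (hu : ∀ i ∈ S, ∀ l ∉ S, IsUnit (α i - α l)) :
    ∃ P : Matrix (Fin D) (Fin D) O, P * A = A * P ∧ P * P = P ∧
      aeval A (∏ i ∈ S, (X - C (α i))) * P = 0 ∧ aeval A (∏ i ∈ Sᶜ, (X - C (α i))) * (1 - P) = 0 := by
  have hco : IsCoprime (∏ i ∈ S, (X - C (α i))) (∏ i ∈ Sᶜ, (X - C (α i))) := by
    apply IsCoprime.prod_left
    intro i hi
    apply IsCoprime.prod_right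
    intro l hl
    exact isCoprime_X_sub_C_of_isUnit_sub (hu i hi l (by simpa using hl))
  obtain ⟨u, v, huv⟩ := hco
  have hCH : aeval A ((∏ i ∈ S, (X - C (α i))) * (∏ i ∈ Sᶜ, (X - C (α i)))) = 0 := by
    rw [Finset.prod_mul_prod_compl, ← h]; exact Matrix.aeval_self_charpoly A
  set pb := ∏ i ∈ S, (X - C (α i))
  set ps := ∏ i ∈ Sᶜ, (X - C (α i))
  have e1 : aeval A (u * pb) = 1 - aeval A (v * ps) := by
    rw [eq_sub_iff_add_eq, ← map_add, huv, map_one]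
  refine ⟨aeval A (v * ps), ?_, ?_, ?_, ?_⟩
  · have : aeval A (X : O[X]) = A := aeval_X A
    have h2 : aeval A (v * ps) * aeval A (X : O[X]) = aeval A (X : O[X]) * aeval A (v * ps) := by
      rw [← map_mul, ← map_mul, mul_comm]
    rwa [this] at h2
  · have : aeval A (v * ps) * aeval A (u * pb) = 0 := by
      rw [← map_mul, show v * ps * (u * pb) = (v * u) * (pb * ps) by ring, map_mul, hCH, mul_zero]
    rw [e1, mul_sub, mul_one, sub_eq_zero] at this
    exact this.symm
  · rw [← map_mul, show pb * (v * ps) = v * (pb * ps) by ring, map_mul, hCH, mul_zero]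
  · rw [← e1, ← map_mul, show ps * (u * pb) = u * (pb * ps) by ring, map_mul, hCH, mul_zero]
end UPI
end

section
open Pointwise
namespace UPI

open Polynomial in
theorem PROJ_seq (D M : ℕ) {ι : Type} (E : ι → Type) [∀ j, Field (E j)] (w : ∀ j, AbsoluteValue (E j) ℝ) (R : ι → ℝ)
    (A : ∀ j, Matrix (Fin D) (Fin D) (E j)) (α : ∀ j, Fin D → E j) (S : Finset (Fin D)) (hR : ∀ j, 2 ≤ R j)
    (hA : ∀ j a b, w j (A j a b) ≤ R j ^ M) (hα : ∀ j, (A j).charpoly = ∏ i, (X - C (α j i)))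
    (hα2 : ∀ j i, w j (α j i) ≤ R j ^ M)
    (hu : ∀ j, ∀ i ∈ S, ∀ l ∉ S, 1 ≤ w j (α j i - α j l) * R j ^ M) :
    ∃ m : ℕ, ∀ j, ∃ P : Matrix (Fin D) (Fin D) (E j), P * A j = A j * P ∧ P * P = P ∧
      aeval (A j) (∏ i ∈ S, (X - C (α j i))) * P = 0 ∧ aeval (A j) (∏ i ∈ Sᶜ, (X - C (α j i))) * (1 - P) = 0 ∧
      ∀ a b, w j (P a b) ≤ R j ^ m := by
  obtain ⟨B, hB⟩ := Obd_mat_exists w R hR A M hA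
  let β : Fin D → Obd w R hR := fun i => ⟨fun j => α j i, M, fun j => hα2 j i⟩
  have hβ : B.charpoly = ∏ i, (X - C (β i)) := by
    apply Obd_poly_ext
    intro j
    rw [← Matrix.charpoly_map, hB, hα, Polynomial.map_prod]
    apply Finset.prod_congr rfl
    intro i _
    simp [β]
  obtain ⟨P, h1, h2, h3, h4⟩ := proj_ring B β hβ S (fun i hi l hl => Obd_isUnit w R hR _ M (fun j => hu j i hi l hl))
  obtain ⟨m, hm⟩ := Obd_mat_bound w R hR P
  have hmap : ∀ j (p : (Obd w R hR)[X]), (aeval B p).map (evO w R hR j) = aeval (A j) (p.map (evO w R hR j)) := by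
    intro j p
    rw [← hB j]
    change (evO w R hR j).mapMatrix (aeval B p) = aeval ((evO w R hR j).mapMatrix B) _
    rw [aeval_def, aeval_def, Polynomial.hom_eval₂, eval₂_map]
    congr 1
    ext x a b
    simp only [RingHom.comp_apply, RingHom.mapMatrix_apply, Matrix.map_apply, Matrix.algebraMap_matrix_apply]
    split_ifs
    · rfl
    · exact map_zero _
  refine ⟨m, fun j => ⟨P.map (evO w R hR j), ?_, ?_, ?_, ?_, hm j⟩⟩
  · rw [← hB, ← Matrix.map_mul, ← Matrix.map_mul, h1]
  · rw [← Matrix.map_mul, h2]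
  · have := congrArg (fun Z : Matrix (Fin D) (Fin D) (Obd w R hR) => Z.map (evO w R hR j)) h3
    simp only [Matrix.map_mul, hmap, Polynomial.map_prod] at this
    rw [Matrix.map_zero _ (map_zero _)] at this
    simpa [β] using this
  · have := congrArg (fun Z : Matrix (Fin D) (Fin D) (Obd w R hR) => Z.map (evO w R hR j)) h4
    simp only [Matrix.map_mul, hmap, Polynomial.map_prod] at this
    have e : (1 - P).map (evO w R hR j) = 1 - P.map (evO w R hR j) := by
      change (evO w R hR j).mapMatrix (1 - P) = _
      rw [map_sub, map_one]; rfl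
    rw [e, Matrix.map_zero _ (map_zero _)] at this
    simpa [β] using this

open Polynomial in
theorem PROJ (D M : ℕ) (S : Finset (Fin D)) : ∃ m : ℕ, ∀ (E : Type) [Field E] (w : AbsoluteValue E ℝ) (R : ℝ)
    (A : Matrix (Fin D) (Fin D) E) (α : Fin D → E), 2 ≤ R → (∀ a b, w (A a b) ≤ R ^ M) →
    A.charpoly = ∏ i, (X - C (α i)) → (∀ i, w (α i) ≤ R ^ M) →
    (∀ i ∈ S, ∀ l ∉ S, 1 ≤ w (α i - α l) * R ^ M) →
    ∃ P : Matrix (Fin D) (Fin D) E, P * A = A * P ∧ P * P = P ∧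
      aeval A (∏ i ∈ S, (X - C (α i))) * P = 0 ∧ aeval A (∏ i ∈ Sᶜ, (X - C (α i))) * (1 - P) = 0 ∧
      ∀ a b, w (P a b) ≤ R ^ m := by
  by_contra hcon
  push Not at hcon
  choose E iE w R A α h1 h2 h3 h4 h5 h6 using hcon
  obtain ⟨m, hm⟩ := PROJ_seq D M E w R A α S h1 h2 h3 h4 h5
  obtain ⟨P, p1, p2, p3, p4, p5⟩ := hm m
  obtain ⟨a, b, hab⟩ := h6 m P p1 p2 p3 p4
  exact absurd (p5 a b) (not_le.mpr hab)

open Polynomial in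
theorem CHb_seq {n : Type} [Fintype n] [DecidableEq n] (M : ℕ) {ι : Type} (E : ι → Type) [∀ j, Field (E j)]
    (w : ∀ j, AbsoluteValue (E j) ℝ) (R : ι → ℝ)
    (B B' : ∀ j, Matrix n n (E j)) (hR : ∀ j, 2 ≤ R j) (hB : ∀ j a b, w j (B j a b) ≤ R j ^ M)
    (hB' : ∀ j a b, w j (B' j a b) ≤ R j ^ M) (hBB : ∀ j, B j * B' j = 1) :
    ∃ m : ℕ, ∀ j, ∃ c : ℕ → E j, 1 ≤ w j (c 0) * R j ^ m ∧ (∀ s, w j (c s) ≤ R j ^ m) ∧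
      ∑ s ∈ Finset.range (Fintype.card n + 1), c s • (B j) ^ s = 0 := by
  obtain ⟨G, hG⟩ := Obd_mat_exists w R hR B M hB
  obtain ⟨G', hG'⟩ := Obd_mat_exists w R hR B' M hB'
  have hGG : G * G' = 1 := by
    apply Obd_mat_ext
    intro j
    rw [Matrix.map_mul, hG, hG', hBB]
    exact (Matrix.map_one _ (map_zero _) (map_one _)).symm
  have hdet : IsUnit G.det := IsUnit.of_mul_eq_one G'.det (by rw [← Matrix.det_mul, hGG, Matrix.det_one])
  have hc0 : IsUnit (G.charpoly.coeff 0) := by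
    have := Matrix.det_eq_sign_charpoly_coeff G
    rw [this] at hdet
    exact isUnit_of_mul_isUnit_right hdet
  obtain ⟨u, hu⟩ := hc0
  obtain ⟨m0, hm0⟩ := (↑u⁻¹ : Obd w R hR).2
  choose mc hmc using fun s => (G.charpoly.coeff s).2
  set N := Fintype.card n with hN
  have hdeg : G.charpoly.natDegree = N ∨ ¬ Nontrivial (Obd w R hR) := by
    by_cases h : Nontrivial (Obd w R hR)
    · exact Or.inl (Matrix.charpoly_natDegree_eq_dim G)
    · exact Or.inr h
  refine ⟨m0 + ∑ s ∈ Finset.range (N + 1), mc s, fun j => ⟨fun s => if s ≤ N then (G.charpoly.coeff s).1 j else 0, ?_, ?_, ?_⟩⟩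
  · simp only [Nat.zero_le, if_true]
    have e : (G.charpoly.coeff 0).1 j * (↑u⁻¹ : Obd w R hR).1 j = 1 := by
      rw [← hu]
      have : (↑u : Obd w R hR) * ↑u⁻¹ = 1 := u.mul_inv
      exact congrArg (fun z : Obd w R hR => z.1 j) this
    have e2 : w j ((G.charpoly.coeff 0).1 j) * w j ((↑u⁻¹ : Obd w R hR).1 j) = 1 := by rw [← map_mul, e, map_one]
    calc (1:ℝ) = _ := e2.symm
      _ ≤ w j ((G.charpoly.coeff 0).1 j) * R j ^ m0 := mul_le_mul_of_nonneg_left (hm0 j) ((w j).nonneg _)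
      _ ≤ _ := by
        apply mul_le_mul_of_nonneg_left _ ((w j).nonneg _)
        exact pow_le_pow_right₀ (by linarith [hR j]) (by omega)
  · intro s
    dsimp only
    split_ifs with h
    · refine (hmc s j).trans (pow_le_pow_right₀ (by linarith [hR j]) ?_)
      have := Finset.single_le_sum (f := mc) (fun _ _ => Nat.zero_le _) (Finset.mem_range.mpr (show s < N + 1 by omega))
      omega
    · rw [map_zero]
      have := hR j
      positivity
  · have hnt : Nontrivial (Obd w R hR) := by
      refine ⟨0, 1, fun h => ?_⟩
      have := congrArg (fun z : Obd w R hR => z.1 j) h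
      exact zero_ne_one this
    have hd : (G.charpoly.map (evO w R hR j)).natDegree = N := by
      rw [← Matrix.charpoly_map]; exact Matrix.charpoly_natDegree_eq_dim _
    have hCH := Matrix.aeval_self_charpoly (B j)
    rw [← hG j, Matrix.charpoly_map, aeval_eq_sum_range, hd, hG j] at hCH
    rw [← hCH]
    apply Finset.sum_congr rfl
    intro s hs
    beta_reduce
    rw [if_pos (by simpa [Nat.lt_succ_iff] using hs), coeff_map]
    rfl

theorem CHb (n : Type) [Fintype n] [DecidableEq n] (M : ℕ) : ∃ m : ℕ, ∀ (E : Type) [Field E] (w : AbsoluteValue E ℝ) (R : ℝ)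
    (B B' : Matrix n n E), 2 ≤ R → (∀ a b, w (B a b) ≤ R ^ M) → (∀ a b, w (B' a b) ≤ R ^ M) → B * B' = 1 →
    ∀ (φ : Matrix n n E →ₗ[E] E), φ 1 ≠ 0 →
      ∃ s, 1 ≤ s ∧ s ≤ Fintype.card n ∧ w (φ 1) ≤ R ^ m * w (φ (B ^ s)) := by
  obtain ⟨m, hm⟩ : ∃ m : ℕ, ∀ (E : Type) [Field E] (w : AbsoluteValue E ℝ) (R : ℝ)
    (B B' : Matrix n n E), 2 ≤ R → (∀ a b, w (B a b) ≤ R ^ M) → (∀ a b, w (B' a b) ≤ R ^ M) → B * B' = 1 →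
     ∃ c : ℕ → E, 1 ≤ w (c 0) * R ^ m ∧ (∀ s, w (c s) ≤ R ^ m) ∧
      ∑ s ∈ Finset.range (Fintype.card n + 1), c s • B ^ s = 0 := by
    by_contra hcon
    push Not at hcon
    choose E iE w R B B' h1 h2 h3 h4 h5 using hcon
    obtain ⟨m, hm⟩ := CHb_seq M E w R B B' h1 h2 h3 h4
    obtain ⟨c, c1, c2, c3⟩ := hm m
    exact h5 m c c1 c2 c3
  refine ⟨2 * m + Fintype.card n, ?_⟩
  intro E _ w R B B' hR hB hB' hBB φ hφ
  obtain ⟨c, c1, c2, c3⟩ := hm E w R B B' hR hB hB' hBB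
  by_contra hcon
  push Not at hcon
  set N := Fintype.card n
  have h1 := congrArg φ c3
  rw [Finset.sum_range_succ', map_add, map_sum, map_zero, pow_zero, map_smul, add_comm, ← eq_neg_iff_add_eq_zero] at h1
  have hpos : 0 < w (φ 1) := w.pos hφ
  have hRm : 0 < R ^ m := by positivity
  have h2 : w (c 0) * w (φ 1) ≤ ∑ s ∈ Finset.range N, R ^ m * w (φ (B ^ (s + 1))) := by
    rw [← map_mul, ← smul_eq_mul, h1, map_neg_eq_map]
    refine (w.sum_le _ _).trans (Finset.sum_le_sum fun s _ => ?_)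
    rw [map_smul, smul_eq_mul, map_mul]
    exact mul_le_mul_of_nonneg_right (c2 _) (w.nonneg _)
  have h3 : ∀ s ∈ Finset.range N, R ^ (2 * m + N) * (R ^ m * w (φ (B ^ (s + 1)))) ≤ R ^ m * w (φ 1) := by
    intro s hs
    have := (hcon (s + 1) (by omega) (by simpa using hs)).le
    calc _ = R ^ m * (R ^ (2 * m + N) * w (φ (B ^ (s + 1)))) := by ring
      _ ≤ _ := mul_le_mul_of_nonneg_left this hRm.le
  have h4 : R ^ (2 * m + N) * (w (c 0) * w (φ 1)) ≤ N * (R ^ m * w (φ 1)) := by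
    refine (mul_le_mul_of_nonneg_left h2 (by positivity)).trans ?_
    rw [Finset.mul_sum]
    refine (Finset.sum_le_card_nsmul _ _ _ h3).trans ?_
    simp
  have h5 : R ^ m * R ^ N * w (φ 1) ≤ R ^ (2 * m + N) * (w (c 0) * w (φ 1)) := by
    calc R ^ m * R ^ N * w (φ 1) = (R ^ m * R ^ N * w (φ 1)) * 1 := by ring
      _ ≤ (R ^ m * R ^ N * w (φ 1)) * (w (c 0) * R ^ m) := mul_le_mul_of_nonneg_left c1 (by positivity)
      _ = _ := by rw [two_mul, pow_add, pow_add]; ring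
  have h6 : (N:ℝ) < R ^ N := by
    calc (N:ℝ) < 2 ^ N := by exact_mod_cast Nat.lt_two_pow_self
      _ ≤ _ := by gcongr
  have h7 : (N:ℝ) * (R ^ m * w (φ 1)) < R ^ N * (R ^ m * w (φ 1)) := mul_lt_mul_of_pos_right h6 (by positivity)
  linarith

/-- gap lemma -/
theorem gap (D : ℕ) : ∃ η₀ : ℝ, 0 < η₀ ∧ ∀ t : Fin D → ℝ, ∑ i, t i = 0 → (∃ i, 1 / 2 ≤ t i) →
    ∃ (S : Finset (Fin D)) (c η : ℝ), S.Nonempty ∧ S ≠ Finset.univ ∧ η₀ ≤ η ∧ η ≤ 1 / 4 ∧ (∃ i, t i = c) ∧ 1 / 2 ≤ c ∧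
      (∀ i ∈ S, c - η ≤ t i) ∧ (∀ i, t i ≤ c) ∧ ∀ i ∉ S, t i ≤ c - 4 * D * η := by
  rcases Nat.eq_zero_or_pos D with rfl | hD
  · refine ⟨1, one_pos, ?_⟩
    rintro t _ ⟨i, _⟩
    exact i.elim0
  have hD1 : (1:ℝ) ≤ D := by exact_mod_cast hD
  let e : ℕ → ℝ := fun k => 1 / 4 * (1 / (4 * D)) ^ k
  have he0 : ∀ k, 0 < e k := fun k => by positivity
  have hes : ∀ k, e k = 4 * D * e (k + 1) := by
    intro k; simp only [e, pow_succ]; field_simp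
  have hanti : Antitone e := by
    apply antitone_nat_of_succ_le
    intro k
    rw [hes k]
    nlinarith [he0 (k+1)]
  refine ⟨e (D + 1), he0 _, ?_⟩
  intro t hsum ⟨i0, hi0⟩
  obtain ⟨i, -, hi⟩ := Finset.exists_max_image Finset.univ t ⟨i0, Finset.mem_univ _⟩
  have hc : 1 / 2 ≤ t i := hi0.trans (hi i0 (Finset.mem_univ _))
  let F : ℕ → Finset (Fin D) := fun k => Finset.univ.filter (fun l => t i - e k ≤ t l)
  have hFmem : ∀ k l, l ∈ F k ↔ t i - e k ≤ t l := fun k l => by simp [F]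
  have hiF : ∀ k, i ∈ F k := fun k => (hFmem k i).mpr (by linarith [he0 k])
  obtain ⟨k, hk, hkF⟩ : ∃ k, k < D ∧ F k = F (k + 1) := by
    by_contra hcon
    push Not at hcon
    have : ∀ k, k ≤ D → (F k).card + k ≤ D := by
      intro k
      induction k with
      | zero => intro _; simpa using Finset.card_le_univ (F 0)
      | succ k ih =>
        intro hk
        have h1 := ih (by omega)
        have hss : F (k + 1) ⊂ F k := by
          refine Finset.ssubset_iff_subset_ne.mpr ⟨?_, (hcon k (by omega)).symm⟩
          intro l hl
          rw [hFmem] at hl ⊢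
          have := hanti (Nat.le_add_right k 1); linarith
        have := Finset.card_lt_card hss
        omega
    have h1 := this D le_rfl
    have h2 := Finset.card_pos.mpr ⟨i, hiF D⟩
    omega
  have h14 : e (k + 1) ≤ 1 / 4 := by
    have := hanti (Nat.zero_le (k + 1))
    simpa [e] using this
  refine ⟨F (k + 1), t i, e (k + 1), ⟨i, hiF _⟩, ?_, hanti (by omega), h14, ⟨i, rfl⟩, hc,
    fun l hl => (hFmem _ l).mp hl, fun l => hi l (Finset.mem_univ _), ?_⟩
  · intro h
    have : ∑ l : Fin D, (1 / 4 : ℝ) ≤ ∑ l, t l := by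
      apply Finset.sum_le_sum
      intro l _
      have : l ∈ F (k + 1) := by rw [h]; exact Finset.mem_univ _
      rw [hFmem] at this
      linarith
    rw [hsum] at this
    simp at this
    linarith
  · intro l hl
    rw [← hkF, hFmem, hes k] at hl
    linarith
end UPI
end

section
open Pointwise
namespace UPI

abbrev AW (E : Type*) [Field E] (D i : ℕ) := (Fin D → E) [⋀^Fin i]→ₗ[E] E

section
variable {E : Type*} [Field E] {D i : ℕ}

noncomputable def rhoE (D i : ℕ) : Matrix (Fin D) (Fin D) E →* Module.End E (AW E D i) where
  toFun g :=
    { toFun := fun ω => ω.compLinearMap (Matrix.vecMulLinear g)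
      map_add' := fun _ _ => rfl
      map_smul' := fun _ _ => rfl }
  map_one' := by
    ext ω v
    change ω (fun l => Matrix.vecMul (v l) 1) = ω v
    simp only [Matrix.vecMul_one]
  map_mul' g h := by
    ext ω v
    change ω (fun l => Matrix.vecMul (v l) (g * h)) = ω (fun l => Matrix.vecMul (Matrix.vecMul (v l) g) h)
    simp only [Matrix.vecMul_vecMul]

theorem rhoE_apply (g : Matrix (Fin D) (Fin D) E) (ω : AW E D i) (v : Fin i → Fin D → E) :
    rhoE D i g ω v = ω (fun l => Matrix.vecMul (v l) g) := rfl

theorem rhoE_smul (c : E) (g : Matrix (Fin D) (Fin D) E) : rhoE D i (c • g) = c ^ i • rhoE D i g := by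
  ext ω v
  rw [rhoE_apply, LinearMap.smul_apply, AlternatingMap.smul_apply, rhoE_apply]
  simp only [Matrix.vecMul_smul]
  have := ω.toMultilinearMap.map_smul_univ (fun _ => c) (fun l => Matrix.vecMul (v l) g)
  simpa using this

/-- standard tuple -/
def eJ (J : Fin i → Fin D) : Fin i → Fin D → E := fun l => Pi.single (J l) 1

theorem expand (ω : AW E D i) (v : Fin i → Fin D → E) :
    ω v = ∑ J : Fin i → Fin D, (∏ l, v l (J l)) * ω (eJ J) := by
  have h1 : v = fun l => ∑ k : Fin D, v l k • (Pi.single k (1:E) : Fin D → E) := by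
    funext l
    exact pi_eq_sum_univ' (v l)
  have h2 := ω.toMultilinearMap.map_sum (fun l (k : Fin D) => v l k • (Pi.single k (1:E) : Fin D → E))
  rw [← h1] at h2
  refine h2.trans (Finset.sum_congr rfl fun J _ => ?_)
  have := ω.toMultilinearMap.map_smul_univ (fun l => v l (J l)) (eJ J)
  simpa [eJ] using this

theorem AW_ext {ω ω' : AW E D i} (h : ∀ J : Fin i → Fin D, ω (eJ J) = ω' (eJ J)) : ω = ω' := by
  ext v
  rw [expand, expand ω']
  simp only [h]

variable (w : AbsoluteValue E ℝ)

noncomputable def NE (ω : AW E D i) : ℝ := ∑ J : Fin i → Fin D, w (ω (eJ J))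

theorem NE_ax : NormAx w (NE w : AW E D i → ℝ) where
  nonneg x := Finset.sum_nonneg fun _ _ => w.nonneg _
  add x y := by
    simp only [NE, ← Finset.sum_add_distrib]
    exact Finset.sum_le_sum fun _ _ => w.add_le _ _
  smul c x := by
    simp only [NE, AlternatingMap.smul_apply, smul_eq_mul, map_mul, Finset.mul_sum]
  eq0 x h := by
    apply AW_ext
    intro J
    have h1 := (Finset.sum_eq_zero_iff_of_nonneg (fun _ _ => w.nonneg _)).mp h J (Finset.mem_univ _)
    simpa using h1

theorem apply_le (ω : AW E D i) (v : Fin i → Fin D → E) (B : Fin i → ℝ) (hv : ∀ l k, w (v l k) ≤ B l) :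
    w (ω v) ≤ (∏ l, B l) * NE w ω := by
  rw [expand, NE, Finset.mul_sum]
  refine (w.sum_le _ _).trans (Finset.sum_le_sum fun J _ => ?_)
  rw [map_mul, map_prod]
  apply mul_le_mul_of_nonneg_right _ (w.nonneg _)
  exact Finset.prod_le_prod (fun _ _ => w.nonneg _) (fun l _ => hv _ _)

theorem eJ_vecMul (J : Fin i → Fin D) (g : Matrix (Fin D) (Fin D) E) (l : Fin i) :
    Matrix.vecMul ((eJ J : Fin i → Fin D → E) l) g = g (J l) := by
  simp [eJ]
  rfl

theorem NE_rho (g : Matrix (Fin D) (Fin D) E) (c : ℝ) (hg : ∀ a b, w (g a b) ≤ c) (ω : AW E D i) :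
    NE w (rhoE D i g ω) ≤ (D * c) ^ i * NE w ω := by
  rw [NE]
  refine (Finset.sum_le_card_nsmul _ _ (c ^ i * NE w ω) ?_).trans (le_of_eq ?_)
  · intro J _
    rw [rhoE_apply]
    have := apply_le w ω (fun l => Matrix.vecMul ((eJ J : Fin i → Fin D → E) l) g) (fun _ => c) (by
      intro l k; beta_reduce; rw [eJ_vecMul]; exact hg _ _)
    simpa using this
  · simp [mul_pow, mul_assoc]

theorem NE_contract (hi : 1 ≤ i) (b P : Matrix (Fin D) (Fin D) E) (u : AW E D i) (hu : rhoE D i P u = 0)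
    (x y : ℝ) (hx : ∀ a k, w ((b * P) a k) ≤ x) (hy : ∀ a k, w ((b * (1 - P)) a k) ≤ y) (hy0 : 0 ≤ y) (hyx : y ≤ x) :
    NE w (rhoE D i b u) ≤ (2 * D) ^ i * (y * x ^ (i - 1)) * NE w u := by
  rw [NE]
  refine (Finset.sum_le_card_nsmul _ _ (2 ^ i * (y * x ^ (i - 1)) * NE w u) ?_).trans (le_of_eq ?_)
  swap
  · simp [mul_pow]; ring
  intro J _
  rw [rhoE_apply]
  have e : (fun l => Matrix.vecMul ((eJ J : Fin i → Fin D → E) l) b) =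
      (fun l => (b * P) (J l)) + (fun l => (b * (1 - P)) (J l)) := by
    funext l
    rw [Pi.add_apply, eJ_vecMul]
    have : b = b * P + b * (1 - P) := by rw [← mul_add, add_sub_cancel, mul_one]
    conv_lhs => rw [this]
    rfl
  rw [e, AlternatingMap.map_add_univ]
  refine (w.sum_le _ _).trans ?_
  refine (Finset.sum_le_card_nsmul _ _ (y * x ^ (i - 1) * NE w u) ?_).trans (le_of_eq ?_)
  swap
  · simp [mul_assoc]
  intro s _
  have hx0 : 0 ≤ x := hy0.trans hyx
  by_cases hs : s = Finset.univ
  · subst hs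
    have : u (Finset.univ.piecewise (fun l => (b * P) (J l)) (fun l => (b * (1 - P)) (J l))) = 0 := by
      have h2 := congrArg (fun z : AW E D i => z (fun l => b (J l))) hu
      simp only [rhoE_apply] at h2
      rw [Finset.piecewise_univ]
      exact h2
    rw [this, map_zero]
    have := (NE_ax w).nonneg u
    positivity
  · have := apply_le w u (s.piecewise (fun l => (b * P) (J l)) (fun l => (b * (1 - P)) (J l)))
      (s.piecewise (fun _ => x) (fun _ => y)) (by
        intro l k
        by_cases hl : l ∈ s
        · simp only [Finset.piecewise_eq_of_mem _ _ _ hl]; exact hx _ _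
        · simp only [Finset.piecewise_eq_of_notMem _ _ _ hl]; exact hy _ _)
    refine this.trans (mul_le_mul_of_nonneg_right ?_ ((NE_ax w).nonneg u))
    obtain ⟨l, hl⟩ : ∃ l, l ∉ s := by
      by_contra hcon
      push Not at hcon
      exact hs (Finset.eq_univ_iff_forall.mpr hcon)
    rw [← Finset.mul_prod_erase Finset.univ _ (Finset.mem_univ l), Finset.piecewise_eq_of_notMem _ _ _ hl]
    apply mul_le_mul_of_nonneg_left _ hy0
    refine (Finset.prod_le_prod (g := fun _ => x) ?_ ?_).trans (le_of_eq ?_)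
    · intro k _
      by_cases hk : k ∈ s
      · simp [hk, hx0]
      · simp [hk, hy0]
    · intro k _
      by_cases hk : k ∈ s
      · simp [hk]
      · simp [hk, hyx]
    · simp

/-- rank one structure -/
theorem EXT (P : Matrix (Fin D) (Fin D) E) (hP : P * P = P)
    (hi : Module.finrank E (LinearMap.range (Matrix.vecMulLinear P)) = i) :
    ∃ (f : AW E D i →ₗ[E] E) (o : AW E D i), f o = 1 ∧ (∀ ω, rhoE D i P ω = f ω • o) ∧
      ∀ x, (∀ (v : Fin i → Fin D → E) k, o (Function.update v k x) = 0) → Matrix.vecMul x P = 0 := by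
  let U := LinearMap.range (Matrix.vecMulLinear P)
  let e : Module.Basis (Fin i) E U := Module.finBasisOfFinrankEq E U hi
  let f : AW E D i →ₗ[E] E :=
    { toFun := fun ω => ω (fun l => (e l : Fin D → E))
      map_add' := fun _ _ => rfl
      map_smul' := fun _ _ => rfl }
  let o : AW E D i := e.det.compLinearMap (Matrix.vecMulLinear P).rangeRestrict
  have hres : ∀ y : U, (Matrix.vecMulLinear P).rangeRestrict (y : Fin D → E) = y := by
    rintro ⟨_, ⟨z, rfl⟩⟩
    apply Subtype.ext
    simp [Matrix.vecMul_vecMul, hP]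
  refine ⟨f, o, ?_, ?_, ?_⟩
  · change e.det (fun l => (Matrix.vecMulLinear P).rangeRestrict (e l : Fin D → E)) = 1
    simp only [hres]
    exact e.det_self
  · intro ω
    have h := AlternatingMap.eq_smul_basis_det e (ω.compLinearMap U.subtype)
    ext v
    have h2 := congrArg (fun z : U [⋀^Fin i]→ₗ[E] E => z (fun l => (Matrix.vecMulLinear P).rangeRestrict (v l))) h
    exact h2
  · intro x hx
    by_contra hne
    let y : U := (Matrix.vecMulLinear P).rangeRestrict x
    have hy : y ≠ 0 := by
      intro h
      exact hne (congrArg Subtype.val h)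
    have : ∃ k, e.repr y k ≠ 0 := by
      by_contra hcon
      push Not at hcon
      apply hy
      apply e.repr.injective
      ext k
      simp [hcon k]
    obtain ⟨k, hk⟩ := this
    apply hk
    have h := hx (fun l => (e l : Fin D → E)) k
    have h2 : o (Function.update (fun l => (e l : Fin D → E)) k x) = e.det (Function.update e k y) := by
      change e.det (fun l => (Matrix.vecMulLinear P).rangeRestrict (Function.update (fun l => (e l : Fin D → E)) k x l)) = _
      congr 1
      funext l
      by_cases hl : l = k
      · subst hl; simp [y]
      · simp only [Function.update_of_ne hl]; exact hres _
    rw [h2] at h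
    have h3 : e.det (Function.update e k y) = e.repr y k := by
      conv_lhs => rw [← e.sum_repr y]
      rw [AlternatingMap.map_update_sum, Finset.sum_eq_single k]
      · rw [AlternatingMap.map_update_smul, Function.update_eq_self, e.det_self]; simp
      · intro l _ hl
        rw [AlternatingMap.map_update_smul, AlternatingMap.map_update_self _ _ hl.symm, smul_zero]
      · simp
    rw [← h3, h]

theorem range_le_of_leftker (A A' : Matrix (Fin D) (Fin D) E) (h : ∀ x, Matrix.vecMul x A = 0 → Matrix.vecMul x A' = 0) :
    LinearMap.range A'.mulVecLin ≤ LinearMap.range A.mulVecLin := by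
  intro y hy
  by_contra hn
  obtain ⟨φ, hφ, hle⟩ := Submodule.exists_le_ker_of_notMem hn
  let x : Fin D → E := fun k => φ (Pi.single k 1)
  have hx : ∀ v, φ v = dotProduct x v := by
    intro v
    conv_lhs => rw [pi_eq_sum_univ' v]
    rw [map_sum]
    simp [dotProduct, x, mul_comm]
  have h1 : Matrix.vecMul x A = 0 := by
    funext k
    have : φ (A.mulVecLin (Pi.single k 1)) = 0 := hle ⟨_, rfl⟩
    rw [hx, Matrix.mulVecLin_apply, Matrix.dotProduct_mulVec] at this
    simpa using this
  have h2 := h x h1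
  obtain ⟨z, rfl⟩ := hy
  apply hφ
  rw [hx, Matrix.mulVecLin_apply, Matrix.dotProduct_mulVec, h2, zero_dotProduct]

theorem line_range (P : Matrix (Fin D) (Fin D) E) (f : AW E D i →ₗ[E] E) (o : AW E D i) (hfo : f o = 1)
    (hPo : ∀ ω, rhoE D i P ω = f ω • o)
    (hrad : ∀ x, (∀ (v : Fin i → Fin D → E) k, o (Function.update v k x) = 0) → Matrix.vecMul x P = 0)
    (h h' : Matrix (Fin D) (Fin D) E) (hh' : IsUnit h') (c : E) (hc : c ≠ 0)
    (hc2 : rhoE D i h o = c • rhoE D i h' o) :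
    LinearMap.range (h' * P).mulVecLin ≤ LinearMap.range (h * P).mulVecLin := by
  apply range_le_of_leftker
  intro x hx
  rw [← Matrix.vecMul_vecMul] at hx ⊢
  apply hrad
  intro v k
  obtain ⟨u, rfl⟩ := hh'
  have e : (fun l => Matrix.vecMul (Function.update (fun l => Matrix.vecMul (v l) (u⁻¹ : (Matrix (Fin D) (Fin D) E)ˣ).1) k x l) u.1) =
      Function.update v k (Matrix.vecMul x u.1) := by
    funext l
    by_cases hl : l = k
    · subst hl; simp
    · simp only [Function.update_of_ne hl, Matrix.vecMul_vecMul, Units.inv_mul, Matrix.vecMul_one]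
  have h1 : rhoE D i u.1 o (Function.update (fun l => Matrix.vecMul (v l) (u⁻¹ : (Matrix (Fin D) (Fin D) E)ˣ).1) k x) = 0 := by
    have h2 : rhoE D i h o (Function.update (fun l => Matrix.vecMul (v l) (u⁻¹ : (Matrix (Fin D) (Fin D) E)ˣ).1) k x) = 0 := by
      have h3 : rhoE D i P o = o := by rw [hPo, hfo, one_smul]
      rw [← h3, rhoE_apply, rhoE_apply]
      apply o.toMultilinearMap.map_coord_zero k
      simpa using hx
    rw [hc2, AlternatingMap.smul_apply, smul_eq_mul] at h2
    exact (mul_eq_zero.mp h2).resolve_left hc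
  rw [rhoE_apply, e] at h1
  exact h1
end
end UPI
end

section
open Pointwise
namespace UPI
open Polynomial

theorem adj_bound {E : Type*} [Field E] {D : ℕ} (w : AbsoluteValue E ℝ) (A : Matrix (Fin D) (Fin D) E) (R : ℝ) (K : ℕ)
    (hR : 1 ≤ R) (hD : (D.factorial : ℝ) ≤ R) (hA : ∀ a b, w (A a b) ≤ R ^ K) (a b : Fin D) :
    w (A.adjugate a b) ≤ R ^ (K * D + 1) := by
  rw [Matrix.adjugate_apply]
  have h1 : (1:ℝ) ≤ R ^ K := one_le_pow₀ hR
  have := Matrix.det_le (abv := w) (x := R ^ K) (A := A.updateRow b (Pi.single a 1)) (by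
    intro i j
    rw [Matrix.updateRow_apply]
    split_ifs
    · rw [Pi.single_apply]; split_ifs
      · rw [map_one]; exact h1
      · rw [map_zero]; positivity
    · exact hA _ _)
  refine this.trans ?_
  rw [nsmul_eq_mul, Fintype.card_fin, pow_succ, pow_mul, mul_comm]
  gcongr

theorem aeval_comm {E R : Type*} [CommRing E] [Ring R] [Algebra E R] (A B : R) (h : Commute A B) (p q : E[X]) :
    Commute (aeval A p) (aeval B q) := by
  have h1 : Commute A (aeval B q) := by
    induction q using Polynomial.induction_on' with
    | add p q hp hq => rw [map_add]; exact hp.add_right hq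
    | monomial n c => rw [aeval_monomial]; exact Commute.mul_right (Algebra.commutes c A).symm (h.pow_right n)
  induction p using Polynomial.induction_on' with
  | add p q hp hq => rw [map_add]; exact hp.add_left hq
  | monomial n c => rw [aeval_monomial]; exact Commute.mul_left (Algebra.commutes c _) (h1.pow_left n)

theorem inv_annih {E : Type*} [Field E] {D : ℕ} (A A' : Matrix (Fin D) (Fin D) E) (h : A * A' = 1) (h' : A' * A = 1)
    {ι : Type*} [DecidableEq ι] (S : Finset ι) (α : ι → E) (hα : ∀ i ∈ S, α i ≠ 0) :
    ∃ Z, aeval A' (∏ i ∈ S, (X - C (α i)⁻¹)) = Z * aeval A (∏ i ∈ S, (X - C (α i))) := by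
  induction S using Finset.induction_on with
  | empty => exact ⟨1, by simp⟩
  | insert i S hi ih =>
    obtain ⟨Z, hZ⟩ := ih (fun j hj => hα j (Finset.mem_insert_of_mem hj))
    have hi0 := hα i (Finset.mem_insert_self _ _)
    have key : aeval A' (X - C (α i)⁻¹) = (-(α i)⁻¹) • A' * aeval A (X - C (α i)) := by
      simp only [map_sub, aeval_X, aeval_C, mul_sub, Matrix.smul_mul, h', Algebra.algebraMap_eq_smul_one, Matrix.mul_smul,
        Matrix.mul_one, smul_smul]
      rw [show (α i * -(α i)⁻¹) = -1 by field_simp, neg_smul, neg_smul]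
      simp; abel
    have comm : aeval A (X - C (α i)) * Z * aeval A (∏ i ∈ S, (X - C (α i))) = Z * aeval A (X - C (α i)) * aeval A (∏ i ∈ S, (X - C (α i))) := by
      rw [mul_assoc, ← hZ, mul_assoc, ← map_mul, mul_comm (X - C (α i)), map_mul, ← mul_assoc, ← hZ]
      exact aeval_comm _ _ (by rw [Commute, SemiconjBy, h, h']) _ _
    refine ⟨(-(α i)⁻¹) • A' * Z, ?_⟩
    rw [Finset.prod_insert hi, Finset.prod_insert hi, map_mul, map_mul, hZ, key]
    rw [mul_assoc, ← mul_assoc _ Z, comm]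
    simp only [mul_assoc]

/-- spectral splitting -/
theorem T1spec (D K : ℕ) : ∃ (m : ℕ) (η₀ R0 : ℝ), 0 < η₀ ∧ ∀ (E : Type) [Field E] [IsAlgClosed E] (w : AbsoluteValue E ℝ) (R : ℝ)
    (a : Matrix (Fin D) (Fin D) E), R0 ≤ R → (∀ i j, w (a i j) ≤ R ^ K) → a.det = 1 →
    (∃ α, a.charpoly.IsRoot α ∧ R ≤ w α ^ 2) →
    ∃ (P : Matrix (Fin D) (Fin D) E) (T θ : ℝ), P * P = P ∧ P * a = a * P ∧ P ≠ 0 ∧ P ≠ 1 ∧ 0 < T ∧ R ^ η₀ ≤ θ ∧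
      (∀ i j, w (P i j) ≤ R ^ m) ∧ ∀ r : ℕ, 1 ≤ r → 3 * (r:ℝ) ≤ R →
        (∀ i j, w ((a ^ r * P) i j) ≤ T ^ r * R ^ m) ∧
        (∀ i j, w ((a ^ r * (1 - P)) i j) ≤ (T / θ ^ (4 * D)) ^ r * R ^ m) ∧
        (∀ i j, w ((a.adjugate ^ r * P) i j) ≤ (θ / T) ^ r * R ^ m) := by
  obtain ⟨η₀, hη₀, hgap⟩ := gap D
  let M := K * D + K + D + 2
  choose mP hmP using PROJ D M
  let M2 := M + 1 + ∑ S, mP S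
  obtain ⟨mB, hmB⟩ := PB D M2
  have hM2 : ∀ S, mP S ≤ M2 := fun S => (Finset.single_le_sum (f := mP) (fun _ _ => Nat.zero_le _) (Finset.mem_univ S)).trans (by omega)
  refine ⟨M2 + mB, η₀, max (max 4 D) (max D.factorial (2 ^ (1 / η₀))), hη₀, ?_⟩
  intro E _ _ w R a hR0 ha hdet ⟨α0, hα0, hα0R⟩
  simp only [max_le_iff] at hR0
  obtain ⟨⟨hR4, hRD⟩, hRf, hRη⟩ := hR0
  have hR2 : (2:ℝ) ≤ R := by linarith
  have hR1 : (1:ℝ) < R := by linarith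
  have hR0 : (0:ℝ) < R := by linarith
  obtain ⟨α, hα⟩ := exists_roots_fin D a.charpoly (Matrix.charpoly_monic a) (by rw [Matrix.charpoly_natDegree_eq_dim, Fintype.card_fin])
  have hroot : ∀ i, a.charpoly.IsRoot (α i) := by
    intro i
    rw [hα, IsRoot, eval_prod]
    exact Finset.prod_eq_zero (Finset.mem_univ i) (by simp)
  have hprod : ∏ i, α i = 1 := by
    have h1 := Matrix.eval_charpoly a 0
    rw [hα, eval_prod] at h1
    simp only [eval_sub, eval_X, eval_C, zero_sub, map_zero, Matrix.det_neg, hdet, Finset.prod_neg, Fintype.card_fin,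
      Finset.card_univ, mul_one] at h1
    exact (mul_right_inj' (pow_ne_zero _ (neg_ne_zero.mpr one_ne_zero))).mp (h1.trans (mul_one _).symm)
  have hα_ne : ∀ i, α i ≠ 0 := by
    intro i h
    rw [Finset.prod_eq_zero (Finset.mem_univ i) h] at hprod
    exact zero_ne_one hprod
  have hwα : ∀ i, 0 < w (α i) := fun i => w.pos (hα_ne i)
  have hup : ∀ i, w (α i) ≤ R ^ (K + 1) := by
    intro i
    refine (ev_le w a (R ^ K) ha (α i) (hroot i)).trans ?_
    rw [pow_succ, mul_comm]
    gcongr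
  have hlog : 0 < Real.log R := Real.log_pos hR1
  let t : Fin D → ℝ := fun i => Real.log (w (α i)) / Real.log R
  have ht : ∀ i, w (α i) = R ^ (t i) := by
    intro i
    rw [Real.rpow_def_of_pos hR0, mul_div_cancel₀ _ hlog.ne', Real.exp_log (hwα i)]
  have htsum : ∑ i, t i = 0 := by
    rw [← Finset.sum_div, ← Real.log_prod (fun i _ => (hwα i).ne'), ← map_prod, hprod, map_one, Real.log_one, zero_div]
  obtain ⟨i0, hi0⟩ : ∃ i, α i = α0 := by
    rw [hα, IsRoot, eval_prod, Finset.prod_eq_zero_iff] at hα0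
    obtain ⟨i, _, hi⟩ := hα0
    exact ⟨i, by simpa [sub_eq_zero, eq_comm] using hi⟩
  have hthalf : 1 / 2 ≤ t i0 := by
    rw [← hi0, ht, ← Real.rpow_natCast, ← Real.rpow_mul hR0.le] at hα0R
    conv_lhs at hα0R => rw [← Real.rpow_one R]
    rw [Real.rpow_le_rpow_left_iff hR1] at hα0R
    push_cast at hα0R
    linarith
  obtain ⟨S, c, η, hSne, hSu, hη1, hη2, ⟨i1, hi1⟩, hc, hSc, hall, hSc'⟩ := hgap t htsum ⟨i0, hthalf⟩
  have hη : 0 < η := lt_of_lt_of_le hη₀ hη1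
  have hD1 : 1 ≤ D := by have := i0.2; omega
  have hcK : c ≤ K + 1 := by
    have := hup i1
    rw [ht, hi1, ← Real.rpow_natCast, Real.rpow_le_rpow_left_iff hR1] at this
    exact_mod_cast this
  set T := R ^ c with hT
  set θ := R ^ η with hθ
  have hTpos : 0 < T := Real.rpow_pos_of_pos hR0 _
  have hθpos : 0 < θ := Real.rpow_pos_of_pos hR0 _
  have mono : ∀ {x y : ℝ}, x ≤ y → R ^ x ≤ R ^ y := fun h => Real.rpow_le_rpow_of_exponent_le hR1.le h
  have hθ2 : 2 ≤ θ := by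
    calc (2:ℝ) = (2 ^ (1 / η₀)) ^ η₀ := by rw [← Real.rpow_mul (by norm_num), one_div, inv_mul_cancel₀ hη₀.ne', Real.rpow_one]
      _ ≤ R ^ η₀ := Real.rpow_le_rpow (by positivity) hRη hη₀.le
      _ ≤ θ := mono hη1
  have hθR : θ ≤ R := by
    calc θ ≤ R ^ (1:ℝ) := mono (by linarith)
      _ = R := Real.rpow_one R
  have hTR : T ≤ R ^ (K + 1) := by
    calc T ≤ R ^ ((K + 1 : ℕ):ℝ) := mono (by push_cast; exact hcK)
      _ = _ := Real.rpow_natCast _ _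
  have hT1 : 1 ≤ T := by
    calc (1:ℝ) = R ^ (0:ℝ) := (Real.rpow_zero R).symm
      _ ≤ T := mono (by linarith)
  have hθ1 : 1 ≤ θ := by linarith
  have hS1 : ∀ i ∈ S, T / θ ≤ w (α i) := by
    intro i hi
    rw [hT, hθ, ← Real.rpow_sub hR0, ht]; exact mono (hSc i hi)
  have hS2 : ∀ i, w (α i) ≤ T := by
    intro i; rw [ht]; exact mono (hall i)
  have hθpow : ∀ n : ℕ, θ ^ n = R ^ (n * η) := by
    intro n; rw [hθ, ← Real.rpow_natCast, ← Real.rpow_mul hR0.le, mul_comm]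
  have hS3 : ∀ i ∉ S, w (α i) ≤ T / θ ^ (4 * D) := by
    intro i hi
    rw [hθpow, hT, ← Real.rpow_sub hR0, ht]; apply mono
    push_cast; exact hSc' i hi
  have hTθ : 1 ≤ T / θ := by
    rw [hT, hθ, ← Real.rpow_sub hR0]
    calc (1:ℝ) = R ^ (0:ℝ) := (Real.rpow_zero R).symm
      _ ≤ _ := mono (by linarith)
  have hθ4 : θ ^ (4 * D) ≤ R ^ D := by
    rw [hθpow, ← Real.rpow_natCast]; apply mono; push_cast
    nlinarith [(Nat.cast_nonneg D : (0:ℝ) ≤ D)]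
  have hdiff : ∀ i ∈ S, ∀ l ∉ S, 1 / 2 ≤ w (α i - α l) := by
    intro i hi l hl
    have h1 := hS1 i hi
    have h2 := hS3 l hl
    have h3 : w (α i) ≤ w (α i - α l) + w (α l) := by simpa using w.add_le (α i - α l) (α l)
    have h4 : T / θ ^ (4 * D) ≤ T / θ / 2 := by
      rw [div_div]
      apply div_le_div_of_nonneg_left hTpos.le (by positivity)
      calc θ * 2 ≤ θ * θ := by gcongr
        _ = θ ^ 2 := by ring
        _ ≤ _ := pow_le_pow_right₀ hθ1 (by omega)
    linarith
  obtain ⟨P, hPa, hPP, hP1, hP2, hPb⟩ := hmP S E w R a α hR2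
    (fun i j => (ha i j).trans (pow_le_pow_right₀ hR1.le (by simp only [M]; omega))) hα
    (fun i => (hup i).trans (pow_le_pow_right₀ hR1.le (by simp only [M]; omega))) (by
      intro i hi l hl
      have h1 := hdiff i hi l hl
      have h2 : R ≤ R ^ M := le_self_pow₀ hR1.le (by simp only [M]; omega)
      nlinarith)
  have hevec : ∀ i (p : E[X]), aeval a p = 0 → p.eval (α i) = 0 := by
    intro i p hp
    obtain ⟨v, hv, hav⟩ := (isRoot_charpoly_iff a (α i)).mp (hroot i)
    have h1 : Module.End.HasEigenvector (Matrix.toLin' a) (α i) v := ⟨Module.End.mem_eigenspace_iff.mpr (by simpa using hav), hv⟩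
    have h2 := Module.End.aeval_apply_of_hasEigenvector (p := p) h1
    have h3 : aeval (Matrix.toLin' a) p = Matrix.toLin' (aeval a p) := by
      have := Polynomial.aeval_algHom_apply (Matrix.toLinAlgEquiv' (R := E) (n := Fin D)).toAlgHom a p
      exact this
    rw [h3, hp, map_zero, LinearMap.zero_apply] at h2
    exact (smul_eq_zero.mp h2.symm).resolve_right hv
  have hne : ∀ i ∈ S, ∀ l ∉ S, α i ≠ α l := by
    intro i hi l hl h
    have := hdiff i hi l hl
    rw [h, sub_self, map_zero] at this; norm_num at this
  have hbig : ∀ i j, w (P i j) ≤ R ^ M2 := fun i j => (hPb i j).trans (pow_le_pow_right₀ hR1.le (hM2 S))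
  have hbig' : ∀ i j, w ((1 - P) i j) ≤ R ^ M2 := by
    intro i j
    have h1 : w ((1 - P) i j) ≤ 1 + R ^ mP S := by
      rw [Matrix.sub_apply]
      refine (w.sub_le_add _ _).trans (add_le_add ?_ (hPb i j))
      rw [Matrix.one_apply]; split_ifs <;> simp
    refine h1.trans ?_
    have h2 : R ^ mP S * R ≤ R ^ M2 := by
      rw [← pow_succ]
      apply pow_le_pow_right₀ hR1.le
      have := Finset.single_le_sum (f := mP) (fun _ _ => Nat.zero_le _) (Finset.mem_univ S)
      simp only [M2]; omega
    have h3 : 1 ≤ R ^ mP S := one_le_pow₀ hR1.le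
    nlinarith
  have hMM2 : M + 1 ≤ M2 := by simp only [M2]; omega
  have hpl : ∀ k, k ≤ M2 → R ^ k ≤ R ^ M2 := fun k hk => pow_le_pow_right₀ hR1.le hk
  have hcard : ∀ (Q : Finset (Fin D)), Multiset.card Q.1 ≤ D := fun Q => by
    have := Finset.card_le_univ Q; simpa using this
  have hfin : ∀ (x : ℝ), 0 ≤ x → x * R ^ mB ≤ x * R ^ (M2 + mB) := fun x hx =>
    mul_le_mul_of_nonneg_left (pow_le_pow_right₀ hR1.le (by omega)) hx
  refine ⟨P, T, θ, hPP, hPa, ?_, ?_, hTpos, mono hη1, fun i j => (hbig i j).trans (pow_le_pow_right₀ hR1.le (by omega)), ?_⟩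
  · rintro rfl
    rw [sub_zero, mul_one] at hP2
    obtain ⟨i, hi⟩ := hSne
    have := hevec i _ hP2
    rw [eval_prod, Finset.prod_eq_zero_iff] at this
    obtain ⟨l, hl, hl2⟩ := this
    rw [Finset.mem_compl] at hl
    exact hne i hi l hl (by simpa [sub_eq_zero] using hl2)
  · rintro rfl
    rw [mul_one] at hP1
    obtain ⟨l, hl⟩ : ∃ l, l ∉ S := by
      by_contra h; push Not at h; exact hSu (Finset.eq_univ_iff_forall.mpr h)
    have := hevec l _ hP1
    rw [eval_prod, Finset.prod_eq_zero_iff] at this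
    obtain ⟨i, hi, hi2⟩ := this
    exact hne i hi l hl (by simpa [sub_eq_zero, eq_comm] using hi2)
  intro r hr hrR
  have haM2 : ∀ i j, w (a i j) ≤ R ^ M2 := fun i j => (ha i j).trans (hpl _ (by simp only [M] at hMM2; omega))
  refine ⟨fun i j => ?_, fun i j => ?_, fun i j => ?_⟩
  · refine (hmB E w R a P T (S.1.map α) r hR2 hRD haM2 hbig ?_ ?_ ?_ ?_ ?_ hr hrR i j).trans (hfin _ (by positivity))
    · have : 1 ≤ R ^ M2 := one_le_pow₀ hR1.le
      nlinarith
    · exact hTR.trans (hpl _ (by simp only [M] at hMM2; omega))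
    · rw [Multiset.card_map]; exact hcard S
    · intro ν hν
      obtain ⟨i, _, rfl⟩ := Multiset.mem_map.mp hν
      exact hS2 i
    · rw [Multiset.map_map]; exact hP1
  · refine (hmB E w R a (1 - P) (T / θ ^ (4 * D)) (Sᶜ.1.map α) r hR2 hRD haM2 hbig' ?_ ?_ ?_ ?_ ?_ hr hrR i j).trans (hfin _ (by positivity))
    · rw [div_mul_eq_mul_div, le_div_iff₀ (by positivity), one_mul]
      have h1 := hθ4.trans (hpl D (by simp only [M] at hMM2; omega))
      have : 0 < R ^ M2 := by positivity
      nlinarith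
    · refine (div_le_self hTpos.le (one_le_pow₀ hθ1)).trans (hTR.trans (hpl _ (by simp only [M] at hMM2; omega)))
    · rw [Multiset.card_map]; exact hcard _
    · intro ν hν
      obtain ⟨i, hi, rfl⟩ := Multiset.mem_map.mp hν
      exact hS3 i (Finset.mem_compl.mp hi)
    · rw [Multiset.map_map]; exact hP2
  · refine (hmB E w R a.adjugate P (θ / T) (S.1.map fun i => (α i)⁻¹) r hR2 hRD ?_ hbig ?_ ?_ ?_ ?_ ?_ hr hrR i j).trans (hfin _ (by positivity))
    · intro i j
      exact (adj_bound w a R K hR1.le hRf ha i j).trans (hpl _ (by simp only [M] at hMM2; omega))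
    · rw [div_mul_eq_mul_div, le_div_iff₀ hTpos, one_mul]
      have h1 := hTR.trans (hpl (K + 1) (by simp only [M] at hMM2; omega))
      have : 0 < R ^ M2 := by positivity
      nlinarith
    · refine (div_le_self hθpos.le hT1).trans (hθR.trans ?_)
      exact le_self_pow₀ hR1.le (by simp only [M] at hMM2; omega)
    · rw [Multiset.card_map]; exact hcard _
    · intro ν hν
      obtain ⟨i, hi, rfl⟩ := Multiset.mem_map.mp hν
      rw [map_inv₀, ← inv_div]
      exact inv_anti₀ (by positivity) (hS1 i hi)
    · rw [Multiset.map_map]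
      obtain ⟨Z, hZ⟩ := inv_annih a a.adjugate (by rw [Matrix.mul_adjugate, hdet, one_smul])
        (by rw [Matrix.adjugate_mul, hdet, one_smul]) S α (fun i _ => hα_ne i)
      have : aeval a.adjugate (∏ i ∈ S, (X - C (α i)⁻¹)) * P = 0 := by
        rw [hZ, mul_assoc, hP1, mul_zero]
      exact this
end UPI
end

section
open Pointwise
namespace UPI
open Polynomial

/-- spectral splitting data -/
structure Spec {E : Type} [Field E] {D : ℕ} (w : AbsoluteValue E ℝ) (R : ℝ) (m : ℕ) (η₀ : ℝ)
    (a P : Matrix (Fin D) (Fin D) E) : Prop where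
  PP : P * P = P
  Pa : P * a = a * P
  P0 : P ≠ 0
  P1 : P ≠ 1
  Pb : ∀ i j, w (P i j) ≤ R ^ m
  ex : ∃ T θ : ℝ, 0 < T ∧ R ^ η₀ ≤ θ ∧ ∀ r : ℕ, 1 ≤ r → 3 * (r:ℝ) ≤ R →
        (∀ i j, w ((a ^ r * P) i j) ≤ T ^ r * R ^ m) ∧
        (∀ i j, w ((a ^ r * (1 - P)) i j) ≤ (T / θ ^ (4 * D)) ^ r * R ^ m) ∧
        (∀ i j, w ((a.adjugate ^ r * P) i j) ≤ (θ / T) ^ r * R ^ m)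

theorem Spec.transpose {E : Type} [Field E] {D : ℕ} {w : AbsoluteValue E ℝ} {R : ℝ} {m : ℕ} {η₀ : ℝ}
    {a P : Matrix (Fin D) (Fin D) E} (hdet : a.det = 1) (h : Spec w R m η₀ a P) :
    Spec w R m η₀ a.transpose P.transpose where
  PP := by rw [← Matrix.transpose_mul, h.PP]
  Pa := by rw [← Matrix.transpose_mul, ← Matrix.transpose_mul, h.Pa]
  P0 := fun h0 => h.P0 (by rw [← Matrix.transpose_transpose P, h0, Matrix.transpose_zero])
  P1 := fun h0 => h.P1 (by rw [← Matrix.transpose_transpose P, h0, Matrix.transpose_one])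
  Pb := fun i j => h.Pb j i
  ex := by
    obtain ⟨T, θ, hT, hθ, hr⟩ := h.ex
    refine ⟨T, θ, hT, hθ, fun r h1 h2 => ?_⟩
    obtain ⟨h3, h4, h5⟩ := hr r h1 h2
    have hc : ∀ r, Commute P (a ^ r) := fun r => Commute.pow_right h.Pa r
    have h1' : a.adjugate * a = 1 := by rw [Matrix.adjugate_mul, hdet, one_smul]
    have h2' : a * a.adjugate = 1 := by rw [Matrix.mul_adjugate, hdet, one_smul]
    have hc2 : Commute P a.adjugate := by
      rw [Commute, SemiconjBy]
      calc P * a.adjugate = a.adjugate * a * P * a.adjugate := by rw [h1', one_mul]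
        _ = a.adjugate * (P * a) * a.adjugate := by rw [h.Pa]; simp only [mul_assoc]
        _ = a.adjugate * P * (a * a.adjugate) := by simp only [mul_assoc]
        _ = _ := by rw [h2', mul_one]
    refine ⟨fun i j => ?_, fun i j => ?_, fun i j => ?_⟩
    · rw [← Matrix.transpose_pow, ← Matrix.transpose_mul, (hc r).eq]; exact h3 j i
    · rw [← Matrix.transpose_pow, show (1 : Matrix (Fin D) (Fin D) E) - P.transpose = (1 - P).transpose by
        rw [Matrix.transpose_sub, Matrix.transpose_one], ← Matrix.transpose_mul, ((Commute.one_left _).sub_left (hc r)).eq]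
      exact h4 j i
    · rw [← Matrix.adjugate_transpose, ← Matrix.transpose_pow, ← Matrix.transpose_mul, (hc2.pow_right r).eq]
      exact h5 j i

theorem T1f (D m : ℕ) (η₀ : ℝ) (hη₀ : 0 < η₀) : ∀ M : ℕ, ∃ (r : ℕ) (R0 : ℝ), 1 ≤ r ∧ ∀ (E : Type) [Field E]
    (w : AbsoluteValue E ℝ) (R : ℝ)
    (a P : Matrix (Fin D) (Fin D) E), R0 ≤ R → a.det = 1 → Spec w R m η₀ a P →
    ∃ (i : ℕ) (f : AW E D i →ₗ[E] E) (o : AW E D i) (Λ : E),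
      1 ≤ i ∧ i ≤ D ∧ f o = 1 ∧ (∀ ω, rhoE D i P ω = f ω • o) ∧
      (∀ x, (∀ (v : Fin i → Fin D → E) k, o (Function.update v k x) = 0) → Matrix.vecMul x P = 0) ∧
      Λ ≠ 0 ∧ rhoE D i (a ^ r) o = Λ • o ∧
      (∀ x, f (rhoE D i (a ^ r) x) = Λ * f x) ∧
      ∀ u, f u = 0 → NE w (rhoE D i (a ^ r) u) ≤ (R ^ M)⁻¹ * w Λ * NE w u := by
  intro M
  obtain ⟨r, hr⟩ := exists_nat_ge ((((2 * m + 1) * D + M : ℕ) : ℝ) / η₀)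
  refine ⟨r + 1, max (2 * D ^ 2 : ℝ) (max 2 (3 * (r + 1))), by omega, ?_⟩
  intro E _ w R a P hR0 hdet hsp
  simp only [max_le_iff] at hR0
  obtain ⟨hRD, hR2, hRr⟩ := hR0
  have hR1 : (1:ℝ) ≤ R := by linarith
  have hRpos : (0:ℝ) < R := by linarith
  obtain ⟨hPP, hPa, hP0, hP1, hPb, T, θ, hT, hθ, hrr⟩ := hsp
  obtain ⟨hb1, hb2, hb3⟩ := hrr (r + 1) (by omega) (by push_cast; exact hRr)
  set b := a ^ (r + 1) with hb
  set b' := a.adjugate ^ (r + 1) with hb'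
  have hPb' : P * b = b * P := (Commute.pow_right (show Commute P a from hPa) (r + 1))
  have hbb : b' * b = 1 := by
    have h1 : a.adjugate * a = 1 := by rw [Matrix.adjugate_mul, hdet, one_smul]
    have h2 : Commute a.adjugate a := by
      rw [Commute, SemiconjBy, h1, Matrix.mul_adjugate, hdet, one_smul]
    rw [hb, hb', ← h2.mul_pow, h1, one_pow]
  have hθ1 : 1 ≤ θ := le_trans (Real.one_le_rpow hR1 hη₀.le) hθ
  obtain ⟨i, hi⟩ : ∃ i, Module.finrank E (LinearMap.range (Matrix.vecMulLinear P)) = i := ⟨_, rfl⟩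
  have hiD : i ≤ D := by
    rw [← hi]; refine (Submodule.finrank_le _).trans ?_; simp
  have hi1 : 1 ≤ i := by
    rw [Nat.one_le_iff_ne_zero]
    rintro rfl
    apply hP0
    have := Submodule.finrank_eq_zero.mp hi
    rw [LinearMap.range_eq_bot] at this
    ext j k
    have := congrFun (LinearMap.congr_fun this (Pi.single j 1)) k
    simpa using this
  obtain ⟨f, o, hfo, hPo, hrad⟩ := EXT P hPP hi
  have hPoo : rhoE D i P o = o := by rw [hPo, hfo, one_smul]
  have ho0 : o ≠ 0 := by rintro h; rw [h, map_zero] at hfo; exact zero_ne_one hfo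
  have hax := NE_ax (D := D) (i := i) w
  have hNo : 0 < NE w o := hax.pos o ho0
  set Λ := f (rhoE D i b o) with hΛ
  have hbo : rhoE D i b o = Λ • o := by
    rw [hΛ, ← hPo, ← Module.End.mul_apply, ← map_mul, hPb', map_mul, Module.End.mul_apply, hPoo]
  have hfb : ∀ x, f (rhoE D i b x) = Λ * f x := by
    intro x
    have : f (rhoE D i b x) • o = (Λ * f x) • o := by
      rw [← hPo, ← Module.End.mul_apply, ← map_mul, hPb', map_mul, Module.End.mul_apply, hPo, map_smul, hbo, smul_smul, mul_comm]
    exact smul_left_injective E ho0 this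
  have hlow : 1 ≤ (D * ((θ / T) ^ (r + 1) * R ^ m)) ^ i * w Λ := by
    have h1 : rhoE D i (b' * P) (rhoE D i b o) = o := by
      rw [← Module.End.mul_apply, ← map_mul, mul_assoc, hPb', ← mul_assoc, hbb, one_mul, hPoo]
    have h2 := NE_rho w (b' * P) _ hb3 (rhoE D i b o)
    rw [h1, hbo, hax.smul, ← mul_assoc] at h2
    exact le_of_mul_le_mul_right (by rw [one_mul]; exact h2) hNo
  have hΛ0 : Λ ≠ 0 := by
    intro h
    rw [h, map_zero, mul_zero] at hlow
    norm_num at hlow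
  refine ⟨i, f, o, Λ, hi1, hiD, hfo, hPo, hrad, hΛ0, hbo, hfb, ?_⟩
  intro u hu
  have hu' : rhoE D i P u = 0 := by rw [hPo, hu, zero_smul]
  have hcon := NE_contract w hi1 b P u hu' _ _ hb1 hb2 (by positivity) (by
    gcongr
    exact div_le_self hT.le (one_le_pow₀ hθ1))
  refine hcon.trans (mul_le_mul_of_nonneg_right ?_ (hax.nonneg u))
  have hRM : (0:ℝ) < R ^ M := by positivity
  rw [inv_mul_eq_div, le_div_iff₀ hRM]
  obtain ⟨j, rfl⟩ : ∃ j, i = j + 1 := ⟨i - 1, by omega⟩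
  rw [Nat.add_sub_cancel]
  have hA0 : 0 < (D * ((θ / T) ^ (r + 1) * R ^ m)) ^ (j + 1) := by
    have : (0:ℝ) < D := by
      have : 0 < D := by omega
      exact_mod_cast this
    positivity
  set q : ℝ := (D * ((θ / T) ^ (r + 1) * R ^ m)) ^ (j + 1) with hq
  suffices hs : (2 * (D:ℝ)) ^ (j + 1) * ((T / θ ^ (4 * D)) ^ (r + 1) * R ^ m * (T ^ (r + 1) * R ^ m) ^ j) * R ^ M * q ≤ 1 by
    have h1 : (0:ℝ) ≤ (2 * (D:ℝ)) ^ (j + 1) * ((T / θ ^ (4 * D)) ^ (r + 1) * R ^ m * (T ^ (r + 1) * R ^ m) ^ j) * R ^ M := by positivity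
    calc _ = _ * 1 := (mul_one _).symm
      _ ≤ _ * (q * w Λ) := mul_le_mul_of_nonneg_left hlow h1
      _ = (_ * q) * w Λ := (mul_assoc _ q _).symm
      _ ≤ 1 * w Λ := mul_le_mul_of_nonneg_right hs (w.nonneg _)
      _ = _ := one_mul _
  have hθpos : 0 < θ := by linarith
  have e1 : (2 * (D:ℝ)) ^ (j + 1) * ((T / θ ^ (4 * D)) ^ (r + 1) * R ^ m * (T ^ (r + 1) * R ^ m) ^ j) * R ^ M * q
     = (2 * (D:ℝ) ^ 2) ^ (j + 1) * (R ^ m) ^ (2 * (j + 1)) * R ^ M * ((θ ^ (j + 1)) / θ ^ (4 * D)) ^ (r + 1) := by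
    rw [hq]
    have hTr : T ^ (r + 1) ≠ 0 := by positivity
    have hθr : θ ^ (r + 1) ≠ 0 := by positivity
    simp only [div_pow, mul_pow]
    rw [← pow_mul θ (j + 1), mul_comm (j + 1) (r + 1), pow_mul θ (r + 1) (j + 1)]
    field_simp
    ring
  rw [e1]
  have h2 : θ ^ (j + 1) / θ ^ (4 * D) ≤ θ⁻¹ := by
    rw [div_le_iff₀ (by positivity), ← div_eq_inv_mul, le_div_iff₀ hθpos, ← pow_succ]
    exact pow_le_pow_right₀ hθ1 (by omega)
  have h3 : R ^ ((2 * m + 1) * D + M) ≤ θ ^ (r + 1) := by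
    calc R ^ ((2 * m + 1) * D + M) = R ^ (((2 * m + 1) * D + M : ℕ) : ℝ) := (Real.rpow_natCast _ _).symm
      _ ≤ R ^ (η₀ * ((r + 1 : ℕ):ℝ)) := by
        apply Real.rpow_le_rpow_of_exponent_le hR1
        rw [div_le_iff₀ hη₀] at hr
        push_cast at hr ⊢
        nlinarith
      _ = (R ^ η₀) ^ (r + 1) := by rw [Real.rpow_mul hRpos.le, Real.rpow_natCast]
      _ ≤ θ ^ (r + 1) := pow_le_pow_left₀ (by positivity) hθ _
  calc (2 * (D:ℝ) ^ 2) ^ (j + 1) * (R ^ m) ^ (2 * (j + 1)) * R ^ M * ((θ ^ (j + 1)) / θ ^ (4 * D)) ^ (r + 1)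
      ≤ R ^ (j + 1) * (R ^ m) ^ (2 * (j + 1)) * R ^ M * (θ⁻¹) ^ (r + 1) := by
        gcongr
    _ = R ^ ((2 * m + 1) * (j + 1) + M) * (θ⁻¹) ^ (r + 1) := by
        congr 1; rw [← pow_mul, ← pow_add, ← pow_add]; congr 1; ring
    _ ≤ R ^ ((2 * m + 1) * D + M) * (θ⁻¹) ^ (r + 1) := by
        gcongr
    _ ≤ θ ^ (r + 1) * (θ⁻¹) ^ (r + 1) := by gcongr
    _ = 1 := by rw [← mul_pow, mul_inv_cancel₀ hθpos.ne', one_pow]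

section tens
variable {E : Type*} [Field E] {D i : ℕ}
/-- tensor power matrix -/
def KM (i : ℕ) (h : Matrix (Fin D) (Fin D) E) : Matrix (Fin i → Fin D) (Fin i → Fin D) E :=
  Matrix.of fun J J' => ∏ l, h (J l) (J' l)

theorem KM_mul (h h' : Matrix (Fin D) (Fin D) E) : KM i h * KM i h' = KM i (h * h') := by
  ext J J''
  simp only [KM, Matrix.mul_apply, Matrix.of_apply]
  rw [Finset.prod_univ_sum, Fintype.piFinset_univ]
  simp only [Finset.prod_mul_distrib]

theorem KM_one : KM i (1 : Matrix (Fin D) (Fin D) E) = 1 := by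
  ext J J'
  simp only [KM, Matrix.of_apply, Matrix.one_apply]
  by_cases h : J = J'
  · subst h; simp
  · rw [if_neg h]
    obtain ⟨l, hl⟩ := Function.ne_iff.mp h
    exact Finset.prod_eq_zero (Finset.mem_univ l) (by rw [if_neg hl])

def hat (ω : AW E D i) : (Fin i → Fin D) → E := fun J => ω (eJ J)

theorem hat_rho (h : Matrix (Fin D) (Fin D) E) (ω : AW E D i) : hat (rhoE D i h ω) = (KM i h).mulVec (hat ω) := by
  funext J
  simp only [hat, rhoE_apply, eJ_vecMul]
  rw [expand]
  rfl

theorem KM_pow (h : Matrix (Fin D) (Fin D) E) (s : ℕ) : KM i h ^ s = KM i (h ^ s) := by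
  induction s with
  | zero => simp [KM_one]
  | succ s ih => rw [pow_succ, ih, KM_mul, pow_succ]
end tens

theorem pow_bound {E : Type*} [Field E] {D : ℕ} (w : AbsoluteValue E ℝ) (Sg : Set (Matrix (Fin D) (Fin D) E)) (R : ℝ)
    (hR : 1 ≤ R) (hD : (D:ℝ) ≤ R) (hS : ∀ s ∈ Sg, ∀ a b, w (s a b) ≤ R) (k : ℕ) :
    ∀ x ∈ Sg ^ k, ∀ a b, w (x a b) ≤ R ^ (2 * k) := by
  induction k with
  | zero =>
    intro x hx a b
    rw [pow_zero, Set.mem_one] at hx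
    subst hx
    rw [Matrix.one_apply]; split_ifs <;> simp
  | succ k ih =>
    intro x hx a b
    rw [pow_succ, Set.mem_mul] at hx
    obtain ⟨y, hy, z, hz, rfl⟩ := hx
    have := mat_mul_bound w y z (R ^ (2 * k)) R (by positivity) (ih y hy) (hS z hz) a b
    refine this.trans ?_
    rw [Fintype.card_fin, show 2 * (k + 1) = 2 * k + 1 + 1 by ring, pow_succ, pow_succ]
    have : 0 ≤ R ^ (2 * k) := by positivity
    nlinarith [mul_nonneg this (by linarith : 0 ≤ R), mul_le_mul_of_nonneg_right hD (mul_nonneg this (by linarith : 0 ≤ R))]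

theorem det_pow_set {E : Type*} [Field E] {D : ℕ} (Sg : Set (Matrix (Fin D) (Fin D) E)) (hS : ∀ s ∈ Sg, s.det = 1) (k : ℕ) :
    ∀ x ∈ Sg ^ k, x.det = 1 := by
  induction k with
  | zero => intro x hx; rw [pow_zero, Set.mem_one] at hx; subst hx; simp
  | succ k ih =>
    intro x hx
    rw [pow_succ, Set.mem_mul] at hx
    obtain ⟨y, hy, z, hz, rfl⟩ := hx
    rw [Matrix.det_mul, ih y hy, hS z hz, one_mul]
end UPI
end

section
open Pointwise
namespace UPI
open Polynomial

theorem mem_pow_mono {M : Type*} [Monoid M] {S : Set M} (h1 : 1 ∈ S) {j k : ℕ} (hjk : j ≤ k) {x : M} (hx : x ∈ S ^ j) : x ∈ S ^ k :=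
  Set.pow_subset_pow_right h1 hjk hx

theorem pow_mem_pow {M : Type*} [Monoid M] {S : Set M} {j : ℕ} {x : M} (hx : x ∈ S ^ j) (k : ℕ) : x ^ k ∈ S ^ (j * k) := by
  rw [pow_mul]; exact Set.pow_mem_pow hx

theorem T1count (D L m : ℕ) (η₀ : ℝ) (hη₀ : 0 < η₀) : ∃ (k : ℕ) (R0 : ℝ), ∀ (E : Type) [Field E] (w : AbsoluteValue E ℝ) (R : ℝ),
    R0 ≤ R → ∀ Sg : Set (Matrix (Fin D) (Fin D) E), 1 ∈ Sg → (∀ s ∈ Sg, s.det = 1) → (∀ s ∈ Sg, ∀ a b, w (s a b) ≤ R) →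
    ∀ a ∈ Sg ^ L, ∀ P, Spec w R m η₀ a P →
    (∃ x ∈ Sg ^ k, ∃ y ∈ Sg ^ k, PFree (E := E) x y) ∨
    ∀ h : Fin (D ^ D + 1) → Matrix (Fin D) (Fin D) E,
      (∀ i, h i ∈ Sg ^ (D ^ D)) → ∃ i i', i ≠ i' ∧
        (LinearMap.range P.mulVecLin).map (h i).mulVecLin = (LinearMap.range P.mulVecLin).map (h i').mulVecLin := by
  have hm := T1f D m η₀ hη₀
  let I := D ^ D
  let K2 := 2 * (I * I)
  let Kn := (K2 * D + 1) * D
  choose mc hmc using fun i : Fin (D + 1) => CHb (Fin i → Fin D) Kn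
  let M1 := ∑ i, mc i
  let M2 := M1 + 1
  let Cx := M2 + (m + 1) * D + (K2 + 1) * D
  obtain ⟨r, R0, hr, hT⟩ := hm (5 * Cx + 3)
  refine ⟨2 * (L * r) + I * I, max (max R0 (D ^ D + 1)) (max (max 20 D) D.factorial), ?_⟩
  intro E _ w R hR0 Sg h1 hdet hent a ha P hsp
  simp only [max_le_iff] at hR0
  obtain ⟨⟨hR0, hRI⟩, ⟨hR20, hRD⟩, hRf⟩ := hR0
  have hR1 : (1:ℝ) ≤ R := by linarith
  have hRp : (0:ℝ) < R := by linarith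
  have hmono : ∀ {x y : ℕ}, x ≤ y → R ^ x ≤ R ^ y := fun h => pow_le_pow_right₀ hR1 h
  have hpb := pow_bound w Sg R hR1 hRD hent
  have hdp := det_pow_set Sg hdet
  obtain ⟨i, f, o, Λ, hi1, hiD, hfo, hPo, hrad, hΛ0, hao, hfa, hcon⟩ :=
    hT E w R a P hR0 (hdp L a ha) hsp
  have hPb := hsp.Pb
  have hax := NE_ax (D := D) (i := i) w
  have ho0 : o ≠ 0 := by rintro h; rw [h, map_zero] at hfo; exact zero_ne_one hfo
  have hNo : 0 < NE w o := hax.pos o ho0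
  have hD1 : 1 ≤ D := by omega
  have hI1 : 1 ≤ I := Nat.one_le_pow _ _ hD1
  have hunit : ∀ k, ∀ x ∈ Sg ^ k, IsUnit x := fun k x hx => by
    rw [Matrix.isUnit_iff_isUnit_det, hdp k x hx]; exact isUnit_one
  by_cases hfree : ∃ x ∈ Sg ^ (2 * (L * r) + I * I), ∃ y ∈ Sg ^ (2 * (L * r) + I * I), PFree (E := E) x y
  · exact Or.inl hfree
  right
  -- returning elements fix the line
  have hpi : ∀ {x : ℕ}, (D * R ^ x) ^ i ≤ R ^ ((x + 1) * D) := by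
    intro x
    calc (D * R ^ x) ^ i ≤ (R * R ^ x) ^ i := by gcongr
      _ = R ^ ((x + 1) * i) := by rw [← pow_succ', pow_mul]
      _ ≤ _ := hmono (by gcongr)
  have hret : ∀ g ∈ Sg ^ (I * I), 1 ≤ R ^ M2 * w (f (rhoE D i g o)) → rhoE D i g o = f (rhoE D i g o) • o := by
    intro g hg hq
    by_contra hgo
    apply hfree
    have har := pow_mem_pow ha r
    refine ⟨a ^ r, mem_pow_mono h1 (by omega) har, a ^ r * g * a ^ r, ?_, ?_⟩
    · rw [show 2 * (L * r) + I * I = L * r + I * I + L * r by ring, pow_add, pow_add]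
      exact Set.mul_mem_mul (Set.mul_mem_mul har hg) har
    refine PP w (rhoE D i) i rhoE_smul (NE w) hax f o hfo (a ^ r) g ((hunit _ a ha).pow r) (hunit _ g hg) Λ hΛ0 hao hfa
      (R ^ (5 * Cx + 3))⁻¹ (R ^ Cx) (by positivity) (one_le_pow₀ hR1) hcon ?_ ?_ ?_ ?_ ?_ hgo
    · rw [inv_pow, ← div_eq_mul_inv, div_le_one (by positivity), ← pow_mul, ← pow_mul]
      calc 20 * R ^ (Cx * 5) ≤ R * R ^ (Cx * 5) := by gcongr
        _ = R ^ (Cx * 5 + 1) := by rw [pow_succ']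
        _ ≤ _ := hmono (by omega)
    · rw [inv_le_comm₀ (by positivity) (by norm_num)]
      calc (1 / 5 : ℝ)⁻¹ ≤ R := by norm_num; linarith
        _ ≤ _ := le_self_pow₀ hR1 (by omega)
    · intro x
      have := NE_rho w P _ hPb x
      rw [hPo, hax.smul] at this
      refine this.trans (mul_le_mul_of_nonneg_right ?_ (hax.nonneg x))
      exact hpi.trans (hmono (by simp only [Cx]; omega))
    · intro x
      refine (NE_rho w g _ (hpb _ g hg) x).trans (mul_le_mul_of_nonneg_right ?_ (hax.nonneg x))
      exact hpi.trans (hmono (by simp only [Cx, K2]; omega))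
    · refine hq.trans (mul_le_mul_of_nonneg_right (hmono (by simp only [Cx]; omega)) (w.nonneg _))
  -- returns
  obtain ⟨J0, hJ0⟩ : ∃ J, o (eJ J) ≠ 0 := by
    by_contra h
    push Not at h
    exact ho0 (AW_ext (by intro J; rw [h]; rfl))
  have hcard : Fintype.card (Fin i → Fin D) ≤ I := by
    simp only [Fintype.card_fun, Fintype.card_fin]
    exact Nat.pow_le_pow_right hD1 hiD
  have hreturn : ∀ h ∈ Sg ^ I, ∃ s, 1 ≤ s ∧ s ≤ I ∧ 1 ≤ R ^ M1 * w (f (rhoE D i (h ^ s) o)) := by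
    intro h hh
    let φ : Matrix (Fin i → Fin D) (Fin i → Fin D) E →ₗ[E] E :=
      { toFun := fun B => ((KM i P).mulVec (B.mulVec (hat o))) J0 / o (eJ J0)
        map_add' := by intro B B'; simp [Matrix.add_mulVec, Matrix.mulVec_add, add_div]
        map_smul' := by intro c B; simp [Matrix.smul_mulVec, Matrix.mulVec_smul, mul_div_assoc] }
    have hφ : ∀ g, φ (KM i g) = f (rhoE D i g o) := by
      intro g
      change ((KM i P).mulVec ((KM i g).mulVec (hat o))) J0 / o (eJ J0) = _
      rw [← hat_rho, ← hat_rho, hPo]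
      simp [hat, hJ0]
    have hent' : ∀ g : Matrix (Fin D) (Fin D) E, (∀ a b, w (g a b) ≤ R ^ (K2 * D + 1)) → ∀ a b, w (KM i g a b) ≤ R ^ Kn := by
      intro g hg J J'
      simp only [KM, Matrix.of_apply, map_prod]
      refine (Finset.prod_le_prod (fun _ _ => w.nonneg _) (fun l _ => hg (J l) (J' l))).trans ?_
      rw [Finset.prod_const, Finset.card_univ, Fintype.card_fin, ← pow_mul]
      exact hmono (by simp only [Kn]; gcongr)
    have hII : I ≤ I * I := Nat.le_mul_of_pos_left _ (by omega)
    have hgb : ∀ a b, w (h a b) ≤ R ^ K2 := fun a b => (hpb I h hh a b).trans (hmono (by simp only [K2]; omega))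
    have hK2D : K2 ≤ K2 * D := Nat.le_mul_of_pos_right _ (by omega)
    obtain ⟨s, hs1, hs2, hs3⟩ := hmc ⟨i, by omega⟩ E w R (KM i h) (KM i h.adjugate) (by linarith)
      (hent' h fun a b => (hgb a b).trans (hmono (by omega))) (hent' _ (adj_bound w h R K2 hR1 hRf hgb))
      (by rw [KM_mul, Matrix.mul_adjugate, hdp _ h hh, one_smul, KM_one]) φ (by
        rw [← KM_one, hφ, map_one, Module.End.one_apply, hfo]; exact one_ne_zero)
    refine ⟨s, hs1, hs2.trans hcard, ?_⟩
    rw [KM_pow, hφ, ← KM_one, hφ, map_one, Module.End.one_apply, hfo, map_one] at hs3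
    refine hs3.trans (mul_le_mul_of_nonneg_right (hmono ?_) (w.nonneg _))
    exact Finset.single_le_sum (f := mc) (fun _ _ => Nat.zero_le _) (Finset.mem_univ _)
  intro h hh
  by_contra hdist
  push Not at hdist
  choose s hs1 hs2 hs3 using fun k => hreturn (h k) (hh k)
  let g := fun k => h k ^ (s k - 1)
  have hgm : ∀ k l, g k * h l ∈ Sg ^ (I * I) := by
    intro k l
    have h3 := pow_mem_pow (hh k) (s k - 1)
    have h4 : g k * h l ∈ Sg ^ (I * (s k - 1) + I) := by rw [pow_add]; exact Set.mul_mem_mul h3 (hh l)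
    refine mem_pow_mono h1 ?_ h4
    rw [← Nat.mul_succ]
    exact Nat.mul_le_mul_left _ (by have := hs1 k; have := hs2 k; omega)
  let c := fun k l => f (rhoE D i (g k * h l) o)
  have hgk : ∀ k, g k * h k = h k ^ s k := by
    intro k; rw [← pow_succ, Nat.sub_add_cancel (hs1 k)]
  have hM12 : R ^ M2 = R ^ M1 * R := pow_succ _ _
  have hckk : ∀ k, 1 ≤ R ^ M1 * w (c k k) := by
    intro k; simp only [c]; rw [hgk]; exact hs3 k
  have hdiag : ∀ k, rhoE D i (g k * h k) o = c k k • o := by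
    intro k
    apply hret _ (hgm k k)
    refine (hckk k).trans (mul_le_mul_of_nonneg_right ?_ (w.nonneg _))
    exact hmono (by simp only [M2]; omega)
  have hc0 : ∀ k, c k k ≠ 0 := by
    intro k h0
    have := hckk k
    rw [h0, map_zero, mul_zero] at this
    norm_num at this
  have hinj : ∀ k, Function.Injective (rhoE D i (g k)) := by
    intro k
    have : IsUnit (rhoE D i (g k)) := ((hunit _ _ (hh k)).pow _).map (rhoE D i)
    exact ((Module.End.isUnit_iff _).mp this).injective
  have hrange : ∀ k, Submodule.map (h k).mulVecLin (LinearMap.range P.mulVecLin) = LinearMap.range (h k * P).mulVecLin := by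
    intro k; rw [Matrix.mulVecLin_mul, LinearMap.range_comp]
  have hoff : ∀ k l, k ≠ l → R ^ M2 * w (c k l) < 1 := by
    intro k l hkl
    by_contra hn
    push Not at hn
    have h5 := hret _ (hgm k l) hn
    change _ = c k l • o at h5
    have hcl : c k l ≠ 0 := by
      intro h0; rw [h0, map_zero, mul_zero] at hn; norm_num at hn
    have h6 : rhoE D i (h l) o = (c k l * (c k k)⁻¹) • rhoE D i (h k) o := by
      apply hinj k
      rw [map_smul, ← Module.End.mul_apply, ← Module.End.mul_apply, ← map_mul, ← map_mul, h5, hdiag, smul_smul, mul_assoc,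
        inv_mul_cancel₀ (hc0 k), mul_one]
    have hcc : c k l * (c k k)⁻¹ ≠ 0 := mul_ne_zero hcl (inv_ne_zero (hc0 k))
    have h7 : rhoE D i (h k) o = (c k l * (c k k)⁻¹)⁻¹ • rhoE D i (h l) o := by
      rw [h6, smul_smul, inv_mul_cancel₀ hcc, one_smul]
    apply hdist k l hkl
    rw [hrange, hrange]
    exact le_antisymm (line_range P f o hfo hPo hrad (h l) (h k) (hunit _ _ (hh k)) _ hcc h6)
      (line_range P f o hfo hPo hrad (h k) (h l) (hunit _ _ (hh l)) _ (inv_ne_zero hcc) h7)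
  have hdep : ¬ LinearIndependent E (fun k => hat (rhoE D i (h k) o)) := by
    intro hli
    have := hli.fintype_card_le_finrank
    rw [Fintype.card_fin, Module.finrank_fintype_fun_eq_card] at this
    have : D ^ D + 1 ≤ D ^ D := this.trans hcard
    omega
  rw [Fintype.not_linearIndependent_iff] at hdep
  obtain ⟨x, hx0, k0, hk0⟩ := hdep
  have hx0' : ∑ k, x k • rhoE D i (h k) o = 0 := by
    apply AW_ext
    intro J
    have := congrFun hx0 J
    rw [Finset.sum_apply] at this
    let ev : AW E D i →ₗ[E] E := { toFun := fun ω => ω (eJ J), map_add' := fun _ _ => rfl, map_smul' := fun _ _ => rfl }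
    change ev _ = 0
    rw [map_sum]
    exact this
  obtain ⟨k, -, hk⟩ := Finset.exists_max_image Finset.univ (fun k => w (x k)) ⟨k0, Finset.mem_univ _⟩
  have hxk : 0 < w (x k) := lt_of_lt_of_le (w.pos hk0) (hk k0 (Finset.mem_univ _))
  have hsum : ∑ l, x l * c k l = 0 := by
    have := congrArg (fun y => f (rhoE D i (g k) y)) hx0'
    simp only [map_sum, map_smul, map_zero, smul_eq_mul] at this
    rw [← this]
    refine Finset.sum_congr rfl fun l _ => ?_
    simp only [c, map_mul, Module.End.mul_apply]
  have h8 : x k * c k k = - ∑ l ∈ Finset.univ.erase k, x l * c k l := by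
    rw [← Finset.add_sum_erase _ _ (Finset.mem_univ k)] at hsum
    exact eq_neg_of_add_eq_zero_left hsum
  have h9 : R ^ M2 * (w (x k) * w (c k k)) ≤ D ^ D * w (x k) := by
    rw [← map_mul, h8, map_neg_eq_map]
    calc R ^ M2 * w (∑ l ∈ Finset.univ.erase k, x l * c k l) ≤ R ^ M2 * ∑ l ∈ Finset.univ.erase k, w (x l * c k l) := by
          gcongr; exact w.sum_le _ _
      _ = ∑ l ∈ Finset.univ.erase k, R ^ M2 * w (x l * c k l) := Finset.mul_sum _ _ _
      _ ≤ ∑ l ∈ Finset.univ.erase k, w (x k) := by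
          refine Finset.sum_le_sum fun l hl => ?_
          have h10 := hoff k l (Finset.ne_of_mem_erase hl).symm
          have h11 := hk l (Finset.mem_univ _)
          rw [map_mul]
          calc R ^ M2 * (w (x l) * w (c k l)) = w (x l) * (R ^ M2 * w (c k l)) := by ring
            _ ≤ w (x l) * 1 := by gcongr
            _ ≤ _ := by rw [mul_one]; exact h11
      _ = D ^ D * w (x k) := by simp
  have h12 : R * w (x k) ≤ D ^ D * w (x k) := by
    refine le_trans ?_ h9
    rw [hM12]
    calc R * w (x k) = R * w (x k) * 1 := (mul_one _).symm
      _ ≤ R * w (x k) * (R ^ M1 * w (c k k)) := by gcongr; exact hckk k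
      _ = _ := by ring
  have := le_of_mul_le_mul_right h12 hxk
  linarith

theorem T1core (D L : ℕ) : ∃ (k : ℕ) (R0 : ℝ), ∀ (E : Type) [Field E] [IsAlgClosed E] (w : AbsoluteValue E ℝ) (R : ℝ),
    R0 ≤ R → ∀ Sg : Set (Matrix (Fin D) (Fin D) E), 1 ∈ Sg → (∀ s ∈ Sg, s.det = 1) → (∀ s ∈ Sg, ∀ a b, w (s a b) ≤ R) →
    ∀ a ∈ Sg ^ L, (∃ α, a.charpoly.IsRoot α ∧ R ≤ w α ^ 2) →
    (∃ x ∈ Sg ^ k, ∃ y ∈ Sg ^ k, PFree (E := E) x y ∨ PFree (E := E) x.transpose y.transpose) ∨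
    ∃ P : Matrix (Fin D) (Fin D) E, P * P = P ∧ P ≠ 0 ∧ P ≠ 1 ∧
      (∀ h : Fin (D ^ D + 1) → Matrix (Fin D) (Fin D) E, (∀ i, h i ∈ Sg ^ (D ^ D)) → ∃ i i', i ≠ i' ∧
        (LinearMap.range P.mulVecLin).map (h i).mulVecLin = (LinearMap.range P.mulVecLin).map (h i').mulVecLin) ∧
      (∀ h : Fin (D ^ D + 1) → Matrix (Fin D) (Fin D) E, (∀ i, h i ∈ Sg ^ (D ^ D)) → ∃ i i', i ≠ i' ∧
        (LinearMap.ker P.mulVecLin).comap (h i).mulVecLin = (LinearMap.ker P.mulVecLin).comap (h i').mulVecLin) := by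
  obtain ⟨m, η₀, R1, hη₀, hspec⟩ := T1spec D (2 * L)
  obtain ⟨k, R2, hcount⟩ := T1count D L m η₀ hη₀
  refine ⟨k, max (max R1 R2) (max 1 D), ?_⟩
  intro E _ _ w R hR0 Sg h1 hdet hent a ha hroot
  simp only [max_le_iff] at hR0
  obtain ⟨⟨hR1, hR2⟩, hR, hRD⟩ := hR0
  have hda := det_pow_set Sg hdet L a ha
  obtain ⟨P, T, θ, hPP, hPa, hP0, hP1, hT, hθ, hPb, hrr⟩ := hspec E w R a hR1 (pow_bound w Sg R hR hRD hent L a ha) hda hroot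
  have hsp : Spec w R m η₀ a P := ⟨hPP, hPa, hP0, hP1, hPb, T, θ, hT, hθ, hrr⟩
  let tr : Set (Matrix (Fin D) (Fin D) E) := Matrix.transpose '' Sg
  have htr : ∀ k, ∀ x, x ∈ Sg ^ k ↔ x.transpose ∈ tr ^ k := by
    intro k
    induction k with
    | zero =>
      intro x
      simp only [pow_zero, Set.mem_one]
      exact ⟨fun h => by rw [h, Matrix.transpose_one], fun h => by rw [← Matrix.transpose_transpose x, h, Matrix.transpose_one]⟩
    | succ k ih =>
      intro x
      rw [pow_succ, pow_succ', Set.mem_mul, Set.mem_mul]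
      constructor
      · rintro ⟨y, hy, z, hz, rfl⟩
        exact ⟨_, ⟨z, hz, rfl⟩, _, (ih y).mp hy, by rw [Matrix.transpose_mul]⟩
      · rintro ⟨_, ⟨z, hz, rfl⟩, y, hy, h⟩
        refine ⟨y.transpose, (ih _).mpr (by rwa [Matrix.transpose_transpose]), z, hz, ?_⟩
        rw [← Matrix.transpose_transpose x, ← h, Matrix.transpose_mul, Matrix.transpose_transpose]
  rcases hcount E w R hR2 Sg h1 hdet hent a ha P hsp with ⟨x, hx, y, hy, hxy⟩ | hc1
  · exact Or.inl ⟨x, hx, y, hy, Or.inl hxy⟩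
  rcases hcount E w R hR2 tr ⟨1, h1, Matrix.transpose_one⟩ (by rintro _ ⟨s, hs, rfl⟩; rw [Matrix.det_transpose]; exact hdet s hs)
    (by rintro _ ⟨s, hs, rfl⟩ i j; exact hent s hs j i) a.transpose ((htr L a).mp ha) _ (hsp.transpose hda) with ⟨x, hx, y, hy, hxy⟩ | hc2
  · refine Or.inl ⟨x.transpose, (htr _ _).mpr (by rwa [Matrix.transpose_transpose]), y.transpose,
      (htr _ _).mpr (by rwa [Matrix.transpose_transpose]), Or.inr ?_⟩
    rwa [Matrix.transpose_transpose, Matrix.transpose_transpose]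
  refine Or.inr ⟨P, hPP, hP0, hP1, hc1, ?_⟩
  intro h hh
  obtain ⟨i, i', hii, he⟩ := hc2 (fun i => (h i).transpose) (fun i => (htr _ _).mp (hh i))
  refine ⟨i, i', hii, ?_⟩
  have key : ∀ g : Matrix (Fin D) (Fin D) E, ∀ v, v ∈ (LinearMap.ker P.mulVecLin).comap g.mulVecLin ↔
      ∀ u ∈ (LinearMap.range P.transpose.mulVecLin).map g.transpose.mulVecLin, dotProduct u v = 0 := by
    intro g v
    simp only [Submodule.mem_comap, LinearMap.mem_ker, Matrix.mulVecLin_apply, Submodule.mem_map, LinearMap.mem_range,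
      exists_exists_eq_and, forall_exists_index, forall_apply_eq_imp_iff]
    constructor
    · intro h0 u
      rw [Matrix.mulVec_transpose, Matrix.mulVec_transpose, ← Matrix.dotProduct_mulVec, ← Matrix.dotProduct_mulVec, h0, dotProduct_zero]
    · intro h0
      apply dotProduct_eq_zero_iff.mp
      intro u
      have := h0 u
      rw [Matrix.mulVec_transpose, Matrix.mulVec_transpose, ← Matrix.dotProduct_mulVec, ← Matrix.dotProduct_mulVec] at this
      rw [dotProduct_comm]; exact this
  ext v
  rw [key, key, he]

theorem PFree_conj {E : Type*} [Field E] {D : ℕ} {P Q a b : Matrix (Fin D) (Fin D) E} (hPQ : P * Q = 1)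
    (h : PFree (E := E) (P * a * Q) (P * b * Q)) : PFree (E := E) a b := by
  have hQP : Q * P = 1 := mul_eq_one_comm.mp hPQ
  let φ : Matrix (Fin D) (Fin D) E →* Matrix (Fin D) (Fin D) E :=
    { toFun := fun x => P * x * Q
      map_one' := by rw [mul_one, hPQ]
      map_mul' := by
        intro x y
        calc P * (x * y) * Q = P * x * 1 * y * Q := by simp only [mul_assoc, one_mul]
          _ = P * x * (Q * P) * y * Q := by rw [hQP]
          _ = _ := by simp only [mul_assoc] }
  have hl : ∀ w, φ (FreeMonoid.lift ![a, b] w) = FreeMonoid.lift ![P * a * Q, P * b * Q] w := by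
    intro w
    have : φ.comp (FreeMonoid.lift ![a, b]) = FreeMonoid.lift ![P * a * Q, P * b * Q] := by
      apply FreeMonoid.hom_eq
      intro x
      fin_cases x <;> rfl
    rw [← this]; rfl
  intro w w' c hc hw
  apply h w w' c hc
  rw [← hl, ← hl, hw]
  change P * (c • _) * Q = c • (P * _ * Q)
  rw [Matrix.mul_smul, Matrix.smul_mul]

theorem prod_le_of_small {E : Type*} [Field E] {D : ℕ} (w : AbsoluteValue E ℝ) (α : Fin D → E) (hprod : ∏ i, α i = 1)
    (X : ℝ) (hX : ∀ i, w (α i) ≤ X) (j : Fin D) : 1 ≤ w (α j) * X ^ (D - 1) := by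
  have h1 : ∏ i, w (α i) = 1 := by rw [← map_prod, hprod, map_one]
  rw [← Finset.mul_prod_erase _ _ (Finset.mem_univ j)] at h1
  rw [← h1]
  apply mul_le_mul_of_nonneg_left _ (w.nonneg _)
  refine (Finset.prod_le_prod (fun _ _ => w.nonneg _) (fun l _ => hX l)).trans ?_
  rw [Finset.prod_const, Finset.card_erase_of_mem (Finset.mem_univ _), Finset.card_univ, Fintype.card_fin]

theorem roots_all {E : Type} [Field E] [IsAlgClosed E] {D : ℕ} (a : Matrix (Fin D) (Fin D) E) (hdet : a.det = 1) :
    ∃ α : Fin D → E, (∀ μ, a.charpoly.IsRoot μ ↔ ∃ i, α i = μ) ∧ ∏ i, α i = 1 := by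
  obtain ⟨α, hα⟩ := exists_roots_fin D a.charpoly (Matrix.charpoly_monic a) (by rw [Matrix.charpoly_natDegree_eq_dim, Fintype.card_fin])
  refine ⟨α, ?_, ?_⟩
  · intro μ
    rw [hα, IsRoot, eval_prod, Finset.prod_eq_zero_iff]
    constructor
    · rintro ⟨i, _, hi⟩
      exact ⟨i, by simpa [sub_eq_zero, eq_comm] using hi⟩
    · rintro ⟨i, rfl⟩
      exact ⟨i, Finset.mem_univ _, by simp⟩
  · have h1 := Matrix.eval_charpoly a 0
    rw [hα, eval_prod] at h1
    simp only [eval_sub, eval_X, eval_C, zero_sub, map_zero, Matrix.det_neg, hdet, Finset.prod_neg, Fintype.card_fin,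
      Finset.card_univ, mul_one] at h1
    exact (mul_right_inj' (pow_ne_zero _ (neg_ne_zero.mpr one_ne_zero))).mp (h1.trans (mul_one _).symm)

theorem isRoot_pow {E : Type} [Field E] {D : ℕ} (a : Matrix (Fin D) (Fin D) E) (μ : E) (h : a.charpoly.IsRoot μ) (q : ℕ) :
    (a ^ q).charpoly.IsRoot (μ ^ q) := by
  rw [isRoot_charpoly_iff] at h ⊢
  obtain ⟨v, hv, hav⟩ := h
  refine ⟨v, hv, ?_⟩
  induction q with
  | zero => simp
  | succ q ih => rw [pow_succ, ← Matrix.mulVec_mulVec, hav, Matrix.mulVec_smul, ih, smul_smul, pow_succ, mul_comm]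

theorem T1mat (D m0 : ℕ) (ε : ℝ) (hε : 0 < ε) : ∃ k : ℕ, ∀ (E : Type) [Field E] [IsAlgClosed E] (w : AbsoluteValue E ℝ)
    (Sg : Set (Matrix (Fin D) (Fin D) E)), Sg.Finite → 1 ∈ Sg → (∀ s ∈ Sg, s.det = 1) →
    (∃ g ∈ Sg ^ m0, ∃ l u, g.charpoly.IsRoot l ∧ g.charpoly.IsRoot u ∧ (1 + ε) * w u ≤ w l) →
    (∃ x ∈ Sg ^ k, ∃ y ∈ Sg ^ k, PFree (E := E) x y ∨ PFree (E := E) x.transpose y.transpose) ∨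
    ∃ P : Matrix (Fin D) (Fin D) E, P * P = P ∧ P ≠ 0 ∧ P ≠ 1 ∧
      (∀ h : Fin (D ^ D + 1) → Matrix (Fin D) (Fin D) E, (∀ i, h i ∈ Sg ^ (D ^ D)) → ∃ i i', i ≠ i' ∧
        (LinearMap.range P.mulVecLin).map (h i).mulVecLin = (LinearMap.range P.mulVecLin).map (h i').mulVecLin) ∧
      (∀ h : Fin (D ^ D + 1) → Matrix (Fin D) (Fin D) E, (∀ i, h i ∈ Sg ^ (D ^ D)) → ∃ i i', i ≠ i' ∧
        (LinearMap.ker P.mulVecLin).comap (h i).mulVecLin = (LinearMap.ker P.mulVecLin).comap (h i').mulVecLin) := by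
  rcases Nat.eq_zero_or_pos D with rfl | hD
  · refine ⟨0, ?_⟩
    rintro E _ _ w Sg _ _ _ ⟨g, hg, l, u, hl, hu, -⟩
    obtain ⟨v, hv, -⟩ := (isRoot_charpoly_iff g l).mp hl
    exact absurd (Subsingleton.elim v 0) hv
  obtain ⟨δ, hδ0, hδ1, L, hL, hJ⟩ := J D hD
  choose kc Rc hcore using fun ℓ => T1core D ℓ
  let K := ∑ ℓ ∈ Finset.range (L + 1), kc ℓ
  let Rm : ℝ := 1 + δ⁻¹ ^ 2 + ∑ ℓ ∈ Finset.range (L + 1), |Rc ℓ|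
  have hRm1 : 1 ≤ Rm := by
    have : 0 ≤ ∑ ℓ ∈ Finset.range (L + 1), |Rc ℓ| := Finset.sum_nonneg fun _ _ => abs_nonneg _
    have : 0 ≤ δ⁻¹ ^ 2 := by positivity
    simp only [Rm]; linarith
  have hRmδ : 1 ≤ δ ^ 2 * Rm := by
    have : 0 ≤ ∑ ℓ ∈ Finset.range (L + 1), |Rc ℓ| := Finset.sum_nonneg fun _ _ => abs_nonneg _
    calc 1 = δ ^ 2 * δ⁻¹ ^ 2 := by rw [← mul_pow, mul_inv_cancel₀ hδ0.ne', one_pow]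
      _ ≤ δ ^ 2 * Rm := by gcongr; simp only [Rm]; linarith
  have hRmc : ∀ ℓ, ℓ ≤ L → Rc ℓ ≤ Rm := by
    intro ℓ hℓ
    have := Finset.single_le_sum (f := fun ℓ => |Rc ℓ|) (fun _ _ => abs_nonneg _) (Finset.mem_range.mpr (by omega : ℓ < L + 1))
    have h2 : 0 ≤ δ⁻¹ ^ 2 := by positivity
    have := le_abs_self (Rc ℓ)
    simp only [Rm]; linarith
  obtain ⟨q, hq⟩ := pow_unbounded_of_one_lt ((D * Rm) ^ D) (by linarith : 1 < 1 + ε)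
  refine ⟨(m0 + 1) * (q + 1) * (K + 1), ?_⟩
  rintro E _ _ w Sg hfin h1 hdet ⟨g, hg, l, u, hl, hu, hlu⟩
  let Sg' := Sg ^ ((m0 + 1) * (q + 1))
  have hg : g ∈ Sg ^ (m0 + 1) := mem_pow_mono h1 (by omega) hg
  have hw : ∃ x, 1 < w x := by
    obtain ⟨α, hα, hprod⟩ := roots_all g (det_pow_set Sg hdet _ g hg)
    obtain ⟨i, rfl⟩ := (hα l).mp hl
    obtain ⟨j, rfl⟩ := (hα u).mp hu
    have hu0 : α j ≠ 0 := by
      intro h; rw [Finset.prod_eq_zero (Finset.mem_univ j) h] at hprod; exact zero_ne_one hprod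
    refine ⟨α i / α j, ?_⟩
    rw [map_div₀, lt_div_iff₀ (w.pos hu0)]
    nlinarith [w.pos hu0]
  have h1' : 1 ∈ Sg' := Set.one_mem_pow h1
  have hdet' : ∀ s ∈ Sg', s.det = 1 := det_pow_set Sg hdet _
  have hfin' : Sg'.Finite := by
    simp only [Sg']
    generalize (m0 + 1) * (q + 1) = k
    induction k with
    | zero => simp
    | succ k ih => rw [pow_succ]; exact ih.mul hfin
  obtain ⟨P, Q, hPQ, ρ, hρ, hent, ℓ, hℓ1, hℓL, x, hx, μ, hμ, hμρ⟩ := hJ E w hw Sg' hfin' ⟨1, h1'⟩ hdet'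
  have hQP : Q * P = 1 := mul_eq_one_comm.mp hPQ
  have hρR : Rm ≤ ρ := by
    have hgq : g ^ (q + 1) ∈ Sg' := pow_mem_pow hg _
    have hent1 := hent _ hgq
    have hchar : (P * g ^ (q + 1) * Q).charpoly = (g ^ (q + 1)).charpoly := charpoly_conj P Q _ hPQ
    obtain ⟨α, hα, hprod⟩ := roots_all _ (hdet' _ hgq)
    have hαb : ∀ i, w (α i) ≤ D * ρ := by
      intro i
      apply ev_le w _ ρ hent1
      rw [hchar]; exact (hα _).mpr ⟨i, rfl⟩
    obtain ⟨i, hi⟩ := (hα _).mp (isRoot_pow g l hl (q + 1))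
    obtain ⟨j, hj⟩ := (hα _).mp (isRoot_pow g u hu (q + 1))
    have h2 := prod_le_of_small w α hprod _ hαb j
    have h3 : (1 + ε) ^ (q + 1) * w (α j) ≤ w (α i) := by
      rw [hi, hj, map_pow, map_pow, ← mul_pow]
      exact pow_le_pow_left₀ (mul_nonneg (by linarith) (w.nonneg _)) hlu _
    have h4 : (1 + ε) ^ (q + 1) ≤ (D * ρ) ^ D := by
      have h5 : (0:ℝ) ≤ (D * ρ) ^ (D - 1) := by positivity
      calc (1 + ε) ^ (q + 1) = (1 + ε) ^ (q + 1) * 1 := (mul_one _).symm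
        _ ≤ (1 + ε) ^ (q + 1) * (w (α j) * (D * ρ) ^ (D - 1)) := by gcongr
        _ = ((1 + ε) ^ (q + 1) * w (α j)) * (D * ρ) ^ (D - 1) := by ring
        _ ≤ (D * ρ) * (D * ρ) ^ (D - 1) := mul_le_mul_of_nonneg_right (h3.trans (hαb i)) h5
        _ = (D * ρ) ^ D := by rw [← pow_succ', Nat.sub_add_cancel hD]
    by_contra hn
    push Not at hn
    have h6 : (D * ρ) ^ D ≤ (D * Rm) ^ D := by gcongr
    have h7 : (1 + ε) ^ q ≤ (1 + ε) ^ (q + 1) := pow_le_pow_right₀ (by linarith) (by omega)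
    linarith
  have hρ1 : 1 ≤ ρ := hRm1.trans hρR
  have hρℓ : ρ ≤ ρ ^ ℓ := le_self_pow₀ hρ1 (by omega)
  let T := (fun s => P * s * Q) '' Sg'
  have hT1 : 1 ∈ T := ⟨1, h1', by simp [hPQ]⟩
  have hTd : ∀ s ∈ T, s.det = 1 := by
    rintro _ ⟨s, hs, rfl⟩
    have : P.det * Q.det = 1 := by rw [← Matrix.det_mul, hPQ, Matrix.det_one]
    simp only [Matrix.det_mul, hdet' s hs, mul_one, this]
  have hTe : ∀ s ∈ T, ∀ a b, w (s a b) ≤ ρ ^ ℓ := by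
    rintro _ ⟨s, hs, rfl⟩ a b
    exact (hent s hs a b).trans hρℓ
  have hTpow : ∀ k, ∀ y ∈ Sg' ^ k, P * y * Q ∈ T ^ k := by
    intro k
    induction k with
    | zero => intro y hy; rw [pow_zero, Set.mem_one] at hy; subst hy; simp [hPQ]
    | succ k ih =>
      intro y hy
      rw [pow_succ, Set.mem_mul] at hy ⊢
      obtain ⟨a, ha, b, hb, rfl⟩ := hy
      refine ⟨_, ih a ha, _, ⟨b, hb, rfl⟩, ?_⟩
      calc P * a * Q * (P * b * Q) = P * a * (Q * P) * b * Q := by simp only [mul_assoc]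
        _ = _ := by rw [hQP]; simp only [mul_assoc, one_mul]
  have hKl : kc ℓ ≤ K := Finset.single_le_sum (f := kc) (fun _ _ => Nat.zero_le _) (Finset.mem_range.mpr (by omega : ℓ < L + 1))
  rcases hcore ℓ E w (ρ ^ ℓ) ((hRmc ℓ hℓL).trans (hρR.trans hρℓ)) T hT1 hTd hTe _ (hTpow ℓ x hx) ⟨μ, by rw [charpoly_conj P Q _ hPQ]; exact hμ, by
      have h8 : Rm ≤ ρ ^ ℓ := hρR.trans hρℓ
      have h9 : (δ * ρ ^ ℓ) ^ 2 ≤ w μ ^ 2 := pow_le_pow_left₀ (by positivity) hμρ.le 2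
      refine le_trans ?_ h9
      calc ρ ^ ℓ = 1 * ρ ^ ℓ := (one_mul _).symm
        _ ≤ (δ ^ 2 * Rm) * ρ ^ ℓ := by gcongr
        _ ≤ (δ ^ 2 * ρ ^ ℓ) * ρ ^ ℓ := by gcongr
        _ = _ := by ring⟩ with ⟨y, hy, z, hz, hyz⟩ | ⟨p, hpp, hp0, hp1, hc1, hc2⟩
  · left
    have hback : ∀ y ∈ T ^ kc ℓ, ∃ y' ∈ Sg ^ ((m0 + 1) * (q + 1) * (K + 1)), y = P * y' * Q := by
      intro y hy
      obtain ⟨y', hy', h⟩ := conj_pow_mem P Q hQP Sg' (kc ℓ + 1) (by omega) y (mem_pow_mono hT1 (by omega) hy)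
      refine ⟨y', ?_, h⟩
      rw [pow_mul]
      exact mem_pow_mono h1' (by omega) hy'
    obtain ⟨y', hy', rfl⟩ := hback y hy
    obtain ⟨z', hz', rfl⟩ := hback z hz
    refine ⟨y', hy', z', hz', hyz.imp (PFree_conj hPQ) fun h => PFree_conj (P := Q.transpose) (Q := P.transpose) ?_ ?_⟩
    · rw [← Matrix.transpose_mul, hPQ, Matrix.transpose_one]
    · simpa only [Matrix.transpose_mul, ← mul_assoc] using h
  · right
    have hQpP : ∀ x y : Matrix (Fin D) (Fin D) E, (Q * x * P) * (Q * y * P) = Q * (x * y) * P := by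
      intro x y
      calc Q * x * P * (Q * y * P) = Q * x * (P * Q) * y * P := by simp only [mul_assoc]
        _ = _ := by rw [hPQ]; simp only [mul_assoc, one_mul]
    have hback : ∀ x, P * (Q * x * P) * Q = x := by
      intro x
      calc P * (Q * x * P) * Q = (P * Q) * x * (P * Q) := by simp only [mul_assoc]
        _ = x := by rw [hPQ, one_mul, mul_one]
    have hle : D ^ D ≤ (m0 + 1) * (q + 1) * D ^ D := Nat.le_mul_of_pos_left _ (by positivity)
    have hmem : ∀ x ∈ Sg ^ (D ^ D), P * x * Q ∈ T ^ (D ^ D) := by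
      intro x hx
      apply hTpow
      have := mem_pow_mono h1 hle hx
      rwa [pow_mul] at this
    have hQs : Function.Surjective Q.mulVecLin := fun v => ⟨P.mulVec v, by simp [hQP]⟩
    have hPs : Function.Surjective P.mulVecLin := fun v => ⟨Q.mulVec v, by simp [hPQ]⟩
    have hQi : LinearMap.ker Q.mulVecLin = ⊥ := by
      rw [LinearMap.ker_eq_bot]
      intro x y hxy
      have := congrArg (P.mulVec ·) hxy
      simpa [hPQ] using this
    refine ⟨Q * p * P, by rw [hQpP, hpp], ?_, ?_, ?_, ?_⟩
    · intro h
      apply hp0; rw [← hback p, h, mul_zero, zero_mul]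
    · intro h
      apply hp1; rw [← hback p, h, mul_one, hPQ]
    · intro h hh
      obtain ⟨i, i', hii, he⟩ := hc1 (fun i => P * h i * Q) (fun i => hmem _ (hh i))
      refine ⟨i, i', hii, ?_⟩
      have := congrArg (Submodule.map Q.mulVecLin) he
      simp only [← LinearMap.range_comp, ← Matrix.mulVecLin_mul] at this ⊢
      have hz : ∀ i, h i * (Q * p * P) = (Q * (P * h i * Q * p)) * P := by
        intro i
        calc h i * (Q * p * P) = 1 * h i * Q * p * P := by simp only [mul_assoc, one_mul]
          _ = (Q * P) * h i * Q * p * P := by rw [hQP]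
          _ = _ := by simp only [mul_assoc]
      rw [hz, hz, Matrix.mulVecLin_mul _ P, Matrix.mulVecLin_mul _ P, LinearMap.range_comp, LinearMap.range_comp,
        LinearMap.range_eq_top.mpr hPs, Submodule.map_top, Submodule.map_top]
      exact this
    · intro h hh
      obtain ⟨i, i', hii, he⟩ := hc2 (fun i => P * h i * Q) (fun i => hmem _ (hh i))
      refine ⟨i, i', hii, ?_⟩
      have := congrArg (Submodule.comap P.mulVecLin) he
      simp only [← LinearMap.ker_comp, ← Matrix.mulVecLin_mul] at this ⊢
      have hz : ∀ i, (Q * p * P) * h i = Q * (p * (P * h i * Q) * P) := by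
        intro i
        calc Q * p * P * h i = Q * p * P * h i * 1 := by rw [mul_one]
          _ = Q * p * P * h i * (Q * P) := by rw [hQP]
          _ = _ := by simp only [mul_assoc]
      rw [hz, hz, Matrix.mulVecLin_mul Q, Matrix.mulVecLin_mul Q, LinearMap.ker_comp_of_ker_eq_bot _ hQi,
        LinearMap.ker_comp_of_ker_eq_bot _ hQi]
      exact this
end UPI
end

section
open Pointwise

namespace UPI

theorem PFree.of_transpose {E : Type} [Field E] {D : ℕ} {x y : Matrix (Fin D) (Fin D) E}
    (h : PFree (E := E) x.transpose y.transpose) : PFree (E := E) x y := by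
  have key : ∀ w : FreeMonoid (Fin 2), (FreeMonoid.lift ![x, y] w).transpose =
      FreeMonoid.lift ![x.transpose, y.transpose] w.reverse := by
    intro w
    induction w using FreeMonoid.inductionOn' with
    | one => exact Matrix.transpose_one
    | of_mul i xs ih =>
      rw [map_mul, Matrix.transpose_mul, ih, FreeMonoid.reverse_mul, map_mul]
      congr 1
      fin_cases i <;> simp
  intro w w' c hc hww
  have h1 := congrArg Matrix.transpose hww
  rw [Matrix.transpose_smul, key, key] at h1
  have := h _ _ c hc h1
  simpa using congrArg FreeMonoid.reverse this

theorem freePair_of_pfree {E : Type} [Field E] {G M : Type*} [Group G] [Ring M] [Algebra E M]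
    (φ : G →* M) {a b : G} {x y : M} {c d : E} (hc : c ≠ 0) (hd : d ≠ 0) (hx : x = c • φ a)
    (hy : y = d • φ b) (h : PFree (E := E) x y) : FreePair a b := by
  have key : ∀ w : FreeMonoid (Fin 2), ∃ C : E, C ≠ 0 ∧
      FreeMonoid.lift ![x, y] w = C • φ (FreeMonoid.lift ![a, b] w) := by
    intro w
    induction w using FreeMonoid.inductionOn' with
    | one => exact ⟨1, one_ne_zero, by simp⟩
    | of_mul i xs ih =>
      obtain ⟨C, hC, e⟩ := ih
      have hi : ∃ C : E, C ≠ 0 ∧ FreeMonoid.lift ![x, y] (FreeMonoid.of i) =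
          C • φ (FreeMonoid.lift ![a, b] (FreeMonoid.of i)) := by
        fin_cases i
        · exact ⟨c, hc, by simpa using hx⟩
        · exact ⟨d, hd, by simpa using hy⟩
      obtain ⟨C', hC', e'⟩ := hi
      refine ⟨C' * C, mul_ne_zero hC' hC, ?_⟩
      rw [map_mul, e, e', map_mul, map_mul, smul_mul_smul_comm]
  intro w w' hww
  obtain ⟨C, hC, e⟩ := key w
  obtain ⟨C', hC', e'⟩ := key w'
  refine h w w' (C / C') (div_ne_zero hC hC') ?_
  rw [e, e', hww, smul_smul, div_mul_cancel₀ _ hC']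

open Classical in
theorem T1rep (D m0 : ℕ) (ε : ℝ) (hε : 0 < ε) : ∃ k : ℕ, ∀ (E : Type) [Field E] [IsAlgClosed E]
    (G : Type) [Group G] (V : Type) [AddCommGroup V] [Module E V] [FiniteDimensional E V],
    Module.finrank E V = D → ∀ (ρ : G →* Module.End E V) (S : Set G), S.Finite → 1 ∈ S →
    (∃ w : AbsoluteValue E ℝ, ∃ g ∈ S ^ m0, ∃ l u, (ρ g).HasEigenvalue l ∧ (ρ g).HasEigenvalue u ∧
      (1 + ε) * w u ≤ w l) →
    (∃ a ∈ S ^ k, ∃ b ∈ S ^ k, FreePair a b) ∨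
    ∃ U U' : Submodule E V, IsCompl U U' ∧ U ≠ ⊥ ∧ U' ≠ ⊥ ∧
      (∀ h : Fin (D ^ D + 1) → G, (∀ i, h i ∈ S ^ (D ^ D)) → ∃ i i', i ≠ i' ∧
        U.map (ρ (h i)) = U.map (ρ (h i'))) ∧
      (∀ h : Fin (D ^ D + 1) → G, (∀ i, h i ∈ S ^ (D ^ D)) → ∃ i i', i ≠ i' ∧
        U'.comap (ρ (h i)) = U'.comap (ρ (h i'))) := by
  obtain ⟨k, hk⟩ := T1mat D m0 ε hε
  refine ⟨k, ?_⟩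
  intro E _ _ G _ V _ _ _ hV ρ S hS h1 ⟨w, g, hg, l, u, hl, hu, hlu⟩
  have hD : D ≠ 0 := by
    rintro rfl
    have := Module.finrank_zero_iff.mp hV
    obtain ⟨v, hv⟩ := hl.exists_hasEigenvector
    exact hv.2 (Subsingleton.elim _ _)
  let b : Module.Basis (Fin D) E V := Module.finBasisOfFinrankEq E V hV
  let e := b.equivFun
  let T : Module.End E V ≃ₐ[E] Matrix (Fin D) (Fin D) E := LinearMap.toMatrixAlgEquiv b
  let M : G →* Matrix (Fin D) (Fin D) E := (T : Module.End E V →* Matrix (Fin D) (Fin D) E).comp ρ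
  have hMdef : ∀ g, M g = T (ρ g) := fun g => rfl
  have hMv : ∀ g v, (M g).mulVec (e v) = e (ρ g v) := by
    intro g v
    exact LinearMap.toMatrix_mulVec_repr b b (ρ g) v
  have hMdet : ∀ g, (M g).det ≠ 0 := by
    intro g h0
    have : (M g).det * (M g⁻¹).det = 1 := by rw [← Matrix.det_mul, ← map_mul]; simp
    rw [h0, zero_mul] at this
    exact zero_ne_one this
  let Sg : Set (Matrix (Fin D) (Fin D) E) := {x | ∃ g ∈ S, ∃ c : E, c ^ D * (M g).det = 1 ∧ x = c • M g}
  have hSgf : Sg.Finite := by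
    have : Sg = ⋃ g ∈ S, (fun c : E => c • M g) '' {c : E | c ^ D * (M g).det = 1} := by
      ext x; simp only [Sg, Set.mem_ofPred_eq, Set.mem_iUnion, Set.mem_image, exists_prop]
      constructor
      · rintro ⟨g, hg, c, hc, rfl⟩; exact ⟨g, hg, c, hc, rfl⟩
      · rintro ⟨g, hg, c, hc, rfl⟩; exact ⟨g, hg, c, hc, rfl⟩
    rw [this]
    refine hS.biUnion fun g _ => Set.Finite.image _ ?_
    refine ((Polynomial.nthRoots D (M g).det⁻¹).toFinset.finite_toSet).subset ?_
    intro c hc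
    simp only [Finset.mem_coe, Multiset.mem_toFinset]
    rw [Polynomial.mem_nthRoots (Nat.pos_of_ne_zero hD)]
    exact eq_inv_of_mul_eq_one_left hc
  have hSg1 : (1 : Matrix (Fin D) (Fin D) E) ∈ Sg := ⟨1, h1, 1, by simp, by simp⟩
  have hSgd : ∀ s ∈ Sg, s.det = 1 := by
    rintro s ⟨g, hg, c, hc, rfl⟩
    simpa [Matrix.det_smul] using hc
  have hdown : ∀ j, ∀ x ∈ Sg ^ j, ∃ g ∈ S ^ j, ∃ c : E, c ≠ 0 ∧ x = c • M g := by
    intro j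
    induction j with
    | zero => intro x hx; simp only [pow_zero, Set.mem_one] at hx; exact ⟨1, by simp, 1, one_ne_zero, by simp [hx]⟩
    | succ j ih =>
      intro x hx
      rw [pow_succ] at hx
      obtain ⟨y, hy, z, ⟨g', hg', c', hc', rfl⟩, rfl⟩ := Set.mem_mul.mp hx
      obtain ⟨g, hg, c, hc, rfl⟩ := ih y hy
      refine ⟨g * g', by rw [pow_succ]; exact Set.mul_mem_mul hg hg', c * c', mul_ne_zero hc ?_, ?_⟩
      · rintro rfl; simp [hD] at hc'
      · rw [map_mul, smul_mul_smul_comm]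
  have hup : ∀ j, ∀ g ∈ S ^ j, ∃ c : E, c ≠ 0 ∧ c • M g ∈ Sg ^ j := by
    intro j
    induction j with
    | zero => intro g hg; simp only [pow_zero, Set.mem_one] at hg; exact ⟨1, one_ne_zero, by simp [hg]⟩
    | succ j ih =>
      intro g hg
      rw [pow_succ] at hg
      obtain ⟨y, hy, z, hz, rfl⟩ := Set.mem_mul.mp hg
      obtain ⟨c, hc, h⟩ := ih y hy
      obtain ⟨c', hc'⟩ := IsAlgClosed.exists_pow_nat_eq (M z).det⁻¹ (Nat.pos_of_ne_zero hD)
      have hc2 : c' ^ D * (M z).det = 1 := by rw [hc', inv_mul_cancel₀ (hMdet z)]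
      refine ⟨c * c', mul_ne_zero hc ?_, ?_⟩
      · rintro rfl; simp [hD] at hc2
      · rw [map_mul, ← smul_mul_smul_comm, pow_succ]
        exact Set.mul_mem_mul h ⟨z, hz, c', hc2, rfl⟩
  have hroot : ∀ g l (c : E), (ρ g).HasEigenvalue l → (c • M g).charpoly.IsRoot (c * l) := by
    intro g l c hl
    obtain ⟨v, hv⟩ := hl.exists_hasEigenvector
    rw [isRoot_charpoly_iff]
    refine ⟨e v, by simpa using hv.2, ?_⟩
    rw [Matrix.smul_mulVec, hMv, hv.apply_eq_smul, map_smul, smul_smul]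
  have hbig : ∃ g ∈ Sg ^ m0, ∃ l u, g.charpoly.IsRoot l ∧ g.charpoly.IsRoot u ∧ (1 + ε) * w u ≤ w l := by
    obtain ⟨c, hc, h⟩ := hup m0 g hg
    refine ⟨_, h, _, _, hroot g l c hl, hroot g u c hu, ?_⟩
    rw [map_mul, map_mul]
    have := w.nonneg c
    nlinarith
  rcases hk E w Sg hSgf hSg1 hSgd hbig with ⟨x, hx, y, hy, hxy⟩ | ⟨P, hPP, hP0, hP1, hr, hker⟩
  · left
    obtain ⟨a, ha, c, hc, hxa⟩ := hdown k x hx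
    obtain ⟨a', ha', c', hc', hya⟩ := hdown k y hy
    refine ⟨a, ha, a', ha', freePair_of_pfree M hc hc' hxa hya ?_⟩
    rcases hxy with h | h
    · exact h
    · exact h.of_transpose
  · right
    have hcompl : IsCompl (LinearMap.range P.mulVecLin) (LinearMap.ker P.mulVecLin) := by
      apply LinearMap.IsIdempotentElem.isCompl
      show P.mulVecLin ∘ₗ P.mulVecLin = P.mulVecLin
      rw [← Matrix.mulVecLin_mul, hPP]
    have hconj : ∀ (g : G) (c : E), ((c • M g).mulVecLin) = c • ((e : V →ₗ[E] (Fin D → E)) ∘ₗ ρ g ∘ₗ (e.symm : (Fin D → E) →ₗ[E] V)) := by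
      intro g c
      ext1 i
      apply LinearMap.ext_ring
      simp only [LinearMap.comp_apply, LinearMap.smul_apply, LinearEquiv.coe_coe, Matrix.mulVecLin_apply,
        Matrix.smul_mulVec]
      rw [← hMv, LinearEquiv.apply_symm_apply]
    refine ⟨(LinearMap.range P.mulVecLin).comap (e : V →ₗ[E] (Fin D → E)), (LinearMap.ker P.mulVecLin).comap (e : V →ₗ[E] (Fin D → E)), ?_, ?_, ?_, ?_, ?_⟩
    · have := hcompl.map (Submodule.orderIsoMapComap e).symm
      exact this
    · intro h
      apply hP0
      have h2 : ∀ v, P.mulVec v = 0 := by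
        intro v
        have : e.symm (P.mulVec v) ∈ (LinearMap.range P.mulVecLin).comap (e : V →ₗ[E] (Fin D → E)) := by
          simp
        rw [h] at this
        simpa using this
      ext i j
      have := congrFun (h2 (Pi.single j 1)) i
      simpa using this
    · intro h
      apply hP1
      have h2 : ∀ v, P.mulVec v = v := by
        intro v
        have : e.symm (P.mulVec v - v) ∈ (LinearMap.ker P.mulVecLin).comap (e : V →ₗ[E] (Fin D → E)) := by
          simp [Matrix.mulVec_sub, hPP]
        rw [h] at this
        have : P.mulVec v - v = 0 := e.symm.map_eq_zero_iff.mp ((Submodule.mem_bot E).mp this)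
        exact sub_eq_zero.mp this
      ext i j
      have := congrFun (h2 (Pi.single j 1)) i
      simpa [Matrix.one_apply, Pi.single_apply] using this
    · intro h hh
      choose c hc hcm using fun i => hup _ (h i) (hh i)
      obtain ⟨i, i', hne, heq⟩ := hr _ hcm
      refine ⟨i, i', hne, ?_⟩
      rw [hconj, hconj, Submodule.map_smul _ _ _ (hc i), Submodule.map_smul _ _ _ (hc i')] at heq
      rw [Submodule.map_comp, Submodule.map_comp, Submodule.map_comp, Submodule.map_comp] at heq
      have heq := Submodule.map_injective_of_injective e.injective heq
      have hs : (LinearMap.range P.mulVecLin).map (e.symm : (Fin D → E) →ₗ[E] V) = (LinearMap.range P.mulVecLin).comap (e : V →ₗ[E] (Fin D → E)) :=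
        Submodule.map_equiv_eq_comap_symm e.symm _
      rw [hs] at heq
      exact heq
    · intro h hh
      choose c hc hcm using fun i => hup _ (h i) (hh i)
      obtain ⟨i, i', hne, heq⟩ := hker _ hcm
      refine ⟨i, i', hne, ?_⟩
      rw [hconj, hconj, Submodule.comap_smul _ _ _ (hc i), Submodule.comap_smul _ _ _ (hc i')] at heq
      rw [Submodule.comap_comp, Submodule.comap_comp, Submodule.comap_comp, Submodule.comap_comp] at heq
      exact Submodule.comap_injective_of_surjective e.symm.surjective heq

end UPI
end

section
open Pointwise

namespace UPI

theorem set_pow_finite {G : Type*} [Monoid G] {S : Set G} (hS : S.Finite) (k : ℕ) : (S ^ k).Finite := by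
  induction k with
  | zero => simp
  | succ k ih => rw [pow_succ]; exact ih.mul hS

theorem reach {G X : Type*} [Group G] [MulAction G X] (S : Set G) (hS : S.Finite) (h1 : 1 ∈ S)
    (hcl : Subgroup.closure S = ⊤) (x : X) (I : ℕ)
    (hP : ∀ h : Fin (I + 1) → G, (∀ i, h i ∈ S ^ I) → ∃ i i', i ≠ i' ∧ h i • x = h i' • x) :
    ∀ g : G, ∃ t ∈ S ^ I, g • x = t • x := by
  have hj : ∃ j ≤ I, ∀ g ∈ S ^ (j + 1), ∃ t ∈ S ^ j, g • x = t • x := by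
    by_contra hcon
    push Not at hcon
    choose f hf hf2 using hcon
    let h : Fin (I + 1) → G := fun i => if hi : (i : ℕ) = 0 then 1 else f (i - 1) (by omega)
    have hmem : ∀ i : Fin (I + 1), h i ∈ S ^ (i : ℕ) := by
      intro i
      by_cases hi : (i : ℕ) = 0
      · have : h i = 1 := dif_pos hi
        rw [this, hi]; simp
      · simp only [h, hi, dif_neg, not_false_iff]
        have := hf (i - 1) (by omega)
        rwa [Nat.sub_add_cancel (by omega)] at this
    obtain ⟨i, i', hne, heq⟩ := hP h (fun i => mem_pow_mono h1 (by omega) (hmem i))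
    have key : ∀ i i' : Fin (I + 1), i < i' → h i • x = h i' • x → False := by
      intro i i' hlt heq
      have hi : (i' : ℕ) ≠ 0 := by have : (i : ℕ) < i' := hlt; omega
      have h2 : h i' = f (i' - 1) (by omega) := dif_neg hi
      rw [h2] at heq
      have hlt' : (i : ℕ) < i' := hlt
      exact hf2 (i' - 1) (by omega) (h i) (mem_pow_mono h1 (by omega) (hmem i)) heq.symm
    rcases lt_or_gt_of_ne hne with h' | h'
    · exact key _ _ h' heq
    · exact key _ _ h' heq.symm
  obtain ⟨j, hjI, hj⟩ := hj
  let O : Set X := (fun t : G => t • x) '' (S ^ j)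
  have hO : O.Finite := (set_pow_finite hS j).image _
  have hs : ∀ s ∈ S, ∀ y ∈ O, s • y ∈ O := by
    rintro s hs _ ⟨t, ht, rfl⟩
    obtain ⟨t', ht', e⟩ := hj (s * t) (by rw [pow_succ']; exact Set.mul_mem_mul hs ht)
    exact ⟨t', ht', by simp [← e, mul_smul]⟩
  have hs' : ∀ s ∈ S, ∀ y ∈ O, s⁻¹ • y ∈ O := by
    intro s hsS y hy
    have hinj : Set.InjOn (fun y : X => s • y) O := (MulAction.injective s).injOn
    have himg : (fun y : X => s • y) '' O = O := by
      apply Set.eq_of_subset_of_ncard_le _ _ hO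
      · rintro _ ⟨y, hy, rfl⟩; exact hs s hsS y hy
      · rw [hinj.ncard_image]
    rw [← himg] at hy
    obtain ⟨z, hz, rfl⟩ := hy
    simpa using hz
  have hall : ∀ g : G, ∀ y ∈ O, g • y ∈ O := by
    intro g
    have hg : g ∈ Subgroup.closure S := by rw [hcl]; trivial
    induction hg using Subgroup.closure_induction'' with
    | mem s hsS => exact hs s hsS
    | inv_mem s hsS => exact hs' s hsS
    | one => intro y hy; simpa using hy
    | mul a b _ _ ha hb => intro y hy; rw [mul_smul]; exact ha _ (hb _ hy)
  intro g
  have hx : x ∈ O := ⟨1, mem_pow_mono h1 (Nat.zero_le j) (by simp), by simp⟩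
  obtain ⟨t, ht, e⟩ := hall g x hx
  exact ⟨t, mem_pow_mono h1 hjI ht, e.symm⟩

theorem orbit_index {G X : Type*} [Group G] [MulAction G X] (S : Set G) (hS : S.Finite) (h1 : 1 ∈ S)
    (hcl : Subgroup.closure S = ⊤) (x : X) (I : ℕ)
    (hP : ∀ h : Fin (I + 1) → G, (∀ i, h i ∈ S ^ I) → ∃ i i', i ≠ i' ∧ h i • x = h i' • x) :
    (MulAction.stabilizer G x).index ≠ 0 ∧ (MulAction.stabilizer G x).index ≤ I := by
  classical
  have hr := reach S hS h1 hcl x I hP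
  have hfin : (MulAction.orbit G x).Finite := by
    refine ((set_pow_finite hS I).image (fun t => t • x)).subset ?_
    rintro _ ⟨g, rfl⟩
    obtain ⟨t, ht, e⟩ := hr g
    exact ⟨t, ht, e.symm⟩
  rw [MulAction.index_stabilizer]
  constructor
  · exact Set.ncard_ne_zero_of_mem (MulAction.mem_orbit_self x) hfin
  · by_contra hcon
    push Not at hcon
    rw [Set.ncard_eq_toFinset_card _ hfin] at hcon
    obtain ⟨t, htsub, htc⟩ := Finset.exists_subset_card_eq (show I + 1 ≤ hfin.toFinset.card from hcon)
    let f : Fin (I + 1) → X := fun i => ((t.equivFinOfCardEq htc).symm i : t)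
    have hf : Function.Injective f := fun i i' h => by
      simpa [f, Subtype.ext_iff] using h
    have : ∀ i, ∃ g ∈ S ^ I, g • x = f i := by
      intro i
      have : f i ∈ hfin.toFinset := htsub ((t.equivFinOfCardEq htc).symm i).2
      obtain ⟨g, hg⟩ := hfin.mem_toFinset.mp this
      obtain ⟨u, hu, e⟩ := hr g
      exact ⟨u, hu, by rw [← e]; exact hg⟩
    choose g hg hgx using this
    obtain ⟨i, i', hne, e⟩ := hP g hg
    rw [hgx, hgx] at e
    exact hne (hf e)

theorem closure_inv_eq {G : Type*} [Group G] (S : Set G) : Subgroup.closure S⁻¹ = Subgroup.closure S :=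
  Subgroup.closure_inv S

theorem schreier {G : Type*} [Group G] (S : Set G) (hS : S.Finite) (h1 : 1 ∈ S)
    (hcl : Subgroup.closure S = ⊤) (H : Subgroup G) (I : ℕ) (hI0 : H.index ≠ 0) (hI : H.index ≤ I) :
    Subgroup.closure {h : H | (h : G) ∈ S ^ (2 * I + 1)} = ⊤ := by
  have hP : ∀ h : Fin (I + 1) → G, ∃ i i', i ≠ i' ∧ h i • ((1 : G) : G ⧸ H) = h i' • ((1 : G) : G ⧸ H) := by
    intro h
    by_contra hcon
    push Not at hcon
    have hinj : Function.Injective (fun i => h i • ((1 : G) : G ⧸ H)) := fun i i' e => by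
      by_contra hne
      exact hcon i i' hne e
    have : Finite (G ⧸ H) := Nat.finite_of_card_ne_zero hI0
    have := Nat.card_le_card_of_injective _ hinj
    rw [Nat.card_fin] at this
    unfold Subgroup.index at hI
    omega
  have hr : ∀ g : G, ∃ u ∈ S ^ I, g * u ∈ H := by
    intro g
    obtain ⟨t, ht, e⟩ := reach S hS h1 hcl _ I (fun h _ => hP h) g⁻¹
    refine ⟨t, ht, ?_⟩
    simp only [MulAction.Quotient.smul_mk, smul_eq_mul, mul_one, QuotientGroup.eq, inv_inv] at e
    exact e
  have hl : ∀ g : G, ∃ t ∈ S ^ I, g * t⁻¹ ∈ H := by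
    intro g
    obtain ⟨t, ht, e⟩ := reach S⁻¹ hS.inv (by simpa using h1) (by rw [closure_inv_eq, hcl]) _ I (fun h _ => hP h) g⁻¹
    refine ⟨t⁻¹, by rwa [inv_pow, Set.mem_inv] at ht, ?_⟩
    simp only [MulAction.Quotient.smul_mk, smul_eq_mul, mul_one, QuotientGroup.eq, inv_inv] at e
    simpa using e
  let K : Subgroup G := (Subgroup.closure {h : H | (h : G) ∈ S ^ (2 * I + 1)}).map H.subtype
  have hK : ∀ g ∈ H, ∀ j ≤ 2 * I + 1, g ∈ S ^ j → g ∈ K := by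
    intro g hg j hj hgS
    exact ⟨⟨g, hg⟩, Subgroup.subset_closure (show g ∈ S ^ (2 * I + 1) from mem_pow_mono h1 hj hgS), rfl⟩
  have hmain : ∀ g : G, ∃ t ∈ S ^ I, g * t⁻¹ ∈ K := by
    intro g
    have hg : g ∈ Subgroup.closure S := by rw [hcl]; trivial
    induction hg using Subgroup.closure_induction_right with
    | one => exact ⟨1, mem_pow_mono h1 (Nat.zero_le I) (by simp), by simp⟩
    | mul_right x hx s hs ih =>
      obtain ⟨t, ht, hk⟩ := ih
      obtain ⟨t', ht', h2⟩ := hl (t * s)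
      obtain ⟨u, hu, h3⟩ := hr t'
      refine ⟨t', ht', ?_⟩
      have a1 : t' * u ∈ K := hK _ h3 (I + I) (by omega) (by rw [pow_add]; exact Set.mul_mem_mul ht' hu)
      have a2 : t * s * u ∈ K := by
        refine hK _ ?_ (I + 1 + I) (by omega) ?_
        · have := H.mul_mem h2 h3
          simpa [mul_assoc] using this
        · rw [pow_add, pow_succ]; exact Set.mul_mem_mul (Set.mul_mem_mul ht hs) hu
      have := K.mul_mem hk (K.mul_mem a2 (K.inv_mem a1))
      convert this using 1
      group
    | mul_inv_cancel x hx s hs ih =>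
      obtain ⟨t, ht, hk⟩ := ih
      obtain ⟨t', ht', h2⟩ := hl (t * s⁻¹)
      obtain ⟨u, hu, h3⟩ := hr t
      refine ⟨t', ht', ?_⟩
      have a1 : t * u ∈ K := hK _ h3 (I + I) (by omega) (by rw [pow_add]; exact Set.mul_mem_mul ht hu)
      have a2 : t' * s * u ∈ K := by
        refine hK _ ?_ (I + 1 + I) (by omega) ?_
        · have := H.mul_mem (H.inv_mem h2) h3
          convert this using 1
          group
        · rw [pow_add, pow_succ]; exact Set.mul_mem_mul (Set.mul_mem_mul ht' hs) hu
      have := K.mul_mem hk (K.mul_mem a1 (K.inv_mem a2))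
      convert this using 1
      group
  rw [eq_top_iff]
  rintro ⟨g, hg⟩ -
  obtain ⟨t, ht, hk⟩ := hmain g
  have hKH : K ≤ H := by rintro _ ⟨y, _, rfl⟩; exact y.2
  have htH : t ∈ H := by
    have := H.mul_mem (H.inv_mem (hKH hk)) hg
    simpa using this
  have : g ∈ K := by
    have := K.mul_mem hk (hK t htH I (by omega) ht)
    simpa using this
  obtain ⟨y, hy, e⟩ := this
  have : y = ⟨g, hg⟩ := Subtype.ext e
  rwa [← this]

/-- left-normed iterated commutators -/
def ic {G : Type*} [Group G] (x : ℕ → G) : ℕ → G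
  | 0 => x 0
  | k + 1 => ic x k * x (k + 1) * (ic x k)⁻¹ * (x (k + 1))⁻¹

theorem ic_map {G H : Type*} [Group G] [Group H] (φ : G →* H) (x : ℕ → G) (k : ℕ) :
    φ (ic x k) = ic (fun i => φ (x i)) k := by
  induction k with
  | zero => rfl
  | succ k ih => simp only [ic]; simp [ih]

theorem ic_congr {G : Type*} [Group G] (x y : ℕ → G) (k : ℕ) (h : ∀ i ≤ k, x i = y i) : ic x k = ic y k := by
  induction k with
  | zero => exact h 0 le_rfl
  | succ k ih => simp only [ic]; rw [ih (fun i hi => h i (by omega)), h (k + 1) le_rfl]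

theorem nilpotent_of_ic (c : ℕ) : ∀ (G : Type) [Group G], (∀ x : ℕ → G, ic x c = 1) → Group.IsNilpotent G := by
  induction c with
  | zero =>
    intro G _ h
    have : Subsingleton G := ⟨fun a b => by rw [show a = 1 from h (fun _ => a), show b = 1 from h (fun _ => b)]⟩
    infer_instance
  | succ c ih =>
    intro G _ h
    apply Group.of_quotient_center_nilpotent
    apply ih
    intro x
    choose y hy using fun i => QuotientGroup.mk_surjective (x i)
    have : x = fun i => (QuotientGroup.mk' (Subgroup.center G)) (y i) := funext fun i => (hy i).symm
    rw [this, ← ic_map]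
    rw [QuotientGroup.mk'_apply, QuotientGroup.eq_one_iff, Subgroup.mem_center_iff]
    intro g
    have h2 := h (fun i => if i = c + 1 then g else y i)
    simp only [ic, if_true] at h2
    rw [ic_congr _ y c (fun i hi => by rw [if_neg (by omega)])] at h2
    rw [mul_assoc, ← mul_inv_rev, mul_inv_eq_one] at h2
    exact h2.symm

end UPI
end

section
open Pointwise

namespace UPI

/-- irreducibility of a representation -/
def Irr {E G V : Type*} [Field E] [Monoid G] [AddCommGroup V] [Module E V] (ρ : G →* Module.End E V) : Prop :=
  ∀ U : Submodule E V, (∀ g, ∀ u ∈ U, ρ g u ∈ U) → U = ⊥ ∨ U = ⊤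

theorem burnside {E V : Type*} [Field E] [IsAlgClosed E] [AddCommGroup V] [Module E V] [FiniteDimensional E V]
    [Nontrivial V] (A : Subalgebra E (Module.End E V))
    (hA : ∀ U : Submodule E V, (∀ a ∈ A, ∀ u ∈ U, a u ∈ U) → U = ⊥ ∨ U = ⊤) : A = ⊤ := by
  have hs : ∀ (a : A) (v : V), a • v = (a : Module.End E V) v := fun a v => rfl
  have : IsSimpleModule A V := by
    suffices h : IsSimpleOrder (Submodule A V) from { toIsSimpleOrder := h }
    refine ⟨?_⟩
    intro U
    have := hA (U.restrictScalars E) (fun a ha u hu => U.smul_mem (⟨a, ha⟩ : A) hu)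
    rcases this with h | h
    · left
      exact (Submodule.restrictScalars_eq_bot_iff (S := E) (R := A) (M := V)).mp h
    · right
      exact (Submodule.restrictScalars_eq_top_iff (S := E) (R := A) (M := V)).mp h
  have schur : ∀ φ : Module.End A V, ∃ c : E, ∀ v, φ v = c • v := by
    intro φ
    let φ' : Module.End E V := φ.restrictScalars E
    obtain ⟨c, hc⟩ := Module.End.exists_eigenvalue φ'
    refine ⟨c, ?_⟩
    have := hA (φ'.eigenspace c) (by
      intro a ha u hu
      rw [Module.End.mem_eigenspace_iff] at hu ⊢
      have : φ ((⟨a, ha⟩ : A) • u) = (⟨a, ha⟩ : A) • φ u := map_smul _ _ _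
      change φ (a u) = a (φ u) at this
      change φ u = c • u at hu
      change φ (a u) = _
      rw [this, hu, map_smul])
    rcases this with h | h
    · exact absurd h hc
    · intro v
      have : v ∈ φ'.eigenspace c := by rw [h]; trivial
      exact Module.End.mem_eigenspace_iff.mp this
  rw [eq_top_iff]
  intro f _
  let f' : Module.End (Module.End A V) V :=
    { toFun := f
      map_add' := map_add f
      map_smul' := by
        intro φ v
        obtain ⟨c, hc⟩ := schur φ
        simp only [Module.End.smul_def, RingHom.id_apply]
        rw [hc, hc, map_smul] }
  let b := Module.finBasis E V
  classical
  obtain ⟨r, hr⟩ := jacobson_density (R := A) f' (Finset.univ.image b)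
  have : f = (r : Module.End E V) := by
    apply b.ext
    intro i
    exact hr (b i) (by simp)
  rw [this]
  exact r.2

theorem span_words {E G V : Type*} [Field E] [IsAlgClosed E] [Group G] [AddCommGroup V] [Module E V] [FiniteDimensional E V]
    (ρ : G →* Module.End E V) (hirr : Irr ρ) (S : Set G) (h1 : 1 ∈ S)
    (hcl : Subgroup.closure S = ⊤) :
    Submodule.span E (ρ '' (S ^ (Module.finrank E V ^ 2))) = ⊤ := by
  rcases subsingleton_or_nontrivial V with hV | hV
  · rw [eq_top_iff]
    intro f _
    have : f = 0 := by ext v; exact Subsingleton.elim _ _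
    rw [this]; exact Submodule.zero_mem _
  let A : ℕ → Submodule E (Module.End E V) := fun j => Submodule.span E (ρ '' (S ^ j))
  have hmono : Monotone A := fun i j hij => Submodule.span_mono (Set.image_mono (fun x hx => mem_pow_mono h1 hij hx))
  have hone : ∀ j, (1 : Module.End E V) ∈ A j := fun j =>
    Submodule.subset_span ⟨1, mem_pow_mono h1 (Nat.zero_le j) (by simp), map_one ρ⟩
  have hN : Module.finrank E (Module.End E V) = Module.finrank E V ^ 2 := by
    rw [Module.finrank_linearMap, sq]
  have hj : ∃ j, j < Module.finrank E V ^ 2 ∧ A (j + 1) ≤ A j ∨ A j = ⊤ ∧ j = Module.finrank E V ^ 2 := by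
    by_contra hcon
    push Not at hcon
    have hlt : ∀ j ≤ Module.finrank E V ^ 2, j < Module.finrank E (A j) := by
      intro j
      induction j with
      | zero =>
        intro _
        rw [Module.finrank_pos_iff_exists_ne_zero]
        exact ⟨⟨1, hone 0⟩, fun h => one_ne_zero (congrArg Subtype.val h)⟩
      | succ j ih =>
        intro hj
        have h2 := ih (by omega)
        have h3 : A j < A (j + 1) := lt_of_le_not_ge (hmono (Nat.le_succ j)) ((hcon j).1 (by omega))
        have := Submodule.finrank_lt_finrank_of_lt h3
        omega
    have h2 := hlt _ le_rfl
    have h3 := Submodule.finrank_le (A (Module.finrank E V ^ 2))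
    omega
  obtain ⟨j, ⟨hjN, hj⟩ | ⟨hj, rfl⟩⟩ := hj
  swap
  · exact hj
  rw [eq_top_iff]
  refine le_trans ?_ (hmono hjN.le)
  have hs : ∀ s ∈ S, ∀ f ∈ A j, ρ s * f ∈ A j := by
    intro s hs f hf
    apply hj
    refine Submodule.span_induction (p := fun f _ => ρ s * f ∈ A (j + 1)) ?_ ?_ ?_ ?_ hf
    · rintro _ ⟨g, hg, rfl⟩
      exact Submodule.subset_span ⟨s * g, by rw [pow_succ']; exact Set.mul_mem_mul hs hg, map_mul _ _ _⟩
    · simp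
    · intro x y _ _ hx hy; rw [mul_add]; exact Submodule.add_mem _ hx hy
    · intro c x _ hx; rw [mul_smul_comm]; exact Submodule.smul_mem _ _ hx
  have hinv : ∀ g : G, ρ g⁻¹ * ρ g = 1 := fun g => by rw [← map_mul]; simp
  have hs' : ∀ s ∈ S, ∀ f ∈ A j, ρ s⁻¹ * f ∈ A j := by
    intro s hsS f hf
    let L : A j →ₗ[E] A j := (LinearMap.mulLeft E (ρ s)).restrict (hs s hsS)
    have hLinj : Function.Injective L := by
      intro x y hxy
      have h2 : ρ s * (x : Module.End E V) = ρ s * (y : Module.End E V) := congrArg Subtype.val hxy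
      have := congrArg (fun z => ρ s⁻¹ * z) h2
      simp only [← mul_assoc, hinv, one_mul] at this
      exact Subtype.ext this
    obtain ⟨x, hx⟩ := LinearMap.injective_iff_surjective.mp hLinj ⟨f, hf⟩
    have h2 : ρ s * (x : Module.End E V) = f := congrArg Subtype.val hx
    rw [← h2, ← mul_assoc, hinv, one_mul]
    exact x.2
  have hall : ∀ g : G, ∀ f ∈ A j, ρ g * f ∈ A j := by
    intro g
    have hg : g ∈ Subgroup.closure S := by rw [hcl]; trivial
    induction hg using Subgroup.closure_induction'' with
    | mem s hsS => exact hs s hsS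
    | inv_mem s hsS => exact hs' s hsS
    | one => intro y hy; simpa using hy
    | mul a b _ _ ha hb => intro y hy; rw [map_mul, mul_assoc]; exact ha _ (hb _ hy)
  let B : Subalgebra E (Module.End E V) := Algebra.adjoin E (Set.range ρ)
  have hB : B = ⊤ := by
    apply burnside
    intro U hU
    exact hirr U (fun g u hu => hU (ρ g) (Algebra.subset_adjoin ⟨g, rfl⟩) u hu)
  have hBA : ∀ f ∈ B, ∀ a ∈ A j, f * a ∈ A j := by
    intro f hf
    induction hf using Algebra.adjoin_induction with
    | mem x hx => obtain ⟨g, rfl⟩ := hx; exact hall g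
    | algebraMap r => intro a ha; rw [← Algebra.smul_def]; exact Submodule.smul_mem _ _ ha
    | add x y _ _ hx hy => intro a ha; rw [add_mul]; exact Submodule.add_mem _ (hx a ha) (hy a ha)
    | mul x y _ _ hx hy => intro a ha; rw [mul_assoc]; exact hx _ (hy a ha)
  intro f _
  have := hBA f (by rw [hB]; trivial) 1 (hone j)
  simpa using this

end UPI
end

section
open Pointwise

namespace UPI

theorem FT {E G : Type} [Field E] [Group G] {d : ℕ} (M : G →* Matrix (Fin d) (Fin d) E) (S : Set G)
    (hcl : Subgroup.closure S = ⊤) (T : Set (Matrix (Fin d) (Fin d) E)) (hT : T.Finite) (h1 : 1 ∈ T)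
    (hs : ∀ s ∈ S, ∃ c : E, c ≠ 0 ∧ ∀ x ∈ T, (c • M s) * x ∈ T) :
    ∃ K : Subgroup G, (∀ g ∈ K, ∃ c : E, M g = c • 1) ∧ K.index ≠ 0 ∧ K.index ≤ T.ncard := by
  have hinv : ∀ g : G, M g⁻¹ * M g = 1 := fun g => by rw [← map_mul]; simp
  have hall : ∀ g : G, ∃ c : E, c ≠ 0 ∧ ∀ x ∈ T, (c • M g) * x ∈ T := by
    intro g
    have hg : g ∈ Subgroup.closure S := by rw [hcl]; trivial
    induction hg using Subgroup.closure_induction'' with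
    | mem s hsS => exact hs s hsS
    | inv_mem s hsS =>
      obtain ⟨c, hc, h⟩ := hs s hsS
      have hci : (c⁻¹ • M s⁻¹) * (c • M s) = 1 := by
        rw [smul_mul_smul_comm, inv_mul_cancel₀ hc, hinv, one_smul]
      have himg : (fun x => (c • M s) * x) '' T = T := by
        apply Set.eq_of_subset_of_ncard_le _ _ hT
        · rintro _ ⟨y, hy, rfl⟩; exact h y hy
        · rw [Set.InjOn.ncard_image]
          intro x _ y _ hxy
          have := congrArg (fun z => (c⁻¹ • M s⁻¹) * z) hxy
          simpa only [← mul_assoc, hci, one_mul] using this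
      refine ⟨c⁻¹, inv_ne_zero hc, ?_⟩
      intro x hx
      rw [← himg] at hx
      obtain ⟨z, hz, rfl⟩ := hx
      simp only [← mul_assoc, hci, one_mul]
      exact hz
    | one => exact ⟨1, one_ne_zero, fun x hx => by simpa using hx⟩
    | mul a b _ _ ha hb =>
      obtain ⟨c, hc, h⟩ := ha
      obtain ⟨c', hc', h'⟩ := hb
      refine ⟨c * c', mul_ne_zero hc hc', fun x hx => ?_⟩
      rw [map_mul, ← smul_mul_smul_comm, mul_assoc]
      exact h _ (h' x hx)
  let K : Subgroup G :=
    { carrier := {g | ∃ c : E, c ≠ 0 ∧ M g = c • 1}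
      one_mem' := ⟨1, one_ne_zero, by simp⟩
      mul_mem' := by
        rintro a b ⟨c, hc, h⟩ ⟨c', hc', h'⟩
        exact ⟨c * c', mul_ne_zero hc hc', by rw [map_mul, h, h', smul_mul_smul_comm, one_mul]⟩
      inv_mem' := by
        rintro a ⟨c, hc, h⟩
        refine ⟨c⁻¹, inv_ne_zero hc, ?_⟩
        have := hinv a
        rw [h, mul_smul_comm, mul_one] at this
        rw [← this, smul_smul, inv_mul_cancel₀ hc, one_smul] }
  refine ⟨K, ?_, ?_⟩
  · rintro g ⟨c, _, h⟩; exact ⟨c, h⟩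
  choose c hc hcT using hall
  let F : G ⧸ K → T := fun q => ⟨(c q.out • M q.out) * 1, hcT _ _ h1⟩
  have hF : Function.Injective F := by
    intro q q' h
    have h2 : c q.out • M q.out = c q'.out • M q'.out := by
      have := congrArg Subtype.val h
      simpa [F] using this
    have : q.out⁻¹ * q'.out ∈ K := by
      refine ⟨c q.out / c q'.out, div_ne_zero (hc _) (hc _), ?_⟩
      have h3 : M q'.out = (c q.out / c q'.out) • M q.out := by
        rw [div_eq_inv_mul, mul_smul, h2, smul_smul, inv_mul_cancel₀ (hc _), one_smul]
      rw [map_mul, h3, mul_smul_comm, hinv]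
    rw [← QuotientGroup.eq] at this
    simpa using this
  have : Finite T := hT
  have hfin : Finite (G ⧸ K) := Finite.of_injective F hF
  refine ⟨?_, ?_⟩
  · unfold Subgroup.index
    exact Nat.card_ne_zero.mpr ⟨⟨((1 : G) : G ⧸ K)⟩, hfin⟩
  · exact Nat.card_le_card_of_injective F hF

/-- rescaled matrices of determinant one -/
def Sc {E G : Type} [Field E] [Group G] {d : ℕ} (M : G →* Matrix (Fin d) (Fin d) E) (S : Set G) :
    Set (Matrix (Fin d) (Fin d) E) := {x | ∃ g ∈ S, ∃ c : E, c ^ d * (M g).det = 1 ∧ x = c • M g}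

theorem Sc_down {E G : Type} [Field E] [Group G] {d : ℕ} (hd : d ≠ 0) (M : G →* Matrix (Fin d) (Fin d) E) (S : Set G) (j : ℕ) :
    ∀ x ∈ Sc M S ^ j, ∃ g ∈ S ^ j, ∃ c : E, c ≠ 0 ∧ x = c • M g := by
  induction j with
  | zero => intro x hx; simp only [pow_zero, Set.mem_one] at hx; exact ⟨1, by simp, 1, one_ne_zero, by simp [hx]⟩
  | succ j ih =>
    intro x hx
    rw [pow_succ] at hx
    obtain ⟨y, hy, z, ⟨g', hg', c', hc', rfl⟩, rfl⟩ := Set.mem_mul.mp hx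
    obtain ⟨g, hg, c, hc, rfl⟩ := ih y hy
    refine ⟨g * g', by rw [pow_succ]; exact Set.mul_mem_mul hg hg', c * c', mul_ne_zero hc ?_, ?_⟩
    · rintro rfl; simp [hd] at hc'
    · rw [map_mul, smul_mul_smul_comm]

theorem Sc_one_up {E G : Type} [Field E] [IsAlgClosed E] [Group G] {d : ℕ} (hd : d ≠ 0) (M : G →* Matrix (Fin d) (Fin d) E) (S : Set G) :
    ∀ g ∈ S, ∃ c : E, c ≠ 0 ∧ c • M g ∈ Sc M S := by
  intro z hz
  have hMdet : (M z).det ≠ 0 := by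
    intro h0
    have : (M z).det * (M z⁻¹).det = 1 := by rw [← Matrix.det_mul, ← map_mul]; simp
    rw [h0, zero_mul] at this
    exact zero_ne_one this
  obtain ⟨c', hc'⟩ := IsAlgClosed.exists_pow_nat_eq (M z).det⁻¹ (Nat.pos_of_ne_zero hd)
  have hc2 : c' ^ d * (M z).det = 1 := by rw [hc', inv_mul_cancel₀ hMdet]
  refine ⟨c', ?_, z, hz, c', hc2, rfl⟩
  rintro rfl; simp [hd] at hc2

theorem Sc_up {E G : Type} [Field E] [IsAlgClosed E] [Group G] {d : ℕ} (hd : d ≠ 0) (M : G →* Matrix (Fin d) (Fin d) E) (S : Set G) (j : ℕ) :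
    ∀ g ∈ S ^ j, ∃ c : E, c ≠ 0 ∧ c • M g ∈ Sc M S ^ j := by
  induction j with
  | zero => intro g hg; simp only [pow_zero, Set.mem_one] at hg; exact ⟨1, one_ne_zero, by simp [hg]⟩
  | succ j ih =>
    intro g hg
    rw [pow_succ] at hg
    obtain ⟨y, hy, z, hz, rfl⟩ := Set.mem_mul.mp hg
    obtain ⟨c, hc, h⟩ := ih y hy
    obtain ⟨c', hc', h'⟩ := Sc_one_up hd M S z hz
    refine ⟨c * c', mul_ne_zero hc hc', ?_⟩
    rw [map_mul, ← smul_mul_smul_comm, pow_succ]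
    exact Set.mul_mem_mul h h'

theorem Sc_det {E G : Type} [Field E] [Group G] {d : ℕ} (M : G →* Matrix (Fin d) (Fin d) E) (S : Set G) :
    ∀ s ∈ Sc M S, s.det = 1 := by
  rintro s ⟨g, hg, c, hc, rfl⟩
  simpa [Matrix.det_smul] using hc

theorem Sc_one {E G : Type} [Field E] [Group G] {d : ℕ} (M : G →* Matrix (Fin d) (Fin d) E) (S : Set G) (h1 : 1 ∈ S) :
    (1 : Matrix (Fin d) (Fin d) E) ∈ Sc M S := ⟨1, h1, 1, by simp, by simp⟩

/-- possible traces -/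
def TT (E : Type) [Field E] (d N : ℕ) : Set E := {t | ∃ m : Fin d → E, (∀ i, m i ^ N = 1) ∧ t = ∑ i, m i}

theorem mu_card (E : Type) [Field E] (N : ℕ) (hN : 0 < N) :
    {x : E | x ^ N = 1}.Finite ∧ {x : E | x ^ N = 1}.ncard ≤ N := by
  classical
  have : {x : E | x ^ N = 1} = ((Polynomial.nthRoots N (1 : E)).toFinset : Set E) := by
    ext x
    simp [Polynomial.mem_nthRoots hN]
  rw [this]
  refine ⟨Finset.finite_toSet _, ?_⟩
  rw [Set.ncard_coe_finset]
  exact (Multiset.toFinset_card_le _).trans (Polynomial.card_nthRoots N 1)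

theorem TT_card (E : Type) [Field E] (d N : ℕ) (hN : 0 < N) : (TT E d N).Finite ∧ (TT E d N).ncard ≤ N ^ d := by
  obtain ⟨hf, hc⟩ := mu_card E N hN
  have : Finite {x : E | x ^ N = 1} := hf
  let F : (Fin d → {x : E | x ^ N = 1}) → E := fun m => ∑ i, (m i : E)
  have hr : TT E d N = Set.range F := by
    ext t
    constructor
    · rintro ⟨m, hm, rfl⟩; exact ⟨fun i => ⟨m i, hm i⟩, rfl⟩
    · rintro ⟨m, rfl⟩; exact ⟨fun i => m i, fun i => (m i).2, rfl⟩
  rw [hr]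
  refine ⟨Set.finite_range F, ?_⟩
  rw [← Set.image_univ]
  refine (Set.ncard_image_le Set.finite_univ).trans ?_
  rw [Set.ncard_univ, Nat.card_fun, Nat.card_fin]
  exact Nat.pow_le_pow_left hc d

/-- tame for a matrix representation -/
def TameM {E G : Type} [Field E] [Group G] {d : ℕ} (M : G →* Matrix (Fin d) (Fin d) E) (X : Set G) (e : ℕ) : Prop :=
  ∀ g ∈ X, ∀ l u, (M g).charpoly.IsRoot l → (M g).charpoly.IsRoot u → (l / u) ^ e = 1

theorem trace_mem {E G : Type} [Field E] [IsAlgClosed E] [Group G] {d : ℕ} (hd : d ≠ 0) (M : G →* Matrix (Fin d) (Fin d) E)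
    (S : Set G) (h1 : 1 ∈ S) (m0 e : ℕ) (ht : TameM M (S ^ m0) e) (j : ℕ) (hj : j ≤ m0)
    (x : Matrix (Fin d) (Fin d) E) (hx : x ∈ Sc M S ^ j) : x.trace ∈ TT E d (d * e) := by
  obtain ⟨g, hg, c, hc, hxg⟩ := Sc_down hd M S j x hx
  have hdet : x.det = 1 := det_pow_set (Sc M S) (Sc_det M S) j x hx
  obtain ⟨α, hα⟩ := exists_roots_fin d x.charpoly (Matrix.charpoly_monic x)
    (by rw [Matrix.charpoly_natDegree_eq_dim, Fintype.card_fin])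
  have hroots : x.charpoly.roots = Finset.univ.val.map α := by
    rw [hα]
    have := Polynomial.roots_multiset_prod_X_sub_C (Finset.univ.val.map α)
    rw [Multiset.map_map] at this
    exact this
  have hprod : ∏ i, α i = 1 := by
    rw [← hdet, Matrix.det_eq_prod_roots_charpoly, hroots]; rfl
  have hsum : x.trace = ∑ i, α i := by
    rw [Matrix.trace_eq_sum_roots_charpoly, hroots]; rfl
  have hr : ∀ i, (M g).charpoly.IsRoot (c⁻¹ * α i) := by
    intro i
    have : x.charpoly.IsRoot (α i) := by
      rw [hα, Polynomial.IsRoot, Polynomial.eval_prod]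
      exact Finset.prod_eq_zero (Finset.mem_univ i) (by simp)
    rw [isRoot_charpoly_iff] at this ⊢
    obtain ⟨v, hv, h⟩ := this
    refine ⟨v, hv, ?_⟩
    rw [hxg, Matrix.smul_mulVec] at h
    rw [mul_smul, ← h, smul_smul, inv_mul_cancel₀ hc, one_smul]
  have hquot : ∀ i i', (α i / α i') ^ e = 1 := by
    intro i i'
    have := ht g (mem_pow_mono h1 hj hg) _ _ (hr i) (hr i')
    rwa [mul_div_mul_left _ _ (inv_ne_zero hc)] at this
  refine ⟨α, ?_, hsum⟩
  intro i
  have h2 : ∏ i', (α i / α i') ^ e = 1 := Finset.prod_eq_one fun i' _ => hquot i i'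
  rw [Finset.prod_pow, Finset.prod_div_distrib, hprod, div_one, Finset.prod_const, Finset.card_univ, Fintype.card_fin,
    ← pow_mul] at h2
  exact h2

end UPI
end

section
open Pointwise

namespace UPI

theorem exists_word_basis {E G : Type} [Field E] [IsAlgClosed E] [Group G] {d : ℕ} (hd : d ≠ 0) (M : G →* Matrix (Fin d) (Fin d) E)
    (S : Set G) (hsp : Submodule.span E (M '' (S ^ (d ^ 2))) = ⊤) :
    ∃ b : Module.Basis (Fin (d ^ 2)) E (Matrix (Fin d) (Fin d) E), ∀ i, b i ∈ Sc M S ^ (d ^ 2) := by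
  have hsp' : ⊤ ≤ Submodule.span E (Sc M S ^ (d ^ 2)) := by
    rw [← hsp, Submodule.span_le]
    rintro _ ⟨g, hg, rfl⟩
    obtain ⟨c, hc, h⟩ := Sc_up hd M S _ g hg
    have : M g = c⁻¹ • (c • M g) := by rw [smul_smul, inv_mul_cancel₀ hc, one_smul]
    rw [this]
    exact Submodule.smul_mem _ _ (Submodule.subset_span h)
  let b := Module.Basis.ofSpan hsp'
  have : Finite _ := Module.Finite.finite_basis b
  have hcard : Nat.card ((linearIndepOn_empty E id).extend (Set.empty_subset (Sc M S ^ (d ^ 2)))) = d ^ 2 := by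
    rw [← Module.finrank_eq_nat_card_basis b, Module.finrank_matrix]
    simp [sq]
  let f := Finite.equivFinOfCardEq hcard
  refine ⟨b.reindex f, fun i => ?_⟩
  rw [Module.Basis.reindex_apply]
  exact Module.Basis.ofSpan_subset hsp' ⟨_, rfl⟩

theorem trace_inj {E : Type} [Field E] {d : ℕ} (b : Module.Basis (Fin (d ^ 2)) E (Matrix (Fin d) (Fin d) E))
    {x y : Matrix (Fin d) (Fin d) E} (h : ∀ i, (x * b i).trace = (y * b i).trace) : x = y := by
  rw [Matrix.ext_iff_trace_mul_right]
  intro z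
  have : (Matrix.traceLinearMap (Fin d) E E) ∘ₗ (LinearMap.mulLeft E x) = (Matrix.traceLinearMap (Fin d) E E) ∘ₗ (LinearMap.mulLeft E y) := by
    apply b.ext
    intro i
    simpa using h i
  simpa using LinearMap.congr_fun this z

theorem FIN0 {E G : Type} [Field E] [IsAlgClosed E] [Group G] {d e : ℕ} (hd : d ≠ 0) (he : e ≠ 0) (M : G →* Matrix (Fin d) (Fin d) E)
    (S : Set G) (h1 : 1 ∈ S) (hcl : Subgroup.closure S = ⊤) (hsp : Submodule.span E (M '' (S ^ (d ^ 2))) = ⊤)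
    (m0 : ℕ) (hm0 : ((d * e) ^ d) ^ (d ^ 2) + d ^ 2 ≤ m0) (ht : TameM M (S ^ m0) e) :
    ∃ K : Subgroup G, (∀ g ∈ K, ∃ c : E, M g = c • 1) ∧ K.index ≠ 0 ∧ K.index ≤ ((d * e) ^ d) ^ (d ^ 2) := by
  obtain ⟨b, hb⟩ := exists_word_basis hd M S hsp
  have hN : 0 < d * e := Nat.mul_pos (Nat.pos_of_ne_zero hd) (Nat.pos_of_ne_zero he)
  obtain ⟨hTf, hTc⟩ := TT_card E d (d * e) hN
  have : Finite (TT E d (d * e)) := hTf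
  set Q := ((d * e) ^ d) ^ (d ^ 2) with hQ
  have hsc1 := Sc_one M S h1
  have hbd : ∀ j ≤ Q, (Sc M S ^ j).Finite ∧ (Sc M S ^ j).ncard ≤ Q := by
    intro j hj
    let F : (Sc M S ^ j : Set _) → (Fin (d ^ 2) → TT E d (d * e)) := fun x i =>
      ⟨((x : Matrix (Fin d) (Fin d) E) * b i).trace, trace_mem hd M S h1 m0 e ht (j + d ^ 2) (by omega) _
        (by rw [pow_add]; exact Set.mul_mem_mul x.2 (hb i))⟩
    have hF : Function.Injective F := by
      intro x y hxy
      apply Subtype.ext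
      apply trace_inj b
      intro i
      exact congrArg Subtype.val (congrFun hxy i)
    refine ⟨Finite.of_injective F hF, ?_⟩
    have := Nat.card_le_card_of_injective F hF
    rw [Nat.card_fun, Nat.card_fin] at this
    exact this.trans (Nat.pow_le_pow_left hTc _)
  have hst : ∃ j ≤ Q, j < Q ∧ Sc M S ^ (j + 1) ⊆ Sc M S ^ j := by
    by_contra hcon
    push Not at hcon
    have hlt : ∀ j ≤ Q, j < (Sc M S ^ j).ncard := by
      intro j
      induction j with
      | zero => intro _; rw [pow_zero, ← Set.singleton_one, Set.ncard_singleton]; norm_num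
      | succ j ih =>
        intro hj
        have h2 := ih (by omega)
        have hss : Sc M S ^ j ⊂ Sc M S ^ (j + 1) :=
          ⟨fun x hx => mem_pow_mono hsc1 (Nat.le_succ j) hx, hcon j (by omega) (by omega)⟩
        have := Set.ncard_lt_ncard hss (hbd _ hj).1
        omega
    have h2 := hlt Q le_rfl
    have h3 := (hbd Q le_rfl).2
    omega
  obtain ⟨j, hjQ, _, hj⟩ := hst
  obtain ⟨K, hK, hK0, hKI⟩ := FT M S hcl (Sc M S ^ j) (hbd j hjQ).1 (mem_pow_mono hsc1 (Nat.zero_le j) (by simp)) (by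
    intro s hs
    obtain ⟨c, hc, h⟩ := Sc_one_up hd M S s hs
    refine ⟨c, hc, fun x hx => hj ?_⟩
    rw [pow_succ']
    exact Set.mul_mem_mul h hx)
  exact ⟨K, hK, hK0, hKI.trans (hbd j hjQ).2⟩

theorem coeffs_in_subfield {E : Type} [Field E] (k : Subfield E) {n : ℕ} (Γ : Matrix (Fin n) (Fin n) E) (hΓ : Γ.det ≠ 0)
    (hk : ∀ i j, Γ i j ∈ k) (c : Fin n → E) (hc : ∀ j, Matrix.vecMul c Γ j ∈ k) : ∀ i, c i ∈ k := by
  let Γ0 : Matrix (Fin n) (Fin n) k := fun i j => ⟨Γ i j, hk i j⟩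
  let v0 : Fin n → k := fun j => ⟨_, hc j⟩
  have hmap : Γ0.map k.subtype = Γ := rfl
  have hdet0 : Γ0.det ≠ 0 := by
    intro h
    apply hΓ
    rw [← hmap, ← RingHom.mapMatrix_apply, ← RingHom.map_det, h, map_zero]
  have hmul : Γ * (Γ0⁻¹).map k.subtype = 1 := by
    rw [← hmap, ← Matrix.map_mul, Matrix.mul_nonsing_inv _ (Ne.isUnit hdet0)]
    simp
  have : c = fun i => (k.subtype (Matrix.vecMul v0 Γ0⁻¹ i)) := by
    have h2 : c = Matrix.vecMul (Matrix.vecMul c Γ) ((Γ0⁻¹).map k.subtype) := by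
      rw [Matrix.vecMul_vecMul, hmul, Matrix.vecMul_one]
    rw [h2]
    ext i
    rw [RingHom.map_vecMul]
    rfl
  intro i
  rw [this]
  exact (Matrix.vecMul v0 Γ0⁻¹ i).2

theorem FINk {E G : Type} [Field E] [IsAlgClosed E] [Group G] {d e : ℕ} (hd : d ≠ 0) (M : G →* Matrix (Fin d) (Fin d) E)
    (S : Set G) (h1 : 1 ∈ S) (hcl : Subgroup.closure S = ⊤) (hsp : Submodule.span E (M '' (S ^ (d ^ 2))) = ⊤)
    (m0 : ℕ) (hm0 : 2 * d ^ 2 + 1 ≤ m0) (ht : TameM M (S ^ m0) e) (k : Subfield E) [Finite k]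
    (hk : TT E d (d * e) ⊆ k) :
    ∃ K : Subgroup G, (∀ g ∈ K, ∃ c : E, M g = c • 1) ∧ K.index ≠ 0 ∧ K.index ≤ Nat.card k ^ (d ^ 2) := by
  obtain ⟨b, hb⟩ := exists_word_basis hd M S hsp
  let Γ : Matrix (Fin (d ^ 2)) (Fin (d ^ 2)) E := fun i j => (b i * b j).trace
  have hΓk : ∀ i j, Γ i j ∈ k := fun i j =>
    hk (trace_mem hd M S h1 m0 e ht (d ^ 2 + d ^ 2) (by omega) _ (by rw [pow_add]; exact Set.mul_mem_mul (hb i) (hb j)))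
  have hvec : ∀ (c : Fin (d ^ 2) → E) j, Matrix.vecMul c Γ j = ((∑ i, c i • b i) * b j).trace := by
    intro c j
    rw [Finset.sum_mul, Matrix.trace_sum]
    simp only [Matrix.vecMul, dotProduct, Γ, smul_mul_assoc, Matrix.trace_smul, smul_eq_mul]
  have hdet : Γ.det ≠ 0 := by
    intro h
    obtain ⟨c, hc0, hc⟩ := Matrix.exists_vecMul_eq_zero_iff.mpr h
    have h2 : ∑ i, c i • b i = 0 := by
      apply trace_inj b
      intro j
      rw [← hvec, hc]; simp
    apply hc0
    have := Fintype.linearIndependent_iff.mp b.linearIndependent c h2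
    exact funext this
  let T : Set (Matrix (Fin d) (Fin d) E) := Set.range (fun c : Fin (d ^ 2) → k => ∑ i, (c i : E) • b i)
  have hcrit : ∀ x : Matrix (Fin d) (Fin d) E, (∀ j, (x * b j).trace ∈ k) → x ∈ T := by
    intro x hx
    have hxs : ∑ i, b.repr x i • b i = x := b.sum_repr x
    have := coeffs_in_subfield k Γ hdet hΓk (fun i => b.repr x i) (by
      intro j
      rw [hvec, hxs]; exact hx j)
    exact ⟨fun i => ⟨_, this i⟩, hxs⟩
  obtain ⟨K, hK, hK0, hKI⟩ := FT M S hcl T (Set.finite_range _) (by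
    apply hcrit
    intro j
    rw [one_mul]
    exact hk (trace_mem hd M S h1 m0 e ht (d ^ 2) (by omega) _ (hb j))) (by
    intro s hs
    obtain ⟨c, hc, h⟩ := Sc_one_up hd M S s hs
    refine ⟨c, hc, ?_⟩
    rintro _ ⟨a, rfl⟩
    apply hcrit
    intro j
    dsimp only
    rw [Finset.mul_sum, Finset.sum_mul, Matrix.trace_sum]
    refine Subfield.sum_mem _ fun i _ => ?_
    rw [mul_smul_comm, smul_mul_assoc, Matrix.trace_smul]
    refine k.mul_mem (a i).2 (hk (trace_mem hd M S h1 m0 e ht (1 + d ^ 2 + d ^ 2) (by omega) _ ?_))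
    rw [pow_add, pow_add, pow_one]
    exact Set.mul_mem_mul (Set.mul_mem_mul h (hb i)) (hb j))
  refine ⟨K, hK, hK0, hKI.trans ?_⟩
  have : T.ncard ≤ Nat.card (Fin (d ^ 2) → k) := by
    simp only [T]
    rw [← Set.image_univ]
    refine (Set.ncard_image_le Set.finite_univ).trans ?_
    rw [Set.ncard_univ]
  rwa [Nat.card_fun, Nat.card_fin] at this

end UPI
end

section
open Pointwise

namespace UPI

/-- invariant submodules -/
def Inv {E G V : Type} [Field E] [Group G] [AddCommGroup V] [Module E V] (ρ : G →* Module.End E V) (U : Submodule E V) : Prop :=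
  ∀ g, ∀ u ∈ U, ρ g u ∈ U

theorem exists_next {E G V : Type} [Field E] [Group G] [AddCommGroup V] [Module E V] [FiniteDimensional E V] (ρ : G →* Module.End E V)
    (A : Submodule E V) (hA : Inv ρ A) : ∃ B, Inv ρ B ∧ A ≤ B ∧ (A = ⊤ ∨ A < B) ∧
      ∀ U, Inv ρ U → A ≤ U → U ≤ B → U = A ∨ U = B := by
  by_cases h : A = ⊤
  · exact ⟨A, hA, le_rfl, Or.inl h, fun U _ h1 h2 => Or.inl (le_antisymm h2 h1)⟩
  · have hne : {B : Submodule E V | Inv ρ B ∧ A < B}.Nonempty :=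
      ⟨⊤, fun g u _ => trivial, lt_top_iff_ne_top.mpr h⟩
    obtain ⟨B, ⟨hB1, hB2⟩, hmin⟩ := (wellFounded_lt (α := Submodule E V)).has_min _ hne
    refine ⟨B, hB1, hB2.le, Or.inr hB2, ?_⟩
    intro U hU h1 h2
    rcases h1.eq_or_lt with h3 | h3
    · exact Or.inl h3.symm
    · right
      rcases h2.eq_or_lt with h4 | h4
      · exact h4
      · exact absurd h4 (hmin U ⟨hU, h3⟩)

theorem exists_flag {E G V : Type} [Field E] [Group G] [AddCommGroup V] [Module E V] [FiniteDimensional E V] (ρ : G →* Module.End E V)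
    (D : ℕ) (hD : Module.finrank E V ≤ D) : ∃ F : ℕ → Submodule E V, F 0 = ⊥ ∧ F D = ⊤ ∧ (∀ j, Inv ρ (F j)) ∧ Monotone F ∧
      ∀ j U, Inv ρ U → F j ≤ U → U ≤ F (j + 1) → U = F j ∨ U = F (j + 1) := by
  choose f hf1 hf2 hf3 hf4 using fun A : {A : Submodule E V // Inv ρ A} => exists_next ρ A.1 A.2
  let f' : {A : Submodule E V // Inv ρ A} → {A : Submodule E V // Inv ρ A} := fun A => ⟨f A, hf1 A⟩
  let F' : ℕ → {A : Submodule E V // Inv ρ A} := fun j => f'^[j] ⟨⊥, fun g u hu => by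
    rw [Submodule.mem_bot] at hu; rw [hu, map_zero]; exact Submodule.zero_mem _⟩
  have hs : ∀ j, F' (j + 1) = f' (F' j) := fun j => Function.iterate_succ_apply' _ _ _
  refine ⟨fun j => (F' j).1, rfl, ?_, fun j => (F' j).2, monotone_nat_of_le_succ fun j => ?_, ?_⟩
  · have : ∀ j, (F' j).1 = ⊤ ∨ j ≤ Module.finrank E (F' j).1 := by
      intro j
      induction j with
      | zero => right; omega
      | succ j ih =>
        rw [hs]
        rcases hf3 (F' j) with h | h
        · left; have := hf2 (F' j); rw [h] at this; exact top_le_iff.mp this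
        · right
          rcases ih with h' | h'
          · rw [h'] at h; exact absurd h not_top_lt
          · have := Submodule.finrank_lt_finrank_of_lt h
            have h5 : (f' (F' j)).1 = f (F' j) := rfl
            rw [h5]; omega
    rcases this D with h | h
    · exact h
    · apply Submodule.eq_top_of_finrank_eq
      have := Submodule.finrank_le (F' D).1
      show Module.finrank E (F' D).1 = _
      omega
  · rw [hs]; exact hf2 _
  · intro j U
    have := hf4 (F' j) U
    show Inv ρ U → (F' j).1 ≤ U → U ≤ (F' (j+1)).1 → U = (F' j).1 ∨ U = (F' (j+1)).1
    rw [hs]; exact this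

theorem step_exists {E G V : Type} [Field E] [IsAlgClosed E] [Group G] [AddCommGroup V] [Module E V] [FiniteDimensional E V]
    (ρ : G →* Module.End E V) (A B : Submodule E V) (hA : Inv ρ A) (hB : Inv ρ B) (hAB : A < B)
    (hirr : ∀ U, Inv ρ U → A ≤ U → U ≤ B → U = A ∨ U = B) :
    ∃ d, d ≠ 0 ∧ d ≤ Module.finrank E V ∧ ∃ M : G →* Matrix (Fin d) (Fin d) E,
      (∀ S : Set G, 1 ∈ S → Subgroup.closure S = ⊤ → Submodule.span E (M '' (S ^ (d ^ 2))) = ⊤) ∧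
      (∀ g l, (M g).charpoly.IsRoot l → (ρ g).HasEigenvalue l) ∧
      (∀ g (c : E), M g = c • 1 → ∀ x ∈ B, ρ g x - c • x ∈ A) := by
  let A' : Submodule E B := A.comap B.subtype
  let r : G → Module.End E B := fun g => (ρ g).restrict (fun x hx => hB g x hx)
  have hrA : ∀ g, A' ≤ A'.comap (r g) := fun g x hx => hA g x hx
  let ρW : G →* Module.End E (B ⧸ A') :=
    { toFun := fun g => A'.mapQ A' (r g) (hrA g)
      map_one' := by
        apply LinearMap.ext; intro q
        obtain ⟨x, rfl⟩ := A'.mkQ_surjective q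
        simp only [Submodule.mkQ_apply, Submodule.mapQ_apply, Module.End.one_apply]
        congr 1
        apply Subtype.ext
        show ρ 1 (x : V) = x
        simp
      map_mul' := by
        intro g h
        apply LinearMap.ext; intro q
        obtain ⟨x, rfl⟩ := A'.mkQ_surjective q
        simp only [Submodule.mkQ_apply, Submodule.mapQ_apply, Module.End.mul_apply]
        congr 1
        apply Subtype.ext
        show ρ (g * h) (x : V) = ρ g (ρ h x)
        simp }
  have hρW : ∀ g (x : B), ρW g (A'.mkQ x) = A'.mkQ (r g x) := fun g x => rfl
  have hmk : ∀ x : B, A'.mkQ x = 0 ↔ (x : V) ∈ A := by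
    intro x
    rw [Submodule.mkQ_apply, Submodule.Quotient.mk_eq_zero]; rfl
  have hIrr : Irr ρW := by
    intro U hU
    let U' : Submodule E V := (U.comap A'.mkQ).map B.subtype
    have hU'mem : ∀ x : B, (x : V) ∈ U' ↔ A'.mkQ x ∈ U := by
      intro x
      constructor
      · rintro ⟨y, hy, hyx⟩
        have : y = x := Subtype.ext hyx
        rw [← this]; exact hy
      · intro hx; exact ⟨x, hx, rfl⟩
    have hU'B : U' ≤ B := by rintro _ ⟨y, _, rfl⟩; exact y.2
    have h3 := hirr U' (by
      rintro g _ ⟨y, hy, rfl⟩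
      refine (hU'mem (r g y)).mpr ?_
      rw [← hρW]
      exact hU g _ hy) (by
      intro a ha
      refine (hU'mem ⟨a, hAB.le ha⟩).mpr ?_
      rw [(hmk ⟨a, hAB.le ha⟩).mpr ha]; exact U.zero_mem) hU'B
    rcases h3 with h3 | h3
    · left
      rw [eq_bot_iff]
      intro q hq
      obtain ⟨x, rfl⟩ := A'.mkQ_surjective q
      have := (hU'mem x).mpr hq
      rw [h3] at this
      rw [Submodule.mem_bot, hmk]; exact this
    · right
      rw [eq_top_iff]
      intro q _
      obtain ⟨x, rfl⟩ := A'.mkQ_surjective q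
      rw [← hU'mem, h3]; exact x.2
  have hnt : Nontrivial (B ⧸ A') := by
    obtain ⟨x, hxB, hxA⟩ := Set.exists_of_ssubset hAB
    refine ⟨⟨A'.mkQ ⟨x, hxB⟩, 0, ?_⟩⟩
    rw [Ne, hmk]; exact hxA
  let d := Module.finrank E (B ⧸ A')
  let b : Module.Basis (Fin d) E (B ⧸ A') := Module.finBasis E (B ⧸ A')
  let T : Module.End E (B ⧸ A') ≃ₐ[E] Matrix (Fin d) (Fin d) E := LinearMap.toMatrixAlgEquiv b
  let M : G →* Matrix (Fin d) (Fin d) E := (T : Module.End E (B ⧸ A') →* Matrix (Fin d) (Fin d) E).comp ρW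
  have hMv : ∀ g v, (M g).mulVec (b.equivFun v) = b.equivFun (ρW g v) := by
    intro g v
    exact LinearMap.toMatrix_mulVec_repr b b (ρW g) v
  refine ⟨d, Module.finrank_pos.ne', ?_, M, ?_, ?_, ?_⟩
  · exact (Submodule.finrank_quotient_le A').trans (Submodule.finrank_le B)
  · intro S h1 hcl
    have h := span_words ρW hIrr S h1 hcl
    have h2 := congrArg (Submodule.map (T : Module.End E (B ⧸ A') →ₗ[E] Matrix (Fin d) (Fin d) E)) h
    rw [Submodule.map_span, ← Set.image_comp, Submodule.map_top] at h2
    have h3 : LinearMap.range (T : Module.End E (B ⧸ A') →ₗ[E] Matrix (Fin d) (Fin d) E) = ⊤ :=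
      LinearMap.range_eq_top.mpr T.surjective
    rw [h3] at h2
    exact h2
  · intro g l hl
    obtain ⟨v, hv, h⟩ := (isRoot_charpoly_iff _ _).mp hl
    obtain ⟨x, hx⟩ := A'.mkQ_surjective (b.equivFun.symm v)
    have hv' : v = b.equivFun (A'.mkQ x) := by rw [hx, LinearEquiv.apply_symm_apply]
    rw [hv', hMv, ← map_smul] at h
    have h2 := b.equivFun.injective h
    rw [hρW, ← map_smul, ← sub_eq_zero, ← map_sub, hmk] at h2
    have hxA : (x : V) ∉ A := by
      intro hxA
      apply hv
      rw [hv', (hmk x).mpr hxA, map_zero]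
    have h2' : (ρ g - l • 1) (x : V) ∈ A := h2
    by_contra hne
    have hinj : Function.Injective (ρ g - l • (1 : Module.End E V)) := by
      rw [← LinearMap.ker_eq_bot]
      by_contra hk
      apply hne
      rw [Module.End.hasEigenvalue_iff, Module.End.eigenspace_def]
      exact hk
    have hAinv : ∀ a ∈ A, (ρ g - l • (1 : Module.End E V)) a ∈ A := fun a ha =>
      A.sub_mem (hA g a ha) (A.smul_mem _ ha)
    let L : A →ₗ[E] A := (ρ g - l • (1 : Module.End E V)).restrict hAinv
    have hL : Function.Injective L := fun a a' haa => Subtype.ext (hinj (congrArg Subtype.val haa))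
    obtain ⟨a, ha⟩ := LinearMap.injective_iff_surjective.mp hL ⟨_, h2'⟩
    have : (a : V) = x := hinj (congrArg Subtype.val ha)
    exact hxA (this ▸ a.2)
  · intro g c hg x hx
    have h : ρW g = c • 1 := by
      apply T.injective
      rw [map_smul, map_one]; exact hg
    have h2 : ρW g (A'.mkQ ⟨x, hx⟩) = c • A'.mkQ ⟨x, hx⟩ := by rw [h]; rfl
    rw [hρW, ← map_smul, ← sub_eq_zero, ← map_sub, hmk] at h2
    exact h2

end UPI
end

section
open Pointwise

namespace UPI

/-- commutator descent along a flag -/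
theorem flag_ic {E G V : Type} [Field E] [Group G] [AddCommGroup V] [Module E V] (ρ : G →* Module.End E V)
    (D : ℕ) (F : ℕ → Submodule E V) (h0 : F 0 = ⊥) (hD : F D = ⊤) (hinv : ∀ j, Inv ρ (F j)) (hmono : Monotone F)
    (x : ℕ → G) (hx : ∀ i, ∃ c : E, ∀ j < D, ∀ v ∈ F (j + 1), ρ (x i) v - c • v ∈ F j) : ρ (ic x D) = 1 := by
  have hx' : ∀ i, ∃ c : E, ∀ j, ∀ v ∈ F j, ρ (x i) v - c • v ∈ F (j - 1) := by
    intro i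
    obtain ⟨c, hc⟩ := hx i
    refine ⟨c, fun j v hv => ?_⟩
    rcases j with _ | j
    · rw [h0, Submodule.mem_bot] at hv
      rw [hv, map_zero, smul_zero, sub_zero]; exact Submodule.zero_mem _
    · by_cases hj : j < D
      · exact hc j hj v hv
      · have : F j = ⊤ := top_le_iff.mp (hD ▸ hmono (not_lt.mp hj))
        show _ ∈ F j
        rw [this]; trivial
  have key : ∀ k, ∃ c : E, (k ≠ 0 → c = 1) ∧ ∀ j, ∀ v ∈ F j, ρ (ic x k) v - c • v ∈ F (j - (k + 1)) := by
    intro k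
    induction k with
    | zero =>
      obtain ⟨c, hc⟩ := hx' 0
      exact ⟨c, fun h => absurd rfl h, fun j v hv => hc j v hv⟩
    | succ k ih =>
      obtain ⟨c, _, hc⟩ := ih
      obtain ⟨c', hc'⟩ := hx' (k + 1)
      refine ⟨1, fun _ => rfl, fun j v hv => ?_⟩
      set g := ic x k with hg
      set h := x (k + 1) with hh
      let u := ρ (g⁻¹) (ρ (h⁻¹) v)
      have hu : u ∈ F j := hinv j _ _ (hinv j _ _ hv)
      have hic : ic x (k + 1) = g * h * g⁻¹ * h⁻¹ := rfl
      have e1 : ρ (ic x (k + 1)) v = ρ g (ρ h u) := by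
        rw [hic]; simp [u]
      have e2 : v = ρ h (ρ g u) := by
        show v = ρ h (ρ g (ρ (g⁻¹) (ρ (h⁻¹) v)))
        rw [← Module.End.mul_apply (ρ g), ← map_mul, mul_inv_cancel, map_one, Module.End.one_apply,
          ← Module.End.mul_apply, ← map_mul, mul_inv_cancel, map_one, Module.End.one_apply]
      have e3 : ρ (ic x (k + 1)) v - (1 : E) • v =
          (ρ g (ρ h u - c' • u) - c • (ρ h u - c' • u)) - (ρ h (ρ g u - c • u) - c' • (ρ g u - c • u)) := by
        rw [e1, one_smul]
        conv_lhs => rw [e2]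
        simp only [map_sub, map_smul, smul_sub]
        rw [smul_comm c c']
        abel
      rw [e3]
      apply Submodule.sub_mem
      · have := hc (j - 1) _ (hc' j u hu)
        rwa [show j - (k + 1 + 1) = j - 1 - (k + 1) by omega]
      · have := hc' (j - (k + 1)) _ (hc j u hu)
        rwa [show j - (k + 1 + 1) = j - (k + 1) - 1 by omega]
  obtain ⟨c, hc1, hc⟩ := key D
  apply LinearMap.ext
  intro v
  rcases Nat.eq_zero_or_pos D with h | h
  · have hv : v ∈ (⊥ : Submodule E V) := by
      rw [← h0]; subst h; rw [hD]; trivial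
    rw [Submodule.mem_bot] at hv
    rw [hv, map_zero, map_zero]
  · have := hc D v (by rw [hD]; trivial)
    rw [hc1 h.ne', show D - (D + 1) = 0 by omega, h0, Submodule.mem_bot, one_smul, sub_eq_zero] at this
    exact this

/-- The finiteness hypothesis for absolutely irreducible tame matrix groups. -/
def FinHyp (E : Type) [Field E] (D e m0 I : ℕ) : Prop :=
  ∀ (G : Type) [Group G] (d : ℕ), d ≠ 0 → d ≤ D → ∀ (M : G →* Matrix (Fin d) (Fin d) E) (S : Set G), 1 ∈ S →
    Subgroup.closure S = ⊤ → Submodule.span E (M '' (S ^ (d ^ 2))) = ⊤ → TameM M (S ^ m0) e →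
    ∃ K : Subgroup G, (∀ g ∈ K, ∃ c : E, M g = c • 1) ∧ K.index ≠ 0 ∧ K.index ≤ I

theorem step_data {E G V : Type} [Field E] [IsAlgClosed E] [Group G] [AddCommGroup V] [Module E V] [FiniteDimensional E V]
    (ρ : G →* Module.End E V) (A B : Submodule E V) (hA : Inv ρ A) (hB : Inv ρ B) (hAB : A ≤ B)
    (hirr : ∀ U, Inv ρ U → A ≤ U → U ≤ B → U = A ∨ U = B) {D e m0 I : ℕ} (hD : Module.finrank E V ≤ D)
    (hF : FinHyp E D e m0 I) (hI : 1 ≤ I) (S : Set G) (h1 : 1 ∈ S) (hcl : Subgroup.closure S = ⊤)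
    (ht : ∀ g ∈ S ^ m0, ∀ l u, (ρ g).HasEigenvalue l → (ρ g).HasEigenvalue u → (l / u) ^ e = 1) :
    ∃ d, d ≤ D ∧ ∃ M : G →* Matrix (Fin d) (Fin d) E,
      (∀ g l, (M g).charpoly.IsRoot l → (ρ g).HasEigenvalue l) ∧
      (∀ g (c : E), M g = c • 1 → ∀ x ∈ B, ρ g x - c • x ∈ A) ∧
      ∃ K : Subgroup G, (∀ g ∈ K, ∃ c : E, M g = c • 1) ∧ K.index ≠ 0 ∧ K.index ≤ I := by
  rcases hAB.eq_or_lt with h | h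
  · refine ⟨0, Nat.zero_le _, 1, ?_, ?_, ⊤, fun g _ => ⟨1, Subsingleton.elim _ _⟩, by simp, by simpa using hI⟩
    · intro g l hl
      obtain ⟨v, hv, _⟩ := (isRoot_charpoly_iff _ _).mp hl
      exact absurd (Subsingleton.elim _ _) hv
    · intro g c _ x hx
      rw [h]
      exact B.sub_mem (hB g x hx) (B.smul_mem _ hx)
  · obtain ⟨d, hd0, hd, M, hM1, hM2, hM3⟩ := step_exists ρ A B hA hB h hirr
    refine ⟨d, hd.trans hD, M, hM2, hM3, ?_⟩
    exact hF G d hd0 (hd.trans hD) M S h1 hcl (hM1 S h1 hcl)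
      (fun g hg l u hl hu => ht g hg l u (hM2 g l hl) (hM2 g u hu))

theorem det_pow_of_roots {E : Type} [Field E] [IsAlgClosed E] {d : ℕ} (A : Matrix (Fin d) (Fin d) E) (e : ℕ) (t : E)
    (h : ∀ l, A.charpoly.IsRoot l → l ^ e = t) : A.det ^ e = t ^ d := by
  rw [Matrix.det_eq_prod_roots_charpoly]
  have h0 : A.charpoly.roots.prod ^ e = (A.charpoly.roots.map (fun l => l ^ e)).prod := by
    rw [Multiset.prod_map_pow, Multiset.map_id']
  rw [h0]
  have h1 : A.charpoly.roots.map (fun l => l ^ e) = Multiset.replicate d t := by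
    rw [Multiset.eq_replicate]
    constructor
    · rw [Multiset.card_map, IsAlgClosed.card_roots_eq_natDegree, Matrix.charpoly_natDegree_eq_dim, Fintype.card_fin]
    · intro b hb
      obtain ⟨l, hl, rfl⟩ := Multiset.mem_map.mp hb
      exact h l (Polynomial.mem_roots'.mp hl).2
  rw [h1, Multiset.prod_replicate]

theorem det_rel {E G : Type} [Field E] [IsAlgClosed E] [Group G] {d d' : ℕ} (M : G →* Matrix (Fin d) (Fin d) E)
    (M' : G →* Matrix (Fin d') (Fin d') E) (e : ℕ) (S : Set G) (hcl : Subgroup.closure S = ⊤)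
    (h : ∀ g ∈ S, ∃ t : E, (∀ l, (M g).charpoly.IsRoot l → l ^ e = t) ∧ (∀ l, (M' g).charpoly.IsRoot l → l ^ e = t)) (g : G) :
    (M g).det ^ (e * d') = (M' g).det ^ (e * d) := by
  let f : G →* E := (powMonoidHom (e * d')).comp (Matrix.detMonoidHom.comp M)
  let f' : G →* E := (powMonoidHom (e * d)).comp (Matrix.detMonoidHom.comp M')
  have : f = f' := by
    apply MonoidHom.eq_of_eqOn_dense hcl
    intro g hg
    obtain ⟨t, h1, h2⟩ := h g hg
    show (M g).det ^ (e * d') = (M' g).det ^ (e * d)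
    rw [pow_mul, pow_mul, det_pow_of_roots _ e t h1, det_pow_of_roots _ e t h2, ← pow_mul, ← pow_mul, mul_comm]
  exact DFunLike.congr_fun this g

theorem index_le_of_map {G α : Type} [Group G] (H K : Subgroup G) (hHK : H ≤ K) (N : ℕ) (hK : K.index ≠ 0) (T : Set α) (hT : T.Finite)
    (hTN : T.ncard ≤ N) (f : K → α) (hfT : ∀ k, f k ∈ T) (hf : ∀ k k' : K, f k = f k' → (k : G)⁻¹ * k' ∈ H) :
    H.index ≠ 0 ∧ H.index ≤ N * K.index := by
  have hinj : Function.Injective (fun q : K ⧸ H.subgroupOf K => (⟨f q.out, hfT _⟩ : T)) := by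
    intro q q' h
    have h1 := hf _ _ (congrArg Subtype.val h)
    rw [← q.out_eq', ← q'.out_eq']
    rw [QuotientGroup.eq]
    rw [Subgroup.mem_subgroupOf]
    exact h1
  have : Finite T := hT
  have h1 : H.relIndex K ≤ N := by
    refine le_trans ?_ hTN
    exact Nat.card_le_card_of_injective _ hinj
  have h2 : H.relIndex K ≠ 0 := by
    have : Finite (K ⧸ H.subgroupOf K) := Finite.of_injective _ hinj
    exact Nat.card_pos.ne'
  rw [← Subgroup.relIndex_mul_index hHK]
  exact ⟨mul_ne_zero h2 hK, Nat.mul_le_mul_right _ h1⟩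

theorem TAME (E : Type) [Field E] [IsAlgClosed E] (D e m0 I : ℕ) (he : e ≠ 0) (hm0 : 1 ≤ m0) (hF : FinHyp E D e m0 I) :
    ∃ I', ∀ (G : Type) [Group G] (V : Type) [AddCommGroup V] [Module E V] [FiniteDimensional E V] (ρ : G →* Module.End E V) (S : Set G),
      Module.finrank E V ≤ D → 1 ∈ S → Subgroup.closure S = ⊤ →
      (∀ g ∈ S ^ m0, ∀ l u, (ρ g).HasEigenvalue l → (ρ g).HasEigenvalue u → (l / u) ^ e = 1) →
      ∃ H : Subgroup G, H.index ≠ 0 ∧ H.index ≤ I' ∧ ∀ x : ℕ → G, (∀ i, x i ∈ H) → ρ (ic x D) = 1 := by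
  let P := D.factorial * D.factorial * e
  have hP : P ≠ 0 := mul_ne_zero (mul_ne_zero D.factorial_ne_zero D.factorial_ne_zero) he
  refine ⟨P ^ D * (I + 1) ^ D, ?_⟩
  intro G _ V _ _ _ ρ S hD h1 hcl ht
  obtain ⟨F, hF0, hFD, hFinv, hFm, hFirr⟩ := exists_flag ρ D hD
  have hF' : FinHyp E D e m0 (I + 1) := fun G _ d h1 h2 M S h3 h4 h5 h6 => by
    obtain ⟨K, a, b, c⟩ := hF G d h1 h2 M S h3 h4 h5 h6
    exact ⟨K, a, b, c.trans (Nat.le_succ _)⟩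
  choose d hd M hMe hMs K hK1 hK2 hK3 using fun j : Fin D =>
    step_data ρ (F j) (F (j + 1)) (hFinv _) (hFinv _) (hFm (Nat.le_succ _)) (hFirr j) hD hF' (Nat.le_add_left _ _) S h1 hcl ht
  have hScl : ∀ g ∈ S, g ∈ S ^ m0 := fun g hg => mem_pow_mono h1 hm0 (by rwa [pow_one])
  have hpow : ∀ g ∈ S, ∃ t : E, ∀ l, (ρ g).HasEigenvalue l → l ^ e = t := by
    intro g hg
    by_cases hex : ∃ u, (ρ g).HasEigenvalue u
    · obtain ⟨u, hu⟩ := hex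
      refine ⟨u ^ e, fun l hl => ?_⟩
      have := ht g (hScl g hg) l u hl hu
      rw [div_pow] at this
      exact eq_of_div_eq_one this
    · exact ⟨1, fun l hl => absurd ⟨l, hl⟩ hex⟩
  have hrel : ∀ i j g, (M i g).det ^ (e * d j) = (M j g).det ^ (e * d i) := by
    intro i j g
    apply det_rel (M i) (M j) e S hcl
    intro g hg
    obtain ⟨t, h⟩ := hpow g hg
    exact ⟨t, fun l hl => h l (hMe i g l hl), fun l hl => h l (hMe j g l hl)⟩
  let KK : Subgroup G := ⨅ j, K j
  have hKK0 : KK.index ≠ 0 := Subgroup.index_iInf_ne_zero hK2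
  have hKKle : KK.index ≤ (I + 1) ^ D := by
    refine (Subgroup.index_iInf_le _).trans ?_
    refine (Finset.prod_le_pow_card _ _ (I + 1) fun j _ => hK3 j).trans ?_
    simp
  have hnz : ∀ j, d j ≠ 0 → ∀ g (c : E), M j g = c • 1 → c ≠ 0 := by
    intro j hj g c hg hc
    have : Nonempty (Fin (d j)) := ⟨⟨0, Nat.pos_of_ne_zero hj⟩⟩
    have : M j (g * g⁻¹) = 0 := by rw [map_mul, hg, hc, zero_smul, zero_mul]
    rw [mul_inv_cancel, map_one] at this
    exact one_ne_zero this
  have hsc : ∀ k : KK, ∃ c : Fin D → E, (∀ j, M j k = c j • 1) ∧ (∀ j, c j ≠ 0) ∧ ∀ i j, (c i) ^ P = (c j) ^ P := by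
    intro k
    have hk : ∀ j, (k : G) ∈ K j := fun j => Subgroup.mem_iInf.mp k.2 j
    choose c0 hc0 using fun j => hK1 j k (hk j)
    by_cases hex : ∃ j0, d j0 ≠ 0
    · obtain ⟨j0, hj0⟩ := hex
      have hP2 : ∀ i j, d i ≠ 0 → d j ≠ 0 → c0 i ^ P = c0 j ^ P := by
        intro i j hi hj
        have h := hrel i j k
        rw [hc0 i, hc0 j, Matrix.det_smul, Matrix.det_smul, Matrix.det_one, Matrix.det_one, mul_one, mul_one,
          Fintype.card_fin, Fintype.card_fin, ← pow_mul, ← pow_mul] at h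
        have hdvd : e * d j * d i ∣ P := by
          have h1 : d i ∣ D.factorial := Nat.dvd_factorial (Nat.pos_of_ne_zero hi) (hd i)
          have h2 : d j ∣ D.factorial := Nat.dvd_factorial (Nat.pos_of_ne_zero hj) (hd j)
          have := Nat.mul_dvd_mul (Nat.mul_dvd_mul h1 h2) (dvd_refl e)
          convert this using 1; ring
        obtain ⟨q, hq⟩ := hdvd
        rw [show d i * (e * d j) = e * d j * d i by ring, show d j * (e * d i) = e * d j * d i by ring] at h
        rw [hq, pow_mul, h, ← pow_mul]
      refine ⟨fun j => if d j = 0 then c0 j0 else c0 j, ?_, ?_, ?_⟩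
      · intro j
        by_cases hj : d j = 0
        · have : IsEmpty (Fin (d j)) := by rw [hj]; infer_instance
          exact Subsingleton.elim _ _
        · simp only [hj, if_false]; exact hc0 j
      · intro j
        by_cases hj : d j = 0
        · simp only [hj, if_true]; exact hnz j0 hj0 _ _ (hc0 j0)
        · simp only [hj, if_false]; exact hnz j hj _ _ (hc0 j)
      · intro i j
        dsimp only
        split_ifs with h1 h2 h2
        · rfl
        · exact hP2 _ _ hj0 h2
        · exact hP2 _ _ h1 hj0
        · exact hP2 _ _ h1 h2
    · push Not at hex
      refine ⟨fun _ => 1, fun j => ?_, fun _ => one_ne_zero, fun _ _ => rfl⟩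
      have : IsEmpty (Fin (d j)) := by rw [hex j]; infer_instance
      exact Subsingleton.elim _ _
  choose c hc1 hc2 hc3 using hsc
  have hinvM : ∀ j g (a : E), a ≠ 0 → M j g = a • 1 → M j g⁻¹ = a⁻¹ • 1 := by
    intro j g a ha hg
    have : M j g⁻¹ = a⁻¹ • (M j g * M j g⁻¹) := by
      rw [hg, smul_mul_assoc, one_mul, smul_smul, inv_mul_cancel₀ ha, one_smul]
    rw [this, ← map_mul, mul_inv_cancel, map_one]
  let H : Subgroup G :=
    { carrier := {g | g ∈ KK ∧ ∃ a : E, a ≠ 0 ∧ ∀ j, M j g = a • 1}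
      one_mem' := ⟨KK.one_mem, 1, one_ne_zero, fun j => by rw [map_one, one_smul]⟩
      mul_mem' := by
        rintro g h ⟨hg, a, ha, hg2⟩ ⟨hh, b, hb, hh2⟩
        refine ⟨KK.mul_mem hg hh, a * b, mul_ne_zero ha hb, fun j => ?_⟩
        rw [map_mul, hg2, hh2, smul_mul_smul_comm, one_mul]
      inv_mem' := by
        rintro g ⟨hg, a, ha, hg2⟩
        exact ⟨KK.inv_mem hg, a⁻¹, inv_ne_zero ha, fun j => hinvM j g a ha (hg2 j)⟩ }
  have hidx : H.index ≠ 0 ∧ H.index ≤ P ^ D * KK.index := by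
    rcases Nat.eq_zero_or_pos D with hD0 | hDpos
    · have : H = KK := by
        apply le_antisymm (fun g hg => hg.1)
        intro g hg
        exact ⟨hg, 1, one_ne_zero, fun j => by exfalso; have := j.2; omega⟩
      rw [this, hD0, pow_zero, one_mul]; exact ⟨hKK0, le_rfl⟩
    · let j0 : Fin D := ⟨0, hDpos⟩
      obtain ⟨hfin, hcard⟩ := mu_card E P (Nat.pos_of_ne_zero hP)
      have : Finite {z : E | z ^ P = 1} := hfin
      refine index_le_of_map H KK (fun g hg => hg.1) _ hKK0 (Set.univ : Set (Fin D → {z : E | z ^ P = 1})) Set.finite_univ ?_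
        (fun k j => ⟨c k j / c k j0, ?_⟩) (fun _ => trivial) ?_
      · rw [Set.ncard_univ, Nat.card_fun, Nat.card_fin]
        exact Nat.pow_le_pow_left hcard D
      · show (c k j / c k j0) ^ P = 1
        rw [div_pow, hc3 k j j0, div_self (pow_ne_zero _ (hc2 k j0))]
      · intro k k' h
        refine ⟨KK.mul_mem (KK.inv_mem k.2) k'.2, (c k j0)⁻¹ * c k' j0, mul_ne_zero (inv_ne_zero (hc2 _ _)) (hc2 _ _), fun j => ?_⟩
        rw [map_mul, hinvM j _ _ (hc2 k j) (hc1 k j), hc1 k' j, smul_mul_smul_comm, one_mul]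
        congr 1
        have h : c k j / c k j0 = c k' j / c k' j0 := congrArg Subtype.val (congrFun h j)
        have a1 := hc2 k j
        have a2 := hc2 k j0
        have a3 := hc2 k' j0
        rw [div_eq_div_iff a2 a3] at h
        field_simp
        rw [h, mul_comm]
  refine ⟨H, hidx.1, hidx.2.trans (Nat.mul_le_mul_left _ hKKle), ?_⟩
  intro x hx
  apply flag_ic ρ D F hF0 hFD hFinv hFm x
  intro i
  obtain ⟨_, a, _, ha⟩ := hx i
  exact ⟨a, fun j hj v hv => hMs ⟨j, hj⟩ (x i) a (ha ⟨j, hj⟩) v hv⟩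

end UPI
end

section
open Pointwise

namespace UPI

theorem FreePair.map_inj {M N : Type*} [Monoid M] [Monoid N] (φ : M →* N) (hφ : Function.Injective φ) {a b : M}
    (h : FreePair a b) : FreePair (φ a) (φ b) := by
  have e : (FreeMonoid.lift ![φ a, φ b] : FreeMonoid (Fin 2) →* N)
      = φ.comp (FreeMonoid.lift ![a, b]) := by
    ext i; fin_cases i <;> simp
  unfold FreePair
  rw [e]
  exact hφ.comp h

/-- dichotomy for eigenvalue ratios -/
def BTH {E G V : Type} [Field E] [Group G] [AddCommGroup V] [Module E V] (ρ : G →* Module.End E V) (e : ℕ) (ε : ℝ) : Prop :=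
  ∀ g l u, (ρ g).HasEigenvalue l → (ρ g).HasEigenvalue u → (l / u) ^ e = 1 ∨ ∃ w : AbsoluteValue E ℝ, (1 + ε) * w u ≤ w l

/-- conclusion of the main proposition -/
def Concl {E G V : Type} [Field E] [Group G] [AddCommGroup V] [Module E V] (ρ : G →* Module.End E V) (D I : ℕ) : Prop :=
  ∃ H : Subgroup G, H.index ≠ 0 ∧ H.index ≤ I ∧ ∀ x : ℕ → G, (∀ i, x i ∈ H) → ρ (ic x D) = 1

/-- the submodule action -/
@[reducible] def subAct {E G V : Type} [Field E] [Group G] [AddCommGroup V] [Module E V] (ρ : G →* Module.End E V) :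
    MulAction G (Submodule E V) where
  smul g W := W.map (ρ g)
  one_smul W := by
    show W.map (ρ 1) = W
    rw [map_one]; exact Submodule.map_id W
  mul_smul g h W := by
    show W.map (ρ (g * h)) = (W.map (ρ h)).map (ρ g)
    rw [map_mul, ← Submodule.map_comp]; rfl

theorem comap_eq_map_inv {E G V : Type} [Field E] [Group G] [AddCommGroup V] [Module E V] (ρ : G →* Module.End E V) (W : Submodule E V) (g : G) :
    W.comap (ρ g⁻¹) = W.map (ρ g) := by
  ext x
  constructor
  · intro hx
    refine ⟨ρ g⁻¹ x, hx, ?_⟩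
    rw [← Module.End.mul_apply, ← map_mul, mul_inv_cancel, map_one]; rfl
  · rintro ⟨y, hy, rfl⟩
    show ρ g⁻¹ (ρ g y) ∈ W
    rw [← Module.End.mul_apply, ← map_mul, inv_mul_cancel, map_one]; exact hy

theorem restrict_rep {E G V : Type} [Field E] [Group G] [AddCommGroup V] [Module E V] (ρ : G →* Module.End E V)
    (U : Submodule E V) (hU : Inv ρ U) : ∃ r : G →* Module.End E U, ∀ g (u : U), ((r g u : U) : V) = ρ g u :=
  ⟨{ toFun := fun g => (ρ g).restrict (fun x hx => hU g x hx)
     map_one' := by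
      apply LinearMap.ext; intro q
      apply Subtype.ext
      show ρ 1 (q : V) = q
      simp
     map_mul' := by
      intro g h
      apply LinearMap.ext; intro q
      apply Subtype.ext
      show ρ (g * h) (q : V) = ρ g (ρ h q)
      simp }, fun _ _ => rfl⟩

theorem restrict_BTH {E G V : Type} [Field E] [Group G] [AddCommGroup V] [Module E V] (ρ : G →* Module.End E V)
    (H : Subgroup G) (U : Submodule E V) (r : H →* Module.End E U) (hr : ∀ g (u : U), ((r g u : U) : V) = ρ g u) (e : ℕ) (ε : ℝ)
    (h : BTH ρ e ε) : BTH r e ε := by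
  have key : ∀ g l, (r g).HasEigenvalue l → (ρ g).HasEigenvalue l := by
    intro g l hl
    obtain ⟨v, hv⟩ := hl.exists_hasEigenvector
    refine Module.End.hasEigenvalue_of_hasEigenvector (x := (v : V)) ⟨?_, ?_⟩
    · rw [Module.End.mem_eigenspace_iff, ← hr, hv.apply_eq_smul]; rfl
    · intro h0; exact hv.2 (Subtype.ext h0)
  intro g l u hl hu
  exact h g l u (key g l hl) (key g u hu)

theorem MAIN (D m0 : ℕ) (ε : ℝ) (hε : 0 < ε) (hm0 : 1 ≤ m0) (δ : ℕ) : δ ≤ D → ∃ m : ℕ, ∀ (E : Type) [Field E] [IsAlgClosed E] (e I : ℕ), e ≠ 0 →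
    FinHyp E D e m0 I → ∃ I', ∀ (G : Type) [Group G] (V : Type) [AddCommGroup V] [Module E V] [FiniteDimensional E V]
      (ρ : G →* Module.End E V) (S : Set G), Module.finrank E V ≤ δ → BTH ρ e ε → S.Finite → 1 ∈ S → Subgroup.closure S = ⊤ →
      (¬ ∃ a ∈ S ^ m, ∃ b ∈ S ^ m, FreePair a b) → Concl ρ D I' := by
  induction δ with
  | zero =>
    intro _
    refine ⟨0, ?_⟩
    intro E _ _ e I _ _
    refine ⟨1, ?_⟩
    intro G _ V _ _ _ ρ S hfr _ _ _ _ _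
    have : Subsingleton V := Module.finrank_zero_iff.mp (Nat.le_zero.mp hfr)
    exact ⟨⊤, by simp, by simp, fun x _ => LinearMap.ext fun v => Subsingleton.elim _ _⟩
  | succ δ ih =>
    intro hδ
    obtain ⟨m, hm⟩ := ih (by omega)
    obtain ⟨k, hk⟩ := T1rep (δ + 1) m0 ε hε
    set N := (δ + 1) ^ (δ + 1) with hN
    set c1 := 2 * (N * N) + 1 with hc1
    refine ⟨k + c1 * m, ?_⟩
    intro E _ _ e I he hF
    obtain ⟨I1, hI1⟩ := hm E e I he hF
    obtain ⟨I2, hI2⟩ := TAME E D e m0 I he hm0 hF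
    refine ⟨I1 + I2 + I1 * I1 * (N * N), ?_⟩
    intro G _ V _ _ _ ρ S hfr hBT hS h1 hcl hno
    have hno_of : ∀ j ≤ k + c1 * m, ¬ ∃ a ∈ S ^ j, ∃ b ∈ S ^ j, FreePair a b := by
      rintro j hj ⟨a, ha, b, hb, hab⟩
      exact hno ⟨a, mem_pow_mono h1 hj ha, b, mem_pow_mono h1 hj hb, hab⟩
    rcases Nat.lt_or_ge (Module.finrank E V) (δ + 1) with hlt | hge
    · obtain ⟨H, a, b, c⟩ := hI1 G V ρ S (by omega) hBT hS h1 hcl (hno_of m (by rw [hc1]; nlinarith [Nat.zero_le (N * N * m)]))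
      exact ⟨H, a, b.trans (by rw [add_assoc]; exact Nat.le_add_right _ _), c⟩
    have hfr' : Module.finrank E V = δ + 1 := le_antisymm hfr hge
    by_cases htame : ∀ g ∈ S ^ m0, ∀ l u, (ρ g).HasEigenvalue l → (ρ g).HasEigenvalue u → (l / u) ^ e = 1
    · obtain ⟨H, a, b, c⟩ := hI2 G V ρ S (by omega) h1 hcl htame
      exact ⟨H, a, b.trans ((Nat.le_add_left _ _).trans (Nat.le_add_right _ _)), c⟩
    push Not at htame
    obtain ⟨g, hg, l, u, hl, hu, hlu⟩ := htame
    obtain ⟨w, hw⟩ := (hBT g l u hl hu).resolve_left hlu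
    rcases hk E G V hfr' ρ S hS h1 ⟨w, g, hg, l, u, hl, hu, hw⟩ with hfp | ⟨U, U', hcompl, hU, hU', hp1, hp2⟩
    · exact absurd hfp (hno_of k (Nat.le_add_right _ _))
    let _ := subAct ρ
    have hst1 := orbit_index S hS h1 hcl U N hp1
    have hst2 := orbit_index S⁻¹ hS.inv (by rwa [Set.mem_inv, inv_one]) (by rw [Subgroup.closure_inv]; exact hcl) U' N (by
      intro h hh
      obtain ⟨i, i', hii, heq⟩ := hp2 (fun i => (h i)⁻¹) (fun i => by
        have := hh i
        rw [inv_pow, Set.mem_inv] at this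
        exact this)
      refine ⟨i, i', hii, ?_⟩
      rw [comap_eq_map_inv, comap_eq_map_inv] at heq
      exact heq)
    let H1 : Subgroup G := MulAction.stabilizer G U ⊓ MulAction.stabilizer G U'
    have hH10 : H1.index ≠ 0 := Subgroup.index_inf_ne_zero hst1.1 hst2.1
    have hH1 : H1.index ≤ N * N := (Subgroup.index_inf_le).trans (Nat.mul_le_mul hst1.2 hst2.2)
    let S1 : Set H1 := {h : H1 | (h : G) ∈ S ^ c1}
    have hS1cl : Subgroup.closure S1 = ⊤ := schreier S hS h1 hcl H1 (N * N) hH10 hH1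
    have hS1fin : S1.Finite := (set_pow_finite hS c1).preimage Subtype.val_injective.injOn
    have h1S1 : (1 : H1) ∈ S1 := mem_pow_mono h1 (Nat.zero_le _) (by rw [pow_zero]; rfl)
    have hpowS1 : ∀ a ∈ S1 ^ m, (a : G) ∈ S ^ (c1 * m) := by
      intro a ha
      have h2 : H1.subtype a ∈ H1.subtype '' (S1 ^ m) := ⟨a, ha, rfl⟩
      rw [Set.image_pow] at h2
      have h3 : H1.subtype '' S1 ⊆ S ^ c1 := by rintro _ ⟨b, hb, rfl⟩; exact hb
      rw [pow_mul]
      exact Set.pow_subset_pow_left h3 h2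
    have hnoS1 : ¬ ∃ a ∈ S1 ^ m, ∃ b ∈ S1 ^ m, FreePair a b := by
      rintro ⟨a, ha, b, hb, hab⟩
      exact hno_of (c1 * m) (Nat.le_add_left _ _) ⟨a, hpowS1 a ha, b, hpowS1 b hb, hab.map_inj H1.subtype H1.subtype_injective⟩
    have hInvU : Inv (ρ.comp H1.subtype) U := by
      intro h u hu
      have : U.map (ρ h) = U := h.2.1
      show ρ h u ∈ U
      rw [← this]; exact ⟨u, hu, rfl⟩
    have hInvU' : Inv (ρ.comp H1.subtype) U' := by
      intro h u hu
      have : U'.map (ρ h) = U' := h.2.2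
      show ρ h u ∈ U'
      rw [← this]; exact ⟨u, hu, rfl⟩
    obtain ⟨r, hr⟩ := restrict_rep _ U hInvU
    obtain ⟨r', hr'⟩ := restrict_rep _ U' hInvU'
    have hUt : U ≠ ⊤ := by
      rintro rfl
      exact hU' (by simpa using hcompl.inf_eq_bot)
    have hUt' : U' ≠ ⊤ := by
      rintro rfl
      exact hU (by simpa using hcompl.inf_eq_bot)
    obtain ⟨HU, a1, a2, a3⟩ := hI1 H1 U r S1 (by have := Submodule.finrank_lt hUt; omega)
      (restrict_BTH ρ H1 U r hr e ε hBT) hS1fin h1S1 hS1cl hnoS1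
    obtain ⟨HU', b1, b2, b3⟩ := hI1 H1 U' r' S1 (by have := Submodule.finrank_lt hUt'; omega)
      (restrict_BTH ρ H1 U' r' hr' e ε hBT) hS1fin h1S1 hS1cl hnoS1
    refine ⟨(HU ⊓ HU').map H1.subtype, ?_, ?_, ?_⟩
    · rw [Subgroup.index_map_subtype]
      exact mul_ne_zero (Subgroup.index_inf_ne_zero a1 b1) hH10
    · rw [Subgroup.index_map_subtype]
      refine le_trans ?_ (Nat.le_add_left _ _)
      exact Nat.mul_le_mul ((Subgroup.index_inf_le).trans (Nat.mul_le_mul a2 b2)) hH1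
    · intro x hx
      choose y hy hyx using hx
      have hxy : ic x D = H1.subtype (ic y D) := by
        rw [ic_map]
        congr 1
        funext i; exact (hyx i).symm
      have e1 := a3 y (fun i => (hy i).1)
      have e2 := b3 y (fun i => (hy i).2)
      apply LinearMap.ext
      intro v
      obtain ⟨p, hp, q, hq, rfl⟩ := Submodule.mem_sup.mp (show v ∈ U ⊔ U' by rw [hcompl.sup_eq_top]; trivial)
      have f1 := hr (ic y D) ⟨p, hp⟩
      have f2 := hr' (ic y D) ⟨q, hq⟩
      rw [e1] at f1
      rw [e2] at f2
      rw [map_add, hxy]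
      have f1' : p = ρ (H1.subtype (ic y D)) p := f1
      have f2' : q = ρ (H1.subtype (ic y D)) q := f2
      rw [← f1', ← f2']; rfl

end UPI
end

section
open Pointwise

namespace UPI

theorem absval_pow {E : Type} [Field E] (w : AbsoluteValue E ℝ) (hna : ∀ x y, w (x + y) ≤ max (w x) (w y)) (μ : E) (h : 1 < w μ) :
    ∃ w' : AbsoluteValue E ℝ, 2 ≤ w' μ := by
  obtain ⟨k, hk⟩ := pow_unbounded_of_one_lt 2 h
  have hk0 : k ≠ 0 := by rintro rfl; norm_num at hk
  refine ⟨{ toFun := fun x => w x ^ k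
            map_mul' := fun x y => by rw [map_mul, mul_pow]
            nonneg' := fun x => pow_nonneg (w.nonneg x) k
            eq_zero' := fun x => by rw [pow_eq_zero_iff hk0, w.eq_zero]
            add_le' := fun x y => ?_ }, hk.le⟩
  calc w (x + y) ^ k ≤ (max (w x) (w y)) ^ k := pow_le_pow_left₀ (w.nonneg _) (hna x y) k
    _ ≤ w x ^ k + w y ^ k := by
      rcases max_choice (w x) (w y) with h | h <;> rw [h]
      · linarith [pow_nonneg (w.nonneg y) k]
      · linarith [pow_nonneg (w.nonneg x) k]

/-- pull back of a norm -/
noncomputable def pullAbs {E Ω : Type} [Field E] [NormedField Ω] (φ : E →+* Ω) : AbsoluteValue E ℝ where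
  toFun x := ‖φ x‖
  map_mul' x y := by rw [map_mul, norm_mul]
  nonneg' x := norm_nonneg _
  eq_zero' x := by rw [norm_eq_zero, map_eq_zero]
  add_le' x y := by rw [map_add]; exact norm_add_le _ _

instance algQ : Algebra.IsAlgebraic ℚ (AlgebraicClosure ℚ) := by
  constructor
  intro x
  obtain ⟨p, hp, h⟩ := (AlgebraicClosure.isAlgebraic ℚ).isAlgebraic x
  refine ⟨p, hp, ?_⟩
  rw [Polynomial.aeval_def] at h ⊢
  convert h using 2
  exact RingHom.ext_rat _ _

instance intQ : Algebra.IsIntegral ℚ (AlgebraicClosure ℚ) := ⟨fun x => (algQ.isAlgebraic x).isIntegral⟩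

theorem rat_int_of_padic (c : ℚ) (h : ∀ (p : ℕ) [Fact p.Prime], ‖(c : ℚ_[p])‖ ≤ 1) : c ∈ Set.range (algebraMap ℤ ℚ) := by
  have : c.den = 1 := by
    by_contra hne
    obtain ⟨p, hp, hpd⟩ := Nat.exists_prime_and_dvd hne
    have : Fact p.Prime := ⟨hp⟩
    have h2 := h p
    rw [Padic.norm_rat_le_one_iff_padicValuation_le_one, Rat.padicValuation_le_one_iff] at h2
    exact h2 hpd
  refine ⟨c.num, ?_⟩
  rw [eq_intCast]
  exact Rat.coe_int_num_of_den_eq_one this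

theorem nonint_abs (μ : AlgebraicClosure ℚ) (hμ : ¬ IsIntegral ℤ μ) : ∃ w : AbsoluteValue (AlgebraicClosure ℚ) ℝ, 2 ≤ w μ := by
  suffices h : ∃ (p : ℕ) (_ : Fact p.Prime) (φ : AlgebraicClosure ℚ →ₐ[ℚ] PadicAlgCl p), 1 < ‖φ μ‖ by
    obtain ⟨p, hp, φ, hφ⟩ := h
    refine absval_pow (pullAbs (φ : AlgebraicClosure ℚ →+* PadicAlgCl p)) ?_ μ hφ
    intro x y
    show ‖φ (x + y)‖ ≤ max ‖φ x‖ ‖φ y‖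
    rw [map_add]
    exact PadicAlgCl.isNonarchimedean p _ _
  by_contra hcon
  push Not at hcon
  apply hμ
  have hcoef : ∀ n, (minpoly ℚ μ).coeff n ∈ Set.range (algebraMap ℤ ℚ) := by
    intro n
    apply rat_int_of_padic
    intro p hp
    let O : Subring (PadicAlgCl p) := (NormedField.valuation (K := PadicAlgCl p)).integer
    have hO : ∀ x, x ∈ O ↔ ‖x‖ ≤ 1 := by
      intro x
      rw [Valuation.mem_integer_iff, NormedField.valuation_apply]
      exact NNReal.coe_le_coe.symm
    let f : Polynomial (PadicAlgCl p) := (minpoly ℚ μ).map (algebraMap ℚ (PadicAlgCl p))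
    have hmon : f.Monic := (minpoly.monic (Algebra.IsIntegral.isIntegral μ)).map _
    have hf : f = (f.roots.map (fun a => Polynomial.X - Polynomial.C a)).prod :=
      (IsAlgClosed.splits f).eq_prod_roots_of_monic hmon
    have hlift : f ∈ Polynomial.lifts O.subtype := by
      rw [hf]
      apply Subsemiring.multiset_prod_mem
      intro q hq
      obtain ⟨z, hz, rfl⟩ := Multiset.mem_map.mp hq
      have hz' : z ∈ (minpoly ℚ μ).rootSet (PadicAlgCl p) := by
        rw [Polynomial.mem_rootSet']
        have := Polynomial.mem_roots'.mp hz
        exact ⟨this.1, by rw [← Polynomial.eval_map_algebraMap]; exact this.2⟩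
      rw [← Algebra.IsAlgebraic.range_eval_eq_rootSet_minpoly] at hz'
      obtain ⟨φ, hφ⟩ := hz'
      have hzO : z ∈ O := by rw [hO, ← hφ]; exact hcon p hp φ
      refine ⟨Polynomial.X - Polynomial.C ⟨z, hzO⟩, ?_⟩
      simp
    rw [Polynomial.lifts_iff_coeff_lifts] at hlift
    obtain ⟨y, hy⟩ := hlift n
    have h1 : ‖f.coeff n‖ ≤ 1 := by
      rw [← hy, ← hO]; exact y.2
    rw [Polynomial.coeff_map, IsScalarTower.algebraMap_apply ℚ ℚ_[p] (PadicAlgCl p)] at h1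
    rw [← PadicAlgCl.norm_extends]
    exact h1
  obtain ⟨q, hq⟩ := (Polynomial.mem_lifts _).mp ((Polynomial.lifts_iff_coeff_lifts _).mpr hcoef)
  have hqm : q.Monic := by
    apply Polynomial.monic_of_injective (algebraMap ℤ ℚ).injective_int
    rw [hq]; exact minpoly.monic (Algebra.IsIntegral.isIntegral μ)
  refine ⟨q, hqm, ?_⟩
  have := minpoly.aeval ℚ μ
  rw [← hq, Polynomial.aeval_map_algebraMap] at this
  exact this

theorem int_roots (μ : AlgebraicClosure ℚ) (hμ : IsIntegral ℤ μ) (z : ℂ) (hz : z ∈ ((minpoly ℤ μ).map (Int.castRingHom ℂ)).roots) :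
    ∃ φ : AlgebraicClosure ℚ →ₐ[ℚ] ℂ, φ μ = z := by
  have h := minpoly.isIntegrallyClosed_eq_field_fractions' ℚ hμ
  have hz' : z ∈ (minpoly ℚ μ).rootSet ℂ := by
    rw [Polynomial.mem_rootSet']
    have := Polynomial.mem_roots'.mp hz
    rw [h, Polynomial.map_map]
    have hc : (algebraMap ℚ ℂ).comp (algebraMap ℤ ℚ) = Int.castRingHom ℂ := RingHom.ext_int _ _
    refine ⟨by rw [hc]; exact this.1, ?_⟩
    rw [Polynomial.aeval_map_algebraMap, ← Polynomial.eval_map_algebraMap]; exact this.2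
  rw [← Algebra.IsAlgebraic.range_eval_eq_rootSet_minpoly] at hz'
  exact hz'

theorem mahler_le (μ : AlgebraicClosure ℚ) (hμ : IsIntegral ℤ μ) (R : ℝ) (hR : 1 ≤ R)
    (h : ∀ φ : AlgebraicClosure ℚ →ₐ[ℚ] ℂ, ‖φ μ‖ ≤ R) :
    ((minpoly ℤ μ).map (Int.castRingHom ℂ)).mahlerMeasure ≤ R ^ (minpoly ℤ μ).natDegree := by
  have hm : ((minpoly ℤ μ).map (Int.castRingHom ℂ)).Monic := (minpoly.monic hμ).map _
  rw [Polynomial.mahlerMeasure_eq_leadingCoeff_mul_prod_roots, hm.leadingCoeff, norm_one, one_mul]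
  have hc : ((minpoly ℤ μ).map (Int.castRingHom ℂ)).roots.card ≤ (minpoly ℤ μ).natDegree :=
    (Polynomial.card_roots' _).trans (Polynomial.natDegree_map_le)
  refine le_trans ?_ (pow_le_pow_right₀ hR hc)
  have hb : ∀ z ∈ ((minpoly ℤ μ).map (Int.castRingHom ℂ)).roots, max 1 ‖z‖ ≤ R := by
    intro z hz
    obtain ⟨φ, rfl⟩ := int_roots μ hμ z hz
    exact max_le hR (h φ)
  revert hb
  generalize ((minpoly ℤ μ).map (Int.castRingHom ℂ)).roots = s
  induction s using Multiset.induction_on with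
  | empty => intro _; simp
  | cons a s ih =>
    intro hb
    rw [Multiset.map_cons, Multiset.prod_cons, Multiset.card_cons, pow_succ']
    apply mul_le_mul (hb a (Multiset.mem_cons_self _ _)) (ih fun z hz => hb z (Multiset.mem_cons_of_mem hz))
    · apply Multiset.prod_nonneg
      intro y hy
      obtain ⟨z, _, rfl⟩ := Multiset.mem_map.mp hy
      exact zero_le_one.trans (le_max_left _ _)
    · linarith

theorem arch_dichotomy (μ : AlgebraicClosure ℚ) (h0 : μ ≠ 0) (hμ : IsIntegral ℤ μ) :
    (∃ n, n ≠ 0 ∧ μ ^ n = 1) ∨ ∃ φ : AlgebraicClosure ℚ →ₐ[ℚ] ℂ, 1 < ‖φ μ‖ := by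
  by_contra hcon
  push Not at hcon
  obtain ⟨hn, hφ⟩ := hcon
  have h1 := mahler_le μ hμ 1 le_rfl hφ
  rw [one_pow] at h1
  have hne : minpoly ℤ μ ≠ 0 := (minpoly.monic hμ).ne_zero
  have h2 : ((minpoly ℤ μ).map (Int.castRingHom ℂ)).mahlerMeasure = 1 :=
    le_antisymm h1 (Polynomial.one_le_mahlerMeasure_of_ne_zero hne)
  let φ : AlgebraicClosure ℚ →ₐ[ℚ] ℂ := IsAlgClosed.lift
  obtain ⟨n, hn0, hn1⟩ := Polynomial.pow_eq_one_of_mahlerMeasure_eq_one h2 (z := φ μ)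
    ((map_ne_zero φ).mpr h0) (by
      rw [Polynomial.mem_aroots]
      refine ⟨hne, ?_⟩
      have : Polynomial.aeval ((φ.restrictScalars ℤ) μ) (minpoly ℤ μ) = 0 := by
        rw [Polynomial.aeval_algHom_apply, minpoly.aeval, map_zero]
      exact this)
  apply hn n hn0.ne'
  apply (φ : AlgebraicClosure ℚ →+* ℂ).injective
  simpa using hn1

theorem BTQ (B : ℕ) : ∃ e : ℕ, e ≠ 0 ∧ ∃ ε : ℝ, 0 < ε ∧ ∀ μ : AlgebraicClosure ℚ, μ ≠ 0 → (minpoly ℚ μ).natDegree ≤ B →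
    μ ^ e = 1 ∨ ∃ w : AbsoluteValue (AlgebraicClosure ℚ) ℝ, 1 + ε ≤ w μ := by
  classical
  have hfin := Polynomial.finite_mahlerMeasure_le B (2 ^ B)
  let T : Set (AlgebraicClosure ℚ) := {μ | μ ≠ 0 ∧ IsIntegral ℤ μ ∧ minpoly ℤ μ ∈
    {p : Polynomial ℤ | p.natDegree ≤ B ∧ (p.map (Int.castRingHom ℂ)).mahlerMeasure ≤ ((2 ^ B : NNReal) : ℝ)}}
  have hT : T.Finite := by
    refine (hfin.biUnion (t := fun p => p.rootSet (AlgebraicClosure ℚ)) fun p _ => Polynomial.rootSet_finite _ _).subset ?_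
    rintro μ ⟨_, hμ, hμ2⟩
    refine Set.mem_biUnion hμ2 ?_
    rw [Polynomial.mem_rootSet']
    refine ⟨((minpoly.monic hμ).map _).ne_zero, minpoly.aeval _ _⟩
  have key : ∀ μ : T, ∃ e : ℕ, e ≠ 0 ∧ ∃ ε : ℝ, 0 < ε ∧
      ((μ : AlgebraicClosure ℚ) ^ e = 1 ∨ ∃ w : AbsoluteValue (AlgebraicClosure ℚ) ℝ, 1 + ε ≤ w μ) := by
    rintro ⟨μ, h0, hμ, _⟩
    rcases arch_dichotomy μ h0 hμ with ⟨n, hn, h⟩ | ⟨φ, h⟩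
    · exact ⟨n, hn, 1, one_pos, Or.inl h⟩
    · refine ⟨1, one_ne_zero, ‖φ μ‖ - 1, by linarith, Or.inr ⟨pullAbs (φ : AlgebraicClosure ℚ →+* ℂ), ?_⟩⟩
      show 1 + (‖φ μ‖ - 1) ≤ ‖φ μ‖
      linarith
  choose e he ε hε hor using key
  have : Fintype T := hT.fintype
  obtain ⟨ε0, hε0, hle⟩ : ∃ ε0 : ℝ, 0 < ε0 ∧ ε0 ≤ 1 ∧ ∀ τ : T, ε0 ≤ ε τ := by
    have hne : (insert 1 (Finset.univ.image ε)).Nonempty := Finset.insert_nonempty _ _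
    refine ⟨(insert 1 (Finset.univ.image ε)).min' hne, ?_, ?_, ?_⟩
    · rw [Finset.lt_min'_iff]
      intro y hy
      rcases Finset.mem_insert.mp hy with rfl | hy
      · exact one_pos
      · obtain ⟨τ, _, rfl⟩ := Finset.mem_image.mp hy
        exact hε τ
    · exact Finset.min'_le _ _ (Finset.mem_insert_self _ _)
    · intro τ
      exact Finset.min'_le _ _ (Finset.mem_insert_of_mem (Finset.mem_image_of_mem _ (Finset.mem_univ _)))
  refine ⟨∏ τ, e τ, Finset.prod_ne_zero_iff.mpr fun τ _ => he τ, ε0, hε0, ?_⟩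
  intro μ h0 hdeg
  by_cases hμ : IsIntegral ℤ μ
  · by_cases hbig : ∃ φ : AlgebraicClosure ℚ →ₐ[ℚ] ℂ, 2 < ‖φ μ‖
    · obtain ⟨φ, hφ⟩ := hbig
      right
      refine ⟨pullAbs (φ : AlgebraicClosure ℚ →+* ℂ), ?_⟩
      show 1 + ε0 ≤ ‖φ μ‖
      linarith [hle.1]
    · push Not at hbig
      have h := mahler_le μ hμ 2 one_le_two hbig
      have hd : (minpoly ℤ μ).natDegree ≤ B := by
        rw [minpoly.isIntegrallyClosed_eq_field_fractions' ℚ hμ, (minpoly.monic hμ).natDegree_map] at hdeg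
        exact hdeg
      have hμT : μ ∈ T := by
        refine ⟨h0, hμ, hd, h.trans ?_⟩
        push_cast
        exact pow_le_pow_right₀ one_le_two hd
      rcases hor ⟨μ, hμT⟩ with h | ⟨w, hw⟩
      · left
        obtain ⟨q, hq⟩ := Finset.dvd_prod_of_mem e (Finset.mem_univ (⟨μ, hμT⟩ : T))
        rw [hq, pow_mul]
        rw [h, one_pow]
      · right
        exact ⟨w, by linarith [hle.2 ⟨μ, hμT⟩]⟩
  · right
    obtain ⟨w, hw⟩ := nonint_abs μ hμ
    exact ⟨w, by linarith [hle.1]⟩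

end UPI
end

section
open Pointwise

namespace UPI

open scoped WithZero in
theorem exists_completion (F : Type) [Field F] : ∃ (K : Type) (_ : NontriviallyNormedField K) (_ : IsUltrametricDist K)
    (_ : CompleteSpace K) (f : RatFunc F →+* K), 1 < ‖f RatFunc.X‖ := by
  classical
  have hX : (1 : ℤᵐ⁰) < Valued.v (algebraMap (RatFunc F) (RatFunc.CompletionAtInfty F) RatFunc.X) := by
    rw [RatFunc.valuedCompletionAtInfty.def]
    have : (RatFunc.inftyValued F).extensionValuation (algebraMap (RatFunc F) (RatFunc.CompletionAtInfty F) RatFunc.X) =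
      RatFunc.inftyValuation F RatFunc.X := @Valued.extensionValuation_apply_coe _ _ _ _ (RatFunc.inftyValued F) _
    rw [this, RatFunc.inftyValuation.X]
    exact WithZero.exp_lt_exp.mpr one_pos
  let _ : Valuation.RankLeOne (Valued.v : Valuation (RatFunc.CompletionAtInfty F) ℤᵐ⁰) :=
    { hom' := (WithZeroMulInt.toNNReal (e := 2) (by norm_num)).comp MonoidWithZeroHom.ValueGroup₀.embedding
      strictMono' := (WithZeroMulInt.toNNReal_strictMono (by norm_num)).comp MonoidWithZeroHom.ValueGroup₀.embedding_strictMono }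
  let _ : Valuation.RankOne (Valued.v : Valuation (RatFunc.CompletionAtInfty F) ℤᵐ⁰) :=
    Valuation.RankLeOne.rankOne_of_exists _ ⟨algebraMap (RatFunc F) (RatFunc.CompletionAtInfty F) RatFunc.X,
      by simpa using RatFunc.X_ne_zero, hX.ne'⟩
  refine ⟨RatFunc.CompletionAtInfty F, Valued.toNontriviallyNormedField _ ℤᵐ⁰, ?_, ?_, algebraMap _ _, ?_⟩
  · infer_instance
  · exact inferInstanceAs (@CompleteSpace (@UniformSpace.Completion (RatFunc F) (RatFunc.inftyValued F).toUniformSpace) _)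
  · exact Valued.toNormedField.one_lt_norm_iff.mpr hX

theorem trans_abs (F E : Type) [Field F] [Field E] [Algebra F E] [Algebra (RatFunc F) E] [IsScalarTower F (RatFunc F) E]
    [Algebra.IsAlgebraic (RatFunc F) E] (μ : E) (hμ : Transcendental F μ) : 
    ∃ w : AbsoluteValue E ℝ, 2 ≤ w μ := by
  obtain ⟨K, _, _, _, f, hf⟩ := exists_completion F
  have halg : Algebra.IsAlgebraic (IntermediateField.adjoin F {μ}) E := by
    have hb : IsTranscendenceBasis F (fun _ : Unit => μ) := by
      have t1 : Algebra.trdeg F (RatFunc F) = 1 := by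
        have : Algebra.IsAlgebraic (Polynomial F) (RatFunc F) := IsLocalization.isAlgebraic _ (nonZeroDivisors (Polynomial F))
        have h := _root_.trdeg_add_eq F (Polynomial F) (A := RatFunc F)
        rw [Polynomial.trdeg_of_isDomain, _root_.trdeg_eq_zero, add_zero] at h
        exact h.symm
      have t2 : Algebra.trdeg F E = 1 := by
        have h := _root_.trdeg_add_eq F (RatFunc F) (A := E)
        rw [t1, _root_.trdeg_eq_zero, add_zero] at h
        exact h.symm
      have ai : AlgebraicIndependent F (fun _ : Unit => μ) := algebraicIndependent_unique_type_iff.mpr hμ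
      apply ai.isTranscendenceBasis_of_trdeg_le_of_finite
      rw [t2]; simp
    have := hb.isAlgebraic_field
    rw [Set.range_const] at this
    exact this
  let g : IntermediateField.adjoin F {μ} →+* AlgebraicClosure K :=
    (algebraMap K (AlgebraicClosure K)).comp (f.comp (RatFunc.algEquivOfTranscendental μ hμ).symm.toRingEquiv.toRingHom)
  let _ : Algebra (IntermediateField.adjoin F {μ}) (AlgebraicClosure K) := g.toAlgebra
  have : FaithfulSMul (IntermediateField.adjoin F {μ}) (AlgebraicClosure K) :=
    (faithfulSMul_iff_algebraMap_injective _ _).mpr g.injective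
  have : Module.IsTorsionFree (IntermediateField.adjoin F {μ}) (AlgebraicClosure K) :=
    Module.isTorsionFree_iff_faithfulSMul.mpr this
  let φ : E →ₐ[IntermediateField.adjoin F {μ}] AlgebraicClosure K := IsAlgClosed.lift
  let _ : NormedField (AlgebraicClosure K) := spectralNorm.normedField K (AlgebraicClosure K)
  have h1 : φ μ = algebraMap K (AlgebraicClosure K) (f RatFunc.X) := by
    have : φ (algebraMap (IntermediateField.adjoin F {μ}) E (IntermediateField.AdjoinSimple.gen F μ)) = _ := φ.commutes _
    rw [IntermediateField.AdjoinSimple.algebraMap_gen] at this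
    rw [this]
    show algebraMap K (AlgebraicClosure K) (f ((RatFunc.algEquivOfTranscendental μ hμ).symm _)) = _
    rw [RatFunc.algEquivOfTranscendental_symm_gen]
  refine absval_pow (pullAbs (φ : E →+* AlgebraicClosure K)) ?_ μ ?_
  · intro x y
    show ‖φ (x + y)‖ ≤ max ‖φ x‖ ‖φ y‖
    rw [map_add]
    exact isNonarchimedean_spectralNorm (K := K) (L := AlgebraicClosure K) _ _
  · show 1 < ‖φ μ‖
    rw [h1]
    have : ‖algebraMap K (AlgebraicClosure K) (f RatFunc.X)‖ = ‖f RatFunc.X‖ := spectralNorm_extends (L := AlgebraicClosure K) _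
    rw [this]; exact hf

theorem alg_coeff (F E : Type) [Field F] [Field E] [Algebra F E] [Algebra (RatFunc F) E] [IsScalarTower F (RatFunc F) E]
    [Algebra.IsAlgebraic (RatFunc F) E] (μ : E) (hμ : IsAlgebraic F μ) : 
    ∃ q : Polynomial F, q.Monic ∧ q.natDegree = (minpoly (RatFunc F) μ).natDegree ∧ Polynomial.aeval μ q = 0 := by
  have hi : IsIntegral F μ := hμ.isIntegral
  have hm := minpoly.monic (hi.tower_top (A := RatFunc F))
  have hd := minpoly.dvd_map_of_isScalarTower F (RatFunc F) μ
  have hl := integralClosure.mem_lifts_of_monic_of_dvd_map (RatFunc F) (minpoly.monic hi) hm hd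
  have hl2 : minpoly (RatFunc F) μ ∈ Polynomial.lifts (algebraMap F (RatFunc F)) := by
    rw [Polynomial.lifts_iff_coeff_lifts] at hl ⊢
    intro n
    obtain ⟨y, hy⟩ := hl n
    by_contra hc
    have : Transcendental F ((minpoly (RatFunc F) μ).coeff n) := by
      apply RatFunc.transcendental_of_ne_C
      rintro ⟨c, h⟩
      exact hc ⟨c, h.symm⟩
    apply this
    rw [← hy]
    exact y.2.isAlgebraic
  obtain ⟨q, hq⟩ := (Polynomial.mem_lifts _).mp hl2
  refine ⟨q, ?_, ?_, ?_⟩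
  · apply Polynomial.monic_of_injective (algebraMap F (RatFunc F)).injective
    rw [hq]; exact hm
  · rw [← hq, Polynomial.natDegree_map]
  · have := minpoly.aeval (RatFunc F) μ
    rwa [← hq, Polynomial.aeval_map_algebraMap] at this

theorem BTp (p : ℕ) [Fact p.Prime] (B : ℕ) : ∃ e : ℕ, e ≠ 0 ∧ ∀ μ : AlgebraicClosure (RatFunc (ZMod p)), μ ≠ 0 →
    (minpoly (RatFunc (ZMod p)) μ).natDegree ≤ B →
    μ ^ e = 1 ∨ ∃ w : AbsoluteValue (AlgebraicClosure (RatFunc (ZMod p))) ℝ, 2 ≤ w μ := by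
  classical
  let T : Set (AlgebraicClosure (RatFunc (ZMod p))) := {μ | μ ≠ 0 ∧ ∃ q : Polynomial (ZMod p), q.Monic ∧ q.natDegree ≤ B ∧ 
    Polynomial.aeval μ q = 0}
  have hT : T.Finite := by
    have hfin : {q : Polynomial (ZMod p) | q.natDegree ≤ B}.Finite := by
      have : (Set.range (fun c : Fin (B+1) → ZMod p => ∑ i, Polynomial.C (c i) * Polynomial.X ^ (i : ℕ))).Finite := Set.finite_range _
      refine this.subset ?_
      intro q hq
      refine ⟨fun i => q.coeff i, ?_⟩
      show ∑ i : Fin (B+1), Polynomial.C (q.coeff i) * Polynomial.X ^ (i : ℕ) = q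
      rw [Fin.sum_univ_eq_sum_range (fun i => Polynomial.C (q.coeff i) * Polynomial.X ^ (i : ℕ))]
      exact (Polynomial.as_sum_range_C_mul_X_pow' q (Nat.lt_succ_of_le hq)).symm
    refine (hfin.biUnion (t := fun q => q.rootSet _) fun p _ => Polynomial.rootSet_finite _ _).subset ?_
    rintro μ ⟨_, q, hq, hqB, hq0⟩
    refine Set.mem_biUnion (hqB : q ∈ {q : Polynomial (ZMod p) | q.natDegree ≤ B}) ?_
    rw [Polynomial.mem_rootSet']
    exact ⟨(hq.map _).ne_zero, hq0⟩
  have key : ∀ μ : T, ∃ e : ℕ, e ≠ 0 ∧ (μ : AlgebraicClosure (RatFunc (ZMod p))) ^ e = 1 := by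
    rintro ⟨μ, h0, q, hq, hqB, hq0⟩
    have hintg : IsIntegral (ZMod p) μ := ⟨q, hq, hq0⟩
    have := IntermediateField.adjoin.finiteDimensional hintg
    have : Finite (IntermediateField.adjoin (ZMod p) {μ}) := Module.finite_of_finite (ZMod p)
    let g : (IntermediateField.adjoin (ZMod p) {μ})ˣ := Units.mk0 (IntermediateField.AdjoinSimple.gen _ μ) (by
      intro h; apply h0; rw [← IntermediateField.AdjoinSimple.algebraMap_gen (ZMod p) μ, h, map_zero])
    refine ⟨orderOf g, (orderOf_pos g).ne', ?_⟩
    have h2 := congrArg (algebraMap (IntermediateField.adjoin (ZMod p) {μ}) (AlgebraicClosure (RatFunc (ZMod p)))) 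
      (congrArg Units.val (pow_orderOf_eq_one g))
    rw [Units.val_pow_eq_pow_val, map_pow] at h2
    simpa [g] using h2
  choose e he h1 using key
  have : Fintype T := hT.fintype
  refine ⟨∏ τ, e τ, Finset.prod_ne_zero_iff.mpr fun τ _ => he τ, ?_⟩
  intro μ h0 hdeg
  by_cases hμ : IsAlgebraic (ZMod p) μ
  · left
    obtain ⟨q, hq, hqd, hq0⟩ := alg_coeff (ZMod p) _ μ hμ
    have hμT : μ ∈ T := ⟨h0, q, hq, hqd ▸ hdeg, hq0⟩
    obtain ⟨r, hr⟩ := Finset.dvd_prod_of_mem e (Finset.mem_univ (⟨μ, hμT⟩ : T))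
    rw [hr, pow_mul]
    rw [h1 ⟨μ, hμT⟩, one_pow]
  · right
    exact trans_abs (ZMod p) _ μ hμ

end UPI
end

section
open Pointwise

namespace UPI

theorem FH0 (E : Type) [Field E] [IsAlgClosed E] (D e : ℕ) (he : e ≠ 0) :
    FinHyp E D e (((D*e)^D)^(D^2)+D^2+1) (((D*e)^D)^(D^2)) := by
  intro G _ d hd hdD M S h1 hcl hsp ht
  have hle : ((d*e)^d)^(d^2) ≤ ((D*e)^D)^(D^2) := by
    have hde : 1 ≤ d * e := Nat.one_le_iff_ne_zero.mpr (Nat.mul_ne_zero hd he)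
    have h2 : (d*e)^d ≤ (D*e)^D :=
      (Nat.pow_le_pow_right hde hdD).trans (Nat.pow_le_pow_left (Nat.mul_le_mul_right _ hdD) _)
    exact (Nat.pow_le_pow_right (Nat.one_le_pow _ _ hde) (Nat.pow_le_pow_left hdD 2)).trans (Nat.pow_le_pow_left h2 _)
  have hsq : d^2 ≤ D^2 := Nat.pow_le_pow_left hdD 2
  obtain ⟨K, a, b, c⟩ := FIN0 hd he M S h1 hcl hsp (((D*e)^D)^(D^2)+D^2+1) (by omega) ht
  exact ⟨K, a, b, c.trans hle⟩

theorem FHp (p : ℕ) [Fact p.Prime] (E : Type) [Field E] [IsAlgClosed E] [Algebra (ZMod p) E] (D e : ℕ) (he : e ≠ 0) :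
    ∃ I, FinHyp E D e (2*D^2+1) I := by
  let R : Set E := ⋃ i : Fin D, {x : E | x ^ ((i.1+1) * e) = 1}
  have hR : R.Finite := Set.finite_iUnion fun i => (mu_card E _ (Nat.pos_of_ne_zero (Nat.mul_ne_zero (Nat.succ_ne_zero _) he))).1
  have : Finite R := hR
  have hfd : FiniteDimensional (ZMod p) (IntermediateField.adjoin (ZMod p) R) := by
    apply IntermediateField.finiteDimensional_adjoin
    intro x hx
    obtain ⟨i, hi⟩ := Set.mem_iUnion.mp hx
    refine ⟨Polynomial.X ^ ((i.1+1) * e) - Polynomial.C 1, Polynomial.monic_X_pow_sub_C _ (Nat.mul_ne_zero (Nat.succ_ne_zero _) he), ?_⟩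
    have : x ^ ((i.1+1) * e) = 1 := hi
    simp [this]
  have hfin : Finite (IntermediateField.adjoin (ZMod p) R) := Module.finite_of_finite (ZMod p)
  let k : Subfield E := (IntermediateField.adjoin (ZMod p) R).toSubfield
  have hk : Finite k := hfin
  refine ⟨Nat.card k ^ (D^2), ?_⟩
  intro G _ d hd hdD M S h1 hcl hsp ht
  have hsq : d^2 ≤ D^2 := Nat.pow_le_pow_left hdD 2
  obtain ⟨K, a, b, c⟩ := FINk hd M S h1 hcl hsp (2*D^2+1) (by omega) ht k (by
    rintro t ⟨m, hm, rfl⟩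
    apply Subfield.sum_mem
    intro i _
    apply IntermediateField.subset_adjoin (ZMod p) R
    refine Set.mem_iUnion.mpr ⟨⟨d-1, by omega⟩, ?_⟩
    show m i ^ ((d - 1 + 1) * e) = 1
    rw [Nat.sub_add_cancel (Nat.one_le_iff_ne_zero.mpr hd)]
    exact hm i)
  exact ⟨K, a, b, c.trans (Nat.pow_le_pow_right Nat.card_pos hsq)⟩

def Good (L : Type) [Field L] (N m D I : ℕ) : Prop := ∀ (G : Type) [Group G] (ρ : G →* GL (Fin N) L) (S : Set G),
  S.Finite → 1 ∈ S → Subgroup.closure S = ⊤ → (¬ ∃ a ∈ S^m, ∃ b ∈ S^m, FreePair (ρ a) (ρ b)) →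
  ∃ H : Subgroup G, H.index ≠ 0 ∧ H.index ≤ I ∧ ∀ x : ℕ → G, (∀ i, x i ∈ H) → ρ (ic x D) = 1

/-- representation of GL over the extension -/
noncomputable def psi (L E : Type) [Field L] [Field E] [Algebra L E] (N : ℕ) : GL (Fin N) L →* Module.End E (Fin N → E) :=
  ((Matrix.toLinAlgEquiv' : Matrix (Fin N) (Fin N) E ≃ₐ[E] _) : Matrix (Fin N) (Fin N) E →* Module.End E (Fin N → E)).comp
    ((algebraMap L E).mapMatrix.toMonoidHom.comp (Units.coeHom _))

theorem psi_inj (L E : Type) [Field L] [Field E] [Algebra L E] (N : ℕ) : Function.Injective (psi L E N) := by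
  intro a b h
  apply Units.ext
  have h2 : (algebraMap L E).mapMatrix a.1 = (algebraMap L E).mapMatrix b.1 := Matrix.toLinAlgEquiv'.injective h
  apply Matrix.map_injective (algebraMap L E).injective h2

theorem psi_eig (L E : Type) [Field L] [Field E] [Algebra L E] (N : ℕ) (g : GL (Fin N) L) (l : E)
    (h : (psi L E N g).HasEigenvalue l) : l ≠ 0 ∧ IsIntegral L l ∧ (minpoly L l).natDegree ≤ N := by
  obtain ⟨v, hv⟩ := h.exists_hasEigenvector
  have hv1 : (g.1.map (algebraMap L E)).mulVec v = l • v := hv.apply_eq_smul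
  have hr : (g.1.map (algebraMap L E)).charpoly.IsRoot l := (isRoot_charpoly_iff _ _).mpr ⟨v, hv.2, hv1⟩
  rw [Matrix.charpoly_map] at hr
  have hr' : Polynomial.aeval l g.1.charpoly = 0 := by
    rw [← Polynomial.eval_map_algebraMap]; exact hr
  refine ⟨?_, ⟨_, g.1.charpoly_monic, hr'⟩, ?_⟩
  · rintro rfl
    rw [zero_smul] at hv1
    have h2 : ((g⁻¹).1.map (algebraMap L E)).mulVec ((g.1.map (algebraMap L E)).mulVec v) = v := by
      rw [Matrix.mulVec_mulVec, ← Matrix.map_mul, ← Units.val_mul, inv_mul_cancel]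
      simp
    rw [hv1, Matrix.mulVec_zero] at h2
    exact hv.2 h2.symm
  · refine (Polynomial.natDegree_le_of_dvd (minpoly.dvd L l hr') g.1.charpoly_monic.ne_zero).trans ?_
    rw [Matrix.charpoly_natDegree_eq_dim]; simp

theorem ratio_deg (L E : Type) [Field L] [Field E] [Algebra L E] (l u : E) (hl : IsIntegral L l) (hu : IsIntegral L u) (N : ℕ)
    (h1 : (minpoly L l).natDegree ≤ N) (h2 : (minpoly L u).natDegree ≤ N) : (minpoly L (l/u)).natDegree ≤ N^2 := by
  have := IntermediateField.adjoin.finiteDimensional hl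
  have := IntermediateField.adjoin.finiteDimensional hu
  let A := IntermediateField.adjoin L {l} ⊔ IntermediateField.adjoin L {u}
  have hlA : l ∈ A := le_sup_left (a := IntermediateField.adjoin L {l}) (IntermediateField.mem_adjoin_simple_self L l)
  have huA : u ∈ A := le_sup_right (a := IntermediateField.adjoin L {l}) (IntermediateField.mem_adjoin_simple_self L u)
  have hfd : FiniteDimensional L A := IntermediateField.finiteDimensional_sup _ _
  let z : A := ⟨l / u, A.div_mem hlA huA⟩
  have hz : minpoly L (l/u) = minpoly L z := minpoly.algebraMap_eq (A := L) (B := A) (B' := E) (algebraMap A E).injective z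
  rw [hz]
  refine (minpoly.natDegree_le z).trans ((IntermediateField.finrank_sup_le _ _).trans ?_)
  rw [IntermediateField.adjoin.finrank hl, IntermediateField.adjoin.finrank hu, pow_two]
  exact Nat.mul_le_mul h1 h2

theorem good_of (L E : Type) [Field L] [Field E] [Algebra L E] (N e m I : ℕ) (ε : ℝ)
    (hBT : ∀ μ : E, μ ≠ 0 → (minpoly L μ).natDegree ≤ N^2 → μ ^ e = 1 ∨ ∃ w : AbsoluteValue E ℝ, 1 + ε ≤ w μ)
    (hM : ∀ (G : Type) [Group G] (V : Type) [AddCommGroup V] [Module E V] [FiniteDimensional E V] (ρ : G →* Module.End E V)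
      (S : Set G), Module.finrank E V ≤ N → BTH ρ e ε → S.Finite → 1 ∈ S → Subgroup.closure S = ⊤ →
      (¬ ∃ a ∈ S^m, ∃ b ∈ S^m, FreePair a b) → Concl ρ N I) : Good L N m N I := by
  intro G _ ρ S hS h1 hcl hfree
  let θ := ρ.rangeRestrict
  have hθ : Function.Surjective θ := ρ.rangeRestrict_surjective
  suffices hC : Concl ((psi L E N).comp ρ.range.subtype) N I by
    obtain ⟨H, hH0, hHI, hH⟩ := hC
    refine ⟨H.comap θ, ?_, ?_, ?_⟩
    · rwa [Subgroup.index_comap_of_surjective _ hθ]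
    · rwa [Subgroup.index_comap_of_surjective _ hθ]
    · intro x hx
      have h3 := hH (fun i => θ (x i)) hx
      rw [← ic_map] at h3
      have h4 : psi L E N (ρ (ic x N)) = 1 := h3
      apply psi_inj L E N
      rw [h4, map_one]
  apply hM ρ.range (Fin N → E) ((psi L E N).comp ρ.range.subtype) (θ '' S) (by simp) ?_
    (hS.image _) ⟨1, h1, map_one _⟩ ?_ ?_
  · intro g l u hl hu
    obtain ⟨l0, li, ld⟩ := psi_eig L E N _ l hl
    obtain ⟨u0, ui, ud⟩ := psi_eig L E N _ u hu
    rcases hBT (l/u) (div_ne_zero l0 u0) (ratio_deg L E l u li ui N ld ud) with h | ⟨w, hw⟩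
    · exact Or.inl h
    · right
      refine ⟨w, ?_⟩
      rw [map_div₀] at hw
      rwa [le_div_iff₀ (w.pos u0)] at hw
  · rw [← MonoidHom.map_closure, hcl, ← MonoidHom.range_eq_map]
    exact MonoidHom.range_eq_top.mpr hθ
  · rintro ⟨a, ha, b, hb, hab⟩
    rw [← Set.image_pow] at ha hb
    obtain ⟨a, ha, rfl⟩ := ha
    obtain ⟨b, hb, rfl⟩ := hb
    apply hfree
    refine ⟨a, ha, b, hb, ?_⟩
    exact FreePair.map_inj ρ.range.subtype ρ.range.subtype_injective hab

theorem GOODQ (N : ℕ) : ∃ m I, Good ℚ N m N I := by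
  obtain ⟨e, he, ε, hε, hBT⟩ := BTQ (N^2)
  obtain ⟨m, hm⟩ := MAIN N (((N*e)^N)^(N^2)+N^2+1) ε hε (by omega) N le_rfl
  obtain ⟨I, hI⟩ := hm (AlgebraicClosure ℚ) e _ he (FH0 _ N e he)
  exact ⟨m, I, good_of ℚ (AlgebraicClosure ℚ) N e m I ε hBT hI⟩

theorem GOODp (N : ℕ) : ∃ m, ∀ (p : ℕ) [Fact p.Prime], ∃ I, Good (RatFunc (ZMod p)) N m N I := by
  obtain ⟨m, hm⟩ := MAIN N (2*N^2+1) 1 one_pos (by omega) N le_rfl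
  refine ⟨m, fun p _ => ?_⟩
  obtain ⟨e, he, hBT⟩ := BTp p (N^2)
  obtain ⟨I0, hI0⟩ := FHp p (AlgebraicClosure (RatFunc (ZMod p))) N e he
  obtain ⟨I, hI⟩ := hm (AlgebraicClosure (RatFunc (ZMod p))) e _ he hI0
  refine ⟨I, good_of _ (AlgebraicClosure (RatFunc (ZMod p))) N e m I 1 ?_ hI⟩
  intro μ h0 hd
  rcases hBT μ h0 hd with h | ⟨w, hw⟩
  · exact Or.inl h
  · exact Or.inr ⟨w, by linarith⟩

end UPI
end

section
open Pointwise
namespace UPI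

theorem SPEC_alg (F : Type) [Field F] (T : Set F)
    (hT : AlgebraicIndependent (⊥ : Subfield F) ((↑) : T → F)) (hcl : Subfield.closure T = ⊤)
    (L : Type) [Field L] [Infinite L] (ι0 : (⊥ : Subfield F) →+* L) (X : Set F) (hX : X.Finite) :
    ∃ (A : Type) (_ : CommRing A) (i : A →+* F) (_ : Function.Injective i) (_ : A →+* L),
      ∀ x ∈ X, x ∈ Set.range i := by
  classical
  have htop : IntermediateField.adjoin (⊥ : Subfield F) (Set.range ((↑) : T → F)) = ⊤ := by
    rw [Subtype.range_coe]
    apply top_unique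
    intro x _
    have h1 : Subfield.closure T ≤
        (IntermediateField.adjoin (⊥ : Subfield F) T).toSubfield := by
      rw [Subfield.closure_le]
      exact IntermediateField.subset_adjoin _ _
    exact h1 (by rw [hcl]; trivial)
  have hfr : ∀ x : F, ∃ r s : MvPolynomial T (⊥ : Subfield F), s ≠ 0 ∧
      x * MvPolynomial.aeval ((↑) : T → F) s = MvPolynomial.aeval ((↑) : T → F) r := by
    intro x
    obtain ⟨r, s, h⟩ := (IntermediateField.mem_adjoin_range_iff (⊥ : Subfield F) ((↑) : T → F) x).mp
      (by rw [htop]; trivial)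
    by_cases hs : MvPolynomial.aeval ((↑) : T → F) s = 0
    · refine ⟨0, 1, one_ne_zero, ?_⟩
      rw [h, hs]; simp
    · refine ⟨r, s, ?_, ?_⟩
      · rintro rfl; simp at hs
      · rw [h]; field_simp
  choose r s hs0 hrs using hfr
  have hinj : Function.Injective (MvPolynomial.aeval (R := (⊥ : Subfield F)) ((↑) : T → F)) := hT
  set B : MvPolynomial T (⊥ : Subfield F) := ∏ x ∈ hX.toFinset, s x with hB
  have hB0 : B ≠ 0 := Finset.prod_ne_zero_iff.mpr fun x _ => hs0 x
  have hBF : (MvPolynomial.aeval (R := (⊥ : Subfield F)) ((↑) : T → F)) B ≠ 0 := by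
    intro h; exact hB0 (hinj (by rw [h, map_zero]))
  obtain ⟨τ, hτ⟩ : ∃ τ : T → L, MvPolynomial.eval₂Hom ι0 τ B ≠ 0 := by
    by_contra hne
    push Not at hne
    apply hB0
    apply MvPolynomial.map_injective ι0 ι0.injective
    apply MvPolynomial.funext
    intro τ
    rw [MvPolynomial.eval_map, map_zero, map_zero]
    exact hne τ
  have hu : IsUnit ((MvPolynomial.aeval (R := (⊥ : Subfield F)) ((↑) : T → F)).toRingHom B) :=
    IsUnit.mk0 _ hBF
  have hu2 : IsUnit (MvPolynomial.eval₂Hom ι0 τ B) := IsUnit.mk0 _ hτ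
  let i : Localization.Away B →+* F := IsLocalization.Away.lift B hu
  have hic : ∀ a, i (algebraMap _ _ a) = MvPolynomial.aeval (R := (⊥ : Subfield F)) ((↑) : T → F) a := by
    intro a
    exact IsLocalization.Away.lift_eq B hu a
  refine ⟨Localization.Away B, inferInstance, i, ?_, IsLocalization.Away.lift B hu2, ?_⟩
  · rw [injective_iff_map_eq_zero]
    intro a ha
    obtain ⟨⟨c, t⟩, hct⟩ := IsLocalization.surj (Submonoid.powers B) a
    have h1 : i (algebraMap _ _ c) = 0 := by
      rw [← hct, map_mul, ha, zero_mul]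
    rw [hic] at h1
    have h2 : c = 0 := hinj (by rw [h1, map_zero])
    rw [h2, map_zero] at hct
    exact (IsLocalization.map_units (Localization.Away B) t).mul_left_eq_zero.mp hct
  · intro x hx
    obtain ⟨c, hc⟩ : s x ∣ B := Finset.dvd_prod_of_mem _ (hX.mem_toFinset.mpr hx)
    refine ⟨algebraMap _ _ (r x * c) * IsLocalization.Away.invSelf B, ?_⟩
    have h1 : i (IsLocalization.Away.invSelf B) * i (algebraMap _ _ B) = 1 := by
      rw [← map_mul, mul_comm, IsLocalization.Away.mul_invSelf, map_one]
    rw [hic] at h1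
    apply mul_right_cancel₀ hBF
    rw [map_mul, mul_assoc, h1, hic, mul_one, hc, map_mul, map_mul, ← hrs x]
    ring

theorem SPEC (F : Type) [Field F] (T : Set F)
    (hT : AlgebraicIndependent (⊥ : Subfield F) ((↑) : T → F)) (hcl : Subfield.closure T = ⊤)
    (L : Type) [Field L] [Infinite L] (ι0 : (⊥ : Subfield F) →+* L) (N : ℕ)
    (Γ : Type) [Group Γ] (j : Γ →* Matrix.GeneralLinearGroup (Fin N) F) (hj : Function.Injective j)
    (S0 W : Set Γ) (hS0 : S0.Finite) (hW : W.Finite) :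
    ∃ ρ : Subgroup.closure S0 →* Matrix.GeneralLinearGroup (Fin N) L,
      ∀ w : Subgroup.closure S0, (w : Γ) ∈ W → w ≠ 1 → ρ w ≠ 1 := by
  classical
  let X1 : Set F := ⋃ s ∈ S0, Set.range fun ab : Fin N × Fin N =>
    (j s : Matrix (Fin N) (Fin N) F) ab.1 ab.2
  let X2 : Set F := ⋃ s ∈ S0, Set.range fun ab : Fin N × Fin N =>
    ((j s)⁻¹ : Matrix.GeneralLinearGroup (Fin N) F).1 ab.1 ab.2
  let X3 : Set F := ⋃ s ∈ W, Set.range fun ab : Fin N × Fin N =>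
    ((j s : Matrix (Fin N) (Fin N) F) ab.1 ab.2 - (1 : Matrix (Fin N) (Fin N) F) ab.1 ab.2)⁻¹
  obtain ⟨A, _, i, hi, θ, hA⟩ := SPEC_alg F T hT hcl L ι0 (X1 ∪ X2 ∪ X3) (by
    refine Set.Finite.union (Set.Finite.union ?_ ?_) ?_
    · exact hS0.biUnion fun s _ => Set.finite_range _
    · exact hS0.biUnion fun s _ => Set.finite_range _
    · exact hW.biUnion fun s _ => Set.finite_range _)
  let ιG : Matrix.GeneralLinearGroup (Fin N) A →* Matrix.GeneralLinearGroup (Fin N) F :=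
    Matrix.GeneralLinearGroup.map i
  have hιG : Function.Injective ιG := by
    intro a b hab
    ext u v
    apply hi
    have := congrArg (fun g : Matrix.GeneralLinearGroup (Fin N) F => g.1 u v) hab
    exact this
  have hle : ∀ g ∈ Subgroup.closure S0, j g ∈ ιG.range := by
    have : Subgroup.closure S0 ≤ ιG.range.comap j := by
      rw [Subgroup.closure_le]
      intro s hs
      have h1 : ∀ u v, ∃ a : A, i a = (j s).1 u v := fun u v =>
        hA _ (Or.inl (Or.inl (Set.mem_biUnion hs ⟨(u, v), rfl⟩)))
      have h2 : ∀ u v, ∃ a : A, i a = ((j s)⁻¹).1 u v := fun u v =>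
        hA _ (Or.inl (Or.inr (Set.mem_biUnion hs ⟨(u, v), rfl⟩)))
      choose P hP using h1
      choose Q hQ using h2
      have hPm : (Matrix.of P).map i = (j s).1 := by ext u v; exact hP u v
      have hQm : (Matrix.of Q).map i = ((j s)⁻¹).1 := by ext u v; exact hQ u v
      have hmi : Function.Injective (fun M : Matrix (Fin N) (Fin N) A => M.map i) :=
        Matrix.map_injective hi
      refine ⟨⟨Matrix.of P, Matrix.of Q, ?_, ?_⟩, ?_⟩
      · apply hmi
        simp only [Matrix.map_mul, hPm, hQm]
        rw [Units.mul_inv]; simp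
      · apply hmi
        simp only [Matrix.map_mul, hPm, hQm]
        rw [Units.inv_mul]; simp
      · ext u v; exact hP u v
    exact this
  let κ : Subgroup.closure S0 →* ιG.range :=
    (j.comp (Subgroup.closure S0).subtype).codRestrict ιG.range fun g => hle g.1 g.2
  let σ : Subgroup.closure S0 →* Matrix.GeneralLinearGroup (Fin N) A :=
    (MonoidHom.ofInjective hιG).symm.toMonoidHom.comp κ
  have hσ : ∀ g, ιG (σ g) = j g.1 := fun g => MonoidHom.apply_ofInjective_symm hιG (κ g)
  refine ⟨(Matrix.GeneralLinearGroup.map θ).comp σ, ?_⟩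
  intro w hwW hw1 hρ
  apply hw1
  apply Subtype.ext
  apply hj
  rw [OneMemClass.coe_one, map_one]
  ext u v
  by_contra hne
  obtain ⟨a, ha⟩ := hA _ (Or.inr (Set.mem_biUnion hwW ⟨(u, v), rfl⟩))
  have h1 : i (((σ w).1 u v - (1 : Matrix (Fin N) (Fin N) A) u v) * a) = 1 := by
    have e1 : i ((σ w).1 u v) = (j w.1).1 u v := by
      rw [← hσ]; rfl
    have e2 : i ((1 : Matrix (Fin N) (Fin N) A) u v) = (1 : Matrix (Fin N) (Fin N) F) u v := by
      simp only [Matrix.one_apply]; split_ifs <;> simp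
    rw [map_mul, map_sub, e1, e2, ha]
    apply mul_inv_cancel₀
    intro h0
    exact hne (sub_eq_zero.mp h0)
  have h2 := hi (h1.trans (map_one i).symm)
  have h3 := congrArg θ h2
  rw [map_mul, map_sub, map_one] at h3
  have e3 : θ ((σ w).1 u v) = (1 : Matrix (Fin N) (Fin N) L) u v := by
    have := congrArg (fun g : Matrix.GeneralLinearGroup (Fin N) L => g.1 u v) hρ
    exact this
  have e4 : θ ((1 : Matrix (Fin N) (Fin N) A) u v) = (1 : Matrix (Fin N) (Fin N) L) u v := by
    simp only [Matrix.one_apply]; split_ifs <;> simp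
  rw [e3, e4, sub_self, zero_mul] at h3
  exact zero_ne_one h3

theorem UL (Γ : Type) [Group Γ] (D I : ℕ)
    (h : ∀ W : Finset Γ, ∃ P H : Subgroup Γ, (∀ w ∈ W, w ∈ P) ∧ H.relIndex P ≠ 0 ∧
      H.relIndex P ≤ I ∧ ∀ x : ℕ → Γ, (∀ i, x i ∈ H) → ic x D ∈ W → ic x D = 1) :
    ∃ H : Subgroup Γ, H.index ≠ 0 ∧ ∀ x : ℕ → Γ, (∀ i, x i ∈ H) → ic x D = 1 := by
  classical
  choose P K hWP hK0 hKI hKic using h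
  let 𝒰 : Ultrafilter (Finset Γ) := Ultrafilter.of Filter.atTop
  have h𝒰 : (𝒰 : Filter (Finset Γ)) ≤ Filter.atTop := Ultrafilter.of_le _
  have hev : ∀ g : Γ, ∀ᶠ W in (𝒰 : Filter (Finset Γ)), g ∈ W := by
    intro g
    apply h𝒰
    filter_upwards [Filter.eventually_ge_atTop ({g} : Finset Γ)] with W hW
    exact hW (Finset.mem_singleton_self g)
  let H : Subgroup Γ :=
    { carrier := {g | ∀ᶠ W in (𝒰 : Filter (Finset Γ)), g ∈ K W}
      mul_mem' := fun {a b} ha hb => by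
        filter_upwards [ha, hb] with W h1 h2 using mul_mem h1 h2
      one_mem' := Filter.Eventually.of_forall fun W => one_mem _
      inv_mem' := fun {a} ha => by
        filter_upwards [ha] with W h1 using inv_mem h1 }
  have hH : ∀ g, g ∈ H ↔ ∀ᶠ W in (𝒰 : Filter (Finset Γ)), g ∈ K W := fun g => Iff.rfl
  refine ⟨H, ?_, ?_⟩
  · intro h0
    have hinf : Infinite (Γ ⧸ H) := by
      by_contra hni
      rw [not_infinite_iff_finite] at hni
      exact Subgroup.index_ne_zero_of_finite h0
    obtain ⟨f⟩ : Nonempty (Fin (I+1) ↪ Γ ⧸ H) := ⟨Fin.valEmbedding.trans (Infinite.natEmbedding _)⟩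
    choose g hg using fun a => Quotient.exists_rep (f a)
    have h1 : ∀ a b : Fin (I+1), a ≠ b → ∀ᶠ W in (𝒰 : Filter (Finset Γ)), (g a)⁻¹ * g b ∉ K W := by
      intro a b hab
      rw [Ultrafilter.eventually_not]
      intro hm
      apply hab
      apply f.injective
      rw [← hg a, ← hg b]
      exact QuotientGroup.eq.mpr hm
    have h2 : ∀ᶠ W in (𝒰 : Filter (Finset Γ)), (∀ a, g a ∈ W) ∧
        ∀ a b : Fin (I+1), a ≠ b → (g a)⁻¹ * g b ∉ K W := by
      refine Filter.Eventually.and (Filter.eventually_all.mpr fun a => hev _) ?_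
      refine Filter.eventually_all.mpr fun a => Filter.eventually_all.mpr fun b => ?_
      by_cases hab : a = b
      · exact Filter.Eventually.of_forall fun W h => absurd hab h
      · filter_upwards [h1 a b hab] with W hW _ using hW
    obtain ⟨W, hgW, hdist⟩ := h2.exists
    have hfin : Finite (P W ⧸ (K W).subgroupOf (P W)) := by
      apply Nat.finite_of_card_ne_zero
      exact hK0 W
    let q : Fin (I+1) → P W ⧸ (K W).subgroupOf (P W) := fun a =>
      QuotientGroup.mk (⟨g a, hWP W _ (hgW a)⟩ : P W)
    have hq : Function.Injective q := by
      intro a b hab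
      by_contra hne
      have := QuotientGroup.eq.mp hab
      exact hdist a b hne (Subgroup.mem_subgroupOf.mp this)
    have h3 := Nat.card_le_card_of_injective q hq
    rw [Nat.card_eq_fintype_card, Fintype.card_fin] at h3
    have h4 : Nat.card (P W ⧸ (K W).subgroupOf (P W)) ≤ I := hKI W
    omega
  · intro x hx
    let y : ℕ → Γ := fun i => if i ≤ D then x i else 1
    have hxy : ic x D = ic y D := ic_congr x y D fun i hi => by simp [y, hi]
    have h1 : ∀ᶠ W in (𝒰 : Filter (Finset Γ)), ∀ i : Fin (D+1), x i ∈ K W :=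
      Filter.eventually_all.mpr fun i => hx i
    obtain ⟨W, hW1, hW2⟩ := (h1.and (hev (ic y D))).exists
    rw [hxy]
    apply hKic W y _ hW2
    intro i
    by_cases hi : i ≤ D
    · simp only [y, hi, if_true]; exact hW1 ⟨i, by omega⟩
    · simp only [y, hi, if_false]; exact one_mem _

theorem TRANSFER (F : Type) [Field F] (T : Set F)
    (hT : AlgebraicIndependent (⊥ : Subfield F) ((↑) : T → F)) (hcl : Subfield.closure T = ⊤)
    (L : Type) [Field L] [Infinite L] (ι0 : (⊥ : Subfield F) →+* L) (N m D I : ℕ)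
    (hgood : Good L N m D I)
    (Γ : Type) [Group Γ] (j : Γ →* Matrix.GeneralLinearGroup (Fin N) F) (hj : Function.Injective j)
    (S : Set Γ) (h1S : 1 ∈ S) (hS : Subgroup.closure S = ⊤)
    (hfree : ¬ ∃ a ∈ S ^ m, ∃ b ∈ S ^ m, FreePair a b) :
    ∃ H : Subgroup Γ, H.index ≠ 0 ∧ ∀ x : ℕ → Γ, (∀ i, x i ∈ H) → ic x D = 1 := by
  classical
  apply UL Γ D I
  intro W
  have hfg : ∀ w : Γ, ∃ S1 : Set Γ, S1 ⊆ S ∧ S1.Finite ∧ w ∈ Subgroup.closure S1 := by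
    intro w
    have hw : w ∈ Subgroup.closure S := by rw [hS]; trivial
    induction hw using Subgroup.closure_induction with
    | mem x hx => exact ⟨{x}, by simpa using hx, Set.finite_singleton _, Subgroup.subset_closure rfl⟩
    | one => exact ⟨∅, by simp, Set.finite_empty, one_mem _⟩
    | mul x y _ _ h1 h2 =>
      obtain ⟨A, hA, hAf, hAx⟩ := h1
      obtain ⟨B, hB, hBf, hBx⟩ := h2
      exact ⟨A ∪ B, Set.union_subset hA hB, hAf.union hBf,
        mul_mem (Subgroup.closure_mono Set.subset_union_left hAx)
          (Subgroup.closure_mono Set.subset_union_right hBx)⟩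
    | inv x _ h1 =>
      obtain ⟨A, hA, hAf, hAx⟩ := h1
      exact ⟨A, hA, hAf, inv_mem hAx⟩
  choose S1 hS1S hS1f hS1w using hfg
  let S0 : Set Γ := {1} ∪ ⋃ w ∈ W, S1 w
  have hS0f : S0.Finite := (Set.finite_singleton _).union
    (W.finite_toSet.biUnion fun w _ => hS1f w)
  have hS0S : S0 ⊆ S := Set.union_subset (by simpa using h1S)
    (Set.iUnion₂_subset fun w _ => hS1S w)
  obtain ⟨ρ, hρ⟩ := SPEC F T hT hcl L ι0 N Γ j hj S0 W hS0f W.finite_toSet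
  let Q : Set (Subgroup.closure S0) := (Subgroup.closure S0).subtype ⁻¹' S0
  have hQim : (Subgroup.closure S0).subtype '' Q = S0 := by
    apply Set.image_preimage_eq_of_subset
    intro s hs
    exact ⟨⟨s, Subgroup.subset_closure hs⟩, rfl⟩
  obtain ⟨H, hH0, hHI, hHic⟩ := hgood (Subgroup.closure S0) ρ Q
    (hS0f.preimage (Subgroup.subtype_injective _).injOn)
    (by left; rfl) (Subgroup.closure_closure_coe_preimage) (by
      rintro ⟨a, ha, b, hb, hab⟩
      apply hfree
      have hmem : ∀ c ∈ Q ^ m, (c : Γ) ∈ S ^ m := by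
        intro c hc
        have : (Subgroup.closure S0).subtype c ∈ (Subgroup.closure S0).subtype '' (Q ^ m) := ⟨c, hc, rfl⟩
        rw [Set.image_pow, hQim] at this
        exact Set.pow_subset_pow_left hS0S this
      exact ⟨a, hmem a ha, b, hmem b hb,
        FreePair.map_inj (Subgroup.closure S0).subtype (Subgroup.subtype_injective _)
          (FreePair.of_map ρ hab)⟩)
  have hrel : (H.map (Subgroup.closure S0).subtype).relIndex (Subgroup.closure S0) = H.index := by
    rw [Subgroup.relIndex, Subgroup.subgroupOf,
      Subgroup.comap_map_eq_self_of_injective (Subgroup.subtype_injective _)]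
  refine ⟨Subgroup.closure S0, H.map (Subgroup.closure S0).subtype, ?_, ?_, ?_, ?_⟩
  · intro w hw
    refine Subgroup.closure_mono ?_ (hS1w w)
    exact Set.Subset.trans (Set.subset_biUnion_of_mem (u := S1) hw) Set.subset_union_right
  · rw [hrel]; exact hH0
  · rw [hrel]; exact hHI
  · intro x hx hxW
    choose y hyH hyx using hx
    have e : ic x D = (Subgroup.closure S0).subtype (ic y D) := by
      rw [ic_map]; congr 1; funext i; exact (hyx i).symm
    rw [e] at hxW ⊢
    by_contra hne
    refine hρ (ic y D) hxW ?_ (hHic y hyH)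
    intro h; apply hne; rw [h, map_one]

end UPI
end

section
open Pointwise
namespace UPI

theorem embed (K : Type) [Field K] (F : Subfield K) [FiniteDimensional F K] (d : ℕ) :
    ∃ j : Matrix.GeneralLinearGroup (Fin d) K →*
      Matrix.GeneralLinearGroup (Fin (Module.finrank F (Fin d → K))) F, Function.Injective j := by
  let b := Module.finBasis F (Fin d → K)
  let f1 : Matrix (Fin d) (Fin d) K →* Module.End K (Fin d → K) :=
    (Matrix.toLinAlgEquiv' (R := K) (n := Fin d)).toAlgHom.toRingHom.toMonoidHom
  let f2 : Module.End K (Fin d → K) →* Module.End F (Fin d → K) :=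
    { toFun := fun g => g.restrictScalars F
      map_one' := rfl
      map_mul' := fun _ _ => rfl }
  let f3 : Module.End F (Fin d → K) →*
      Matrix (Fin (Module.finrank F (Fin d → K))) (Fin (Module.finrank F (Fin d → K))) F :=
    (LinearMap.toMatrixAlgEquiv b).toAlgHom.toRingHom.toMonoidHom
  have h1 : Function.Injective f1 := (Matrix.toLinAlgEquiv' (R := K) (n := Fin d)).injective
  have h2 : Function.Injective f2 := LinearMap.restrictScalars_injective F
  have h3 : Function.Injective f3 := (LinearMap.toMatrixAlgEquiv b).injective
  exact ⟨Units.map (f3.comp (f2.comp f1)), Units.map_injective (h3.comp (h2.comp h1))⟩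

theorem prime_cases (F : Type) [Field F] :
    Nonempty ((⊥ : Subfield F) →+* ℚ) ∨
      ∃ (p : ℕ) (_ : Fact p.Prime), Nonempty ((⊥ : Subfield F) →+* RatFunc (ZMod p)) := by
  obtain ⟨p, hp⟩ := CharP.exists F
  rcases CharP.char_is_prime_or_zero F p with hpp | rfl
  · right
    have : Fact p.Prime := ⟨hpp⟩
    refine ⟨p, this, ?_⟩
    let _ : Algebra (ZMod p) F := ZMod.algebra F p
    rw [Subfield.bot_eq_of_zMod_algebra p]
    exact ⟨(algebraMap (ZMod p) (RatFunc (ZMod p))).comp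
      (RingHom.rangeRestrictFieldEquiv (algebraMap (ZMod p) F)).symm.toRingHom⟩
  · left
    have : CharZero F := CharP.charP_to_charZero F
    rw [Subfield.bot_eq_of_charZero]
    exact ⟨(RingHom.rangeRestrictFieldEquiv (algebraMap ℚ F)).symm.toRingHom⟩

theorem FINAL (n : ℕ) :
    ∃ m : ℕ, 1 ≤ m ∧
      ∀ (K : Type) [Field K] (F : Subfield K),
        FiniteDimensional F K → Module.finrank F K ≤ n →
        (∃ T : Set F, AlgebraicIndependent (⊥ : Subfield F) ((↑) : T → F) ∧
          Subfield.closure T = ⊤) →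
        ∀ d : ℕ, d ≤ n →
          ∀ S : Set (Matrix.GeneralLinearGroup (Fin d) K), 1 ∈ S →
            (¬ ∃ H : Subgroup ↥(Subgroup.closure S), H.FiniteIndex ∧ Group.IsNilpotent ↥H) →
            ∃ a ∈ S ^ m, ∃ b ∈ S ^ m, FreePair a b := by
  choose mQ IQ hQ using GOODQ
  choose mp hp using GOODp
  let m := 1 + ∑ N ∈ Finset.range (n*n+1), (mQ N + mp N)
  refine ⟨m, by omega, ?_⟩
  intro K _ F hfd hrk ⟨T, hT, hcl⟩ d hd S h1S hnv
  obtain ⟨N, hN, j, hj⟩ : ∃ N, N = Module.finrank F (Fin d → K) ∧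
      ∃ j : Matrix.GeneralLinearGroup (Fin d) K →* Matrix.GeneralLinearGroup (Fin N) F,
        Function.Injective j := ⟨_, rfl, embed K F d⟩
  have hNn : N ≤ n * n := by
    rw [hN, Module.finrank_pi_fintype]
    simp only [Finset.sum_const, Finset.card_univ, Fintype.card_fin, smul_eq_mul]
    exact Nat.mul_le_mul hd hrk
  have hsum : mQ N + mp N ≤ m := by
    have : mQ N + mp N ≤ ∑ N ∈ Finset.range (n*n+1), (mQ N + mp N) :=
      Finset.single_le_sum (f := fun N => mQ N + mp N) (fun _ _ => Nat.zero_le _)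
        (Finset.mem_range.mpr (by omega))
    omega
  let Γ := Subgroup.closure S
  let S' : Set Γ := Γ.subtype ⁻¹' S
  have hSim : Γ.subtype '' S' = S := by
    apply Set.image_preimage_eq_of_subset
    intro s hs
    exact ⟨⟨s, Subgroup.subset_closure hs⟩, rfl⟩
  by_contra hfree
  have hfree' : ∀ k ≤ m, ¬ ∃ a ∈ S' ^ k, ∃ b ∈ S' ^ k, FreePair a b := by
    rintro k hk ⟨a, ha, b, hb, hab⟩
    apply hfree
    have hmem : ∀ c ∈ S' ^ k, (c : Matrix.GeneralLinearGroup (Fin d) K) ∈ S ^ m := by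
      intro c hc
      have : Γ.subtype c ∈ Γ.subtype '' (S' ^ k) := ⟨c, hc, rfl⟩
      rw [Set.image_pow, hSim] at this
      exact mem_pow_mono h1S hk this
    exact ⟨a, hmem a ha, b, hmem b hb, FreePair.map_inj Γ.subtype (Subgroup.subtype_injective _) hab⟩
  have key : ∃ H : Subgroup Γ, H.index ≠ 0 ∧ ∀ x : ℕ → Γ, (∀ i, x i ∈ H) → ic x N = 1 := by
    have hjj : Function.Injective (j.comp Γ.subtype) := hj.comp (Subgroup.subtype_injective _)
    have hS'cl : Subgroup.closure S' = ⊤ := Subgroup.closure_closure_coe_preimage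
    have h1S' : (1 : Γ) ∈ S' := h1S
    rcases prime_cases F with ⟨⟨ι0⟩⟩ | ⟨p, hpf, ⟨ι0⟩⟩
    · exact TRANSFER F T hT hcl ℚ ι0 N (mQ N) N (IQ N) (hQ N) Γ (j.comp Γ.subtype) hjj S' h1S' hS'cl
        (hfree' _ (by omega))
    · obtain ⟨I, hI⟩ := hp N p
      have : Infinite (RatFunc (ZMod p)) :=
        Infinite.of_injective _ (RatFunc.algebraMap_injective (ZMod p))
      exact TRANSFER F T hT hcl (RatFunc (ZMod p)) ι0 N (mp N) N I hI Γ (j.comp Γ.subtype) hjj S' h1S' hS'cl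
        (hfree' _ (by omega))
  obtain ⟨H, hH0, hHic⟩ := key
  refine hnv ⟨H, ⟨hH0⟩, ?_⟩
  apply nilpotent_of_ic N H
  intro x
  apply Subtype.ext
  have := ic_map H.subtype x N
  exact this.trans (hHic _ (fun i => (x i).2))

end UPI
end

open Matrix Pointwise

/-- **Uniform positive independence over fields of bounded type.** For every `n ≥ 1` there is
`m ≥ 1` such that whenever `𝕂` is a field which is an extension of degree at most `n` of a
subfield `F` that is purely transcendental over its prime subfield, `d ≤ n`, and
`S ⊆ GL_d(𝕂)` contains `1` and generates a group that is not virtually nilpotent, then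
`S ^ m` contains two elements generating a free semigroup. -/
theorem uniform_positive_independence_bounded_type (n : ℕ) (hn : 1 ≤ n) :
    ∃ m : ℕ, 1 ≤ m ∧
      ∀ (𝕂 : Type) [Field 𝕂] (F : Subfield 𝕂),
        FiniteDimensional F 𝕂 → Module.finrank F 𝕂 ≤ n →
        -- `F` is purely transcendental over its prime subfield `⊥`:
        (∃ T : Set F, AlgebraicIndependent (⊥ : Subfield F) ((↑) : T → F) ∧
          Subfield.closure T = ⊤) →
        ∀ d : ℕ, d ≤ n →
          ∀ S : Set (GL (Fin d) 𝕂), (1 : GL (Fin d) 𝕂) ∈ S →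
            (¬ ∃ H : Subgroup ↥(Subgroup.closure S), H.FiniteIndex ∧ Group.IsNilpotent ↥H) →
            ∃ a ∈ S ^ m, ∃ b ∈ S ^ m,
              Function.Injective
                (FreeMonoid.lift ![a, b] : FreeMonoid (Fin 2) →* GL (Fin d) 𝕂) := by
  exact UPI.FINAL n
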